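/- Let m, α > 0 and let U : ℝ × ℝ³ → ℝ be a C¹ function, T-periodic in the first variable, with U(t,x) > 0 for every (t,x) ∈ ℝ × ℝ³ and such that |U(t,x)| + |∇_x U(t,x)| → 0 as |x| → ∞, uniformly in t ∈ ℝ. Then the forced relativistic Kepler equation d/dt( m ẋ / √(1 − |ẋ|²/c²) ) = −α x/|x|³ + ∇_x U(t,x), x ∈ ℝ³, has infinitely many T-periodic classical solutions x : ℝ → ℝ³ with x(t) ≠ 0 for all t. -/

import Mathlib

open Function

noncomputable section

/-- `ℝ³` with the Euclidean norm. -/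
abbrev E3 : Type := EuclideanSpace ℝ (Fin 3)

/-- A partition of the plane of the first two coordinates into three sectors meeting at `0`. -/
def sector (x : E3) : Fin 3 := if 0 < x 0 then 0 else if 0 < x 1 then 1 else 2

open scoped Classical in
/-- Parity cochain detecting whether a small triangle meets the half axis `{s * x₂ > 0}`. -/
def axisHit (s : ℝ) (x y z : E3) : ZMod 2 :=
  if (sector x ≠ sector y ∧ sector y ≠ sector z ∧ sector x ≠ sector z) ∧
    0 < s * x 2 ∧ 0 < s * y 2 ∧ 0 < s * z 2 then 1 else 0

/-- Parity of the half axis crossings of the strip swept between two discrete paths during one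
time step. -/
def stripHit (s : ℝ) (x y : ℕ → E3) (t : ℕ) : ZMod 2 :=
  axisHit s (x t) (y t) (y (t + 1)) + axisHit s (x t) (x (t + 1)) (y (t + 1))

/-- Discrete iterated integral counting staircases whose successive jumps cross the two half
axes alternately. -/
def staircase : ℕ → ℕ → (ℕ → ℕ → E3) → ZMod 2
  | 0, _, _ => 1
  | n + 1, J, y => ∑ t ∈ Finset.range J,
      staircase n t y * stripHit ((-1) ^ n) (y n) (y (n + 1)) t

/-- The `m`-th face map. -/
def skip (m i : ℕ) : ℕ := if i < m then i else i + 1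

lemma coord_abs_le (x : E3) (i : Fin 3) : |x i| ≤ ‖x‖ := by
  simpa using PiLp.norm_apply_le x i

lemma norm_sq_eq (x : E3) : ‖x‖ ^ 2 = x 0 ^ 2 + x 1 ^ 2 + x 2 ^ 2 := by
  rw [EuclideanSpace.norm_sq_eq]; simp [Fin.sum_univ_three]

lemma sector_cases (x : E3) : (sector x = 0 ∧ 0 < x 0) ∨ (sector x = 1 ∧ x 0 ≤ 0 ∧ 0 < x 1) ∨
    (sector x = 2 ∧ x 0 ≤ 0 ∧ x 1 ≤ 0) := by
  unfold sector
  split_ifs with h1 h2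
  · left; exact ⟨rfl, h1⟩
  · right; left; exact ⟨rfl, by linarith, h2⟩
  · right; right; exact ⟨rfl, by linarith, by linarith⟩

lemma coord_sub_le {x y : E3} {ε : ℝ} (h : ‖x - y‖ ≤ ε) (i : Fin 3) : |x i - y i| ≤ ε := by
  have := coord_abs_le (x - y) i
  simp only [PiLp.sub_apply] at this
  linarith

lemma near_axis_of_sectors {x y z : E3} {ε : ℝ} (hxy : ‖x - y‖ ≤ ε) (hyz : ‖y - z‖ ≤ ε)
    (hxz : ‖x - z‖ ≤ ε)
    (h : sector x ≠ sector y ∧ sector y ≠ sector z ∧ sector x ≠ sector z) :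
    |x 0| ≤ ε ∧ |x 1| ≤ ε := by
  have a0 := abs_le.1 (coord_sub_le hxy 0)
  have a1 := abs_le.1 (coord_sub_le hxy 1)
  have b0 := abs_le.1 (coord_sub_le hyz 0)
  have b1 := abs_le.1 (coord_sub_le hyz 1)
  have c0 := abs_le.1 (coord_sub_le hxz 0)
  have c1 := abs_le.1 (coord_sub_le hxz 1)
  obtain ⟨h1, h2, h3⟩ := h
  rw [abs_le, abs_le]
  rcases sector_cases x with ⟨p, p'⟩ | ⟨p, p', p''⟩ | ⟨p, p', p''⟩ <;>
  rcases sector_cases y with ⟨q, q'⟩ | ⟨q, q', q''⟩ | ⟨q, q', q''⟩ <;>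
  rcases sector_cases z with ⟨r, r'⟩ | ⟨r, r', r''⟩ | ⟨r, r', r''⟩ <;>
  simp only [p, q, r, ne_eq, not_true_eq_false] at h1 h2 h3 <;>
  refine ⟨⟨?_, ?_⟩, ?_, ?_⟩ <;> linarith

lemma axisHit_ne_zero_iff {s : ℝ} {x y z : E3} : axisHit s x y z ≠ 0 ↔
    (sector x ≠ sector y ∧ sector y ≠ sector z ∧ sector x ≠ sector z) ∧
    0 < s * x 2 ∧ 0 < s * y 2 ∧ 0 < s * z 2 := by
  unfold axisHit
  split_ifs with h
  · simpa using h
  · simpa using h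

/-- A triangle far from the origin that meets an axis is far from the opposite half axis. -/
lemma height_of_near_axis {x : E3} {ε : ℝ} (hε : 0 < ε) (hx : 10 * ε ≤ ‖x‖)
    (h : |x 0| ≤ ε ∧ |x 1| ≤ ε) : 9 * ε ≤ |x 2| := by
  have h0 := sq_le_sq' (abs_le.1 h.1).1 (abs_le.1 h.1).2
  have h1 := sq_le_sq' (abs_le.1 h.2).1 (abs_le.1 h.2).2
  have := norm_sq_eq x
  have h2 : (10 * ε) ^ 2 ≤ ‖x‖ ^ 2 := by gcongr
  have : (9 * ε) ^ 2 ≤ x 2 ^ 2 := by nlinarith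
  have := sq_le_sq.1 this
  rwa [abs_of_pos (by positivity)] at this

lemma height_of_axisHit {s : ℝ} (hs : s = 1 ∨ s = -1) {x y z : E3} {ε : ℝ} (hε : 0 < ε)
    (hx : 10 * ε ≤ ‖x‖)
    (hxy : ‖x - y‖ ≤ ε) (hyz : ‖y - z‖ ≤ ε) (hxz : ‖x - z‖ ≤ ε)
    (h : axisHit s x y z ≠ 0) : 9 * ε ≤ s * x 2 := by
  rw [axisHit_ne_zero_iff] at h
  have h1 := height_of_near_axis hε hx (near_axis_of_sectors hxy hyz hxz h.1)
  have h2 : |s * x 2| = |x 2| := by rcases hs with rfl | rfl <;> simp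
  rw [← abs_of_pos h.2.1, h2]; exact h1

lemma axisHit_tetra_aux (s : ℝ) (x y z w : E3)
    (h : ∀ a ∈ ({x, y, z, w} : Set E3), 0 < s * a 2) :
    axisHit s x y z + axisHit s x y w + axisHit s x z w + axisHit s y z w = 0 := by
  have hx := h x (by simp)
  have hy := h y (by simp)
  have hz := h z (by simp)
  have hw := h w (by simp)
  unfold axisHit
  simp only [hx, hy, hz, hw, and_true]
  generalize sector x = a
  generalize sector y = b
  generalize sector z = c
  generalize sector w = d
  clear hx hy hz hw h
  revert a b c d
  decide

lemma height_transfer {s : ℝ} (hs : s = 1 ∨ s = -1) {x y : E3} {ε : ℝ} (hε : 0 < ε)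
    (h : 9 * ε ≤ s * x 2) (hxy : ‖x - y‖ ≤ ε) : 0 < s * y 2 := by
  have := abs_le.1 (coord_sub_le hxy 2)
  rcases hs with rfl | rfl <;> linarith

lemma axisHit_tetra {s : ℝ} (hs : s = 1 ∨ s = -1) {ε : ℝ} (hε : 0 < ε) {S : Set E3}
    (hS : ∀ a ∈ S, 10 * ε ≤ ‖a‖) (hd : ∀ a ∈ S, ∀ b ∈ S, ‖a - b‖ ≤ ε)
    {x y z w : E3} (hx : x ∈ S) (hy : y ∈ S) (hz : z ∈ S) (hw : w ∈ S) :
    axisHit s x y z + axisHit s x y w + axisHit s x z w + axisHit s y z w = 0 := by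
  have key : ∀ a ∈ S, ∀ b ∈ S, ∀ c ∈ S, axisHit s a b c ≠ 0 →
      axisHit s x y z + axisHit s x y w + axisHit s x z w + axisHit s y z w = 0 := by
    intro a ha b hb c hc h
    have h9 := height_of_axisHit hs hε (hS a ha) (hd a ha b hb) (hd b hb c hc) (hd a ha c hc) h
    apply axisHit_tetra_aux
    intro d hd'
    have : d ∈ S := by
      simp only [Set.mem_insert_iff, Set.mem_singleton_iff] at hd'
      rcases hd' with rfl | rfl | rfl | rfl <;> assumption
    exact height_transfer hs hε h9 (hd a ha d this)
  by_contra hne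
  have h1 : axisHit s x y z = 0 := by by_contra h; exact hne (key x hx y hy z hz h)
  have h2 : axisHit s x y w = 0 := by by_contra h; exact hne (key x hx y hy w hw h)
  have h3 : axisHit s x z w = 0 := by by_contra h; exact hne (key x hx z hz w hw h)
  have h4 : axisHit s y z w = 0 := by by_contra h; exact hne (key y hy z hz w hw h)
  simp [h1, h2, h3, h4] at hne

lemma axisHit_mul_neg {s : ℝ} (hs : s = 1 ∨ s = -1) {ε : ℝ} (hε : 0 < ε) {S : Set E3}
    (hS : ∀ a ∈ S, 10 * ε ≤ ‖a‖) (hd : ∀ a ∈ S, ∀ b ∈ S, ‖a - b‖ ≤ ε)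
    {x y z x' y' z' : E3} (hx : x ∈ S) (hy : y ∈ S) (hz : z ∈ S) (hx' : x' ∈ S) :
    axisHit s x y z * axisHit (-s) x' y' z' = 0 := by
  by_contra h
  obtain ⟨h1, h2⟩ := mul_ne_zero_iff.1 h
  have h9 := height_of_axisHit hs hε (hS x hx) (hd x hx y hy) (hd y hy z hz) (hd x hx z hz) h1
  have := height_transfer hs hε h9 (hd x hx x' hx')
  have := (axisHit_ne_zero_iff.1 h2).2.1
  linarith

lemma axisHit_self_left (s : ℝ) (x z : E3) : axisHit s x x z = 0 := by
  unfold axisHit; simp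

lemma axisHit_self_right (s : ℝ) (x z : E3) : axisHit s x z z = 0 := by
  unfold axisHit; simp

/-- A family of discrete paths that stays at every time step in a set of small diameter away
from the origin. -/
structure SmallChain (ε : ℝ) (L : ℕ) (y : ℕ → ℕ → E3) : Prop where
  pos : 0 < ε
  far : ∀ i t, t ≤ L → 10 * ε ≤ ‖y i t‖
  close : ∀ i j t, t < L → ∀ a ∈ ({t, t + 1} : Set ℕ), ∀ b ∈ ({t, t + 1} : Set ℕ),
    ‖y i a - y j b‖ ≤ ε
  start : ∀ i, 0 < y i 0 0

lemma neg_one_pow_cases (n : ℕ) : ((-1 : ℝ)) ^ n = 1 ∨ ((-1 : ℝ)) ^ n = -1 := neg_one_pow_eq_or ℝ n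

namespace SmallChain

variable {ε : ℝ} {L : ℕ} {y : ℕ → ℕ → E3}

/-- The points of the chain during one time step. -/
def slab (y : ℕ → ℕ → E3) (t : ℕ) : Set E3 := {p | ∃ i, p = y i t ∨ p = y i (t + 1)}

lemma mem_slab (i t : ℕ) : y i t ∈ slab y t := ⟨i, Or.inl rfl⟩

lemma mem_slab_succ (i t : ℕ) : y i (t + 1) ∈ slab y t := ⟨i, Or.inr rfl⟩

lemma slab_far (h : SmallChain ε L y) {t : ℕ} (ht : t < L) : ∀ a ∈ slab y t, 10 * ε ≤ ‖a‖ := by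
  rintro a ⟨i, rfl | rfl⟩
  · exact h.far i t ht.le
  · exact h.far i (t + 1) ht

lemma slab_close (h : SmallChain ε L y) {t : ℕ} (ht : t < L) :
    ∀ a ∈ slab y t, ∀ b ∈ slab y t, ‖a - b‖ ≤ ε := by
  rintro a ⟨i, rfl | rfl⟩ b ⟨j, rfl | rfl⟩ <;> exact h.close i j t ht _ (by simp) _ (by simp)

lemma stripHit_cocycle (h : SmallChain ε L y) {s : ℝ} (hs : s = 1 ∨ s = -1) {t : ℕ} (ht : t < L)
    (i j k : ℕ) :
    stripHit s (y j) (y k) t + stripHit s (y i) (y k) t + stripHit s (y i) (y j) t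
      = axisHit s (y i (t + 1)) (y j (t + 1)) (y k (t + 1)) + axisHit s (y i t) (y j t) (y k t) := by
  have e1 := axisHit_tetra hs h.pos (h.slab_far ht) (h.slab_close ht)
    (mem_slab i t) (mem_slab j t) (mem_slab k t) (mem_slab_succ k t)
  have e2 := axisHit_tetra hs h.pos (h.slab_far ht) (h.slab_close ht)
    (mem_slab i t) (mem_slab j t) (mem_slab_succ j t) (mem_slab_succ k t)
  have e3 := axisHit_tetra hs h.pos (h.slab_far ht) (h.slab_close ht)
    (mem_slab i t) (mem_slab_succ i t) (mem_slab_succ j t) (mem_slab_succ k t)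
  unfold stripHit
  have two : (2 : ZMod 2) = 0 := rfl
  linear_combination e1 + e2 + e3 - (axisHit s (y i t) (y j t) (y k t)
    + axisHit s (y i t) (y j t) (y k (t+1)) + axisHit s (y i t) (y j (t+1)) (y k (t+1))
    + axisHit s (y i (t+1)) (y j (t+1)) (y k (t+1))) * two

lemma axisHit_mul_stripHit (h : SmallChain ε L y) {s : ℝ} (hs : s = 1 ∨ s = -1) {t : ℕ}
    (ht : t < L) {a b c : E3} (ha : a ∈ slab y t) (hb : b ∈ slab y t) (hc : c ∈ slab y t)
    (i j : ℕ) : axisHit s a b c * stripHit (-s) (y i) (y j) t = 0 := by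
  unfold stripHit
  rw [mul_add, axisHit_mul_neg hs h.pos (h.slab_far ht) (h.slab_close ht) ha hb hc (mem_slab i t),
    axisHit_mul_neg hs h.pos (h.slab_far ht) (h.slab_close ht) ha hb hc (mem_slab i t), add_zero]

end SmallChain

lemma staircase_congr {n J : ℕ} {y z : ℕ → ℕ → E3} (h : ∀ i ≤ n, y i = z i) :
    staircase n J y = staircase n J z := by
  induction n generalizing J with
  | zero => rfl
  | succ n ih =>
    simp only [staircase]
    refine Finset.sum_congr rfl fun t _ => ?_
    rw [ih fun i hi => h i (by omega), h n (by omega), h (n + 1) le_rfl]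

lemma staircase_zero_time (n : ℕ) (y : ℕ → ℕ → E3) : staircase (n + 1) 0 y = 0 := by
  simp [staircase]

lemma staircase_succ_time (n J : ℕ) (y : ℕ → ℕ → E3) :
    staircase (n + 1) (J + 1) y
      = staircase (n + 1) J y + staircase n J y * stripHit ((-1) ^ n) (y n) (y (n + 1)) J := by
  simp [staircase, Finset.sum_range_succ]

lemma axisHit_of_sector_zero {s : ℝ} {x y z : E3} (hx : 0 < x 0) (hy : 0 < y 0) :
    axisHit s x y z = 0 := by
  have : sector x = sector y := by simp [sector, hx, hy]
  unfold axisHit; simp [this]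

lemma skip_of_lt {m i : ℕ} (h : i < m) : skip m i = i := by simp [skip, h]

lemma skip_of_le {m i : ℕ} (h : m ≤ i) : skip m i = i + 1 := by simp [skip, Nat.not_lt.2 h]

/-- Discrete Stokes formula for the iterated integral. -/
lemma SmallChain.sum_faces {ε : ℝ} {L : ℕ} {y : ℕ → ℕ → E3} (h : SmallChain ε L y) (n : ℕ) :
    ∀ J ≤ L, ∑ m ∈ Finset.range (n + 3), staircase (n + 1) J (fun i => y (skip m i))
      = staircase n J y * axisHit ((-1) ^ n) (y n J) (y (n + 1) J) (y (n + 2) J) := by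
  have aux : ∀ n J, J < L → ∀ a ∈ ({J, J + 1} : Set ℕ), ∀ i j k,
      (staircase (n + 1) (J + 1) y - staircase (n + 1) J y) *
        axisHit ((-1) ^ (n + 1)) (y i a) (y j a) (y k a) = 0 := by
    intro n J hJ a ha i j k
    rw [staircase_succ_time, add_sub_cancel_left, mul_assoc]
    have hm : ∀ i, y i a ∈ slab y J := by
      intro i
      rcases ha with rfl | ha
      · exact mem_slab i _
      · rw [Set.mem_singleton_iff.1 ha]; exact mem_slab_succ i J
    have := h.axisHit_mul_stripHit (s := (-1) ^ (n + 1)) (neg_one_pow_cases _) hJ (hm i) (hm j)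
      (hm k) n (n + 1)
    rw [pow_succ, mul_neg_one, neg_neg, mul_comm] at this
    rw [pow_succ, mul_neg_one, this, mul_zero]
  induction n with
  | zero =>
    intro J hJ
    induction J with
    | zero =>
      simp [staircase, axisHit_of_sector_zero (h.start 0) (h.start 1)]
    | succ J ih =>
      have ih := ih (by omega)
      have hc := h.stripHit_cocycle (s := 1) (Or.inl rfl) (t := J) (by omega) 0 1 2
      simp only [staircase_succ_time, Finset.sum_add_distrib, ih]
      simp only [staircase, one_mul, pow_zero, Finset.sum_range_succ, Finset.range_zero,
        Finset.sum_empty, zero_add, skip]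
      have two : (2 : ZMod 2) = 0 := rfl
      simp only [Nat.not_lt_zero, if_false, Nat.lt_irrefl, Nat.zero_lt_one, if_true,
        Nat.reduceLT, Nat.reduceAdd]
      linear_combination hc + axisHit 1 (y 0 J) (y 1 J) (y 2 J) * two
  | succ n ih =>
    intro J hJ
    induction J with
    | zero => simp [staircase_zero_time]
    | succ J ihJ =>
      have ihJ := ihJ (by omega)
      simp only [staircase_succ_time (n + 1) J, Finset.sum_add_distrib, ihJ]
      have hc := h.stripHit_cocycle (s := (-1) ^ (n + 1)) (neg_one_pow_cases _) (t := J) (by omega)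
        (n + 1) (n + 2) (n + 3)
      have ihn := ih J (by omega)
      rw [Finset.sum_range_succ] at ihn
      have e0 : staircase (n + 1) J (fun i => y (skip (n + 2) i)) = staircase (n + 1) J y :=
        staircase_congr fun i hi => by rw [skip_of_lt (by omega)]
      have e1 : staircase (n + 1) J (fun i => y (skip (n + 3) i)) = staircase (n + 1) J y :=
        staircase_congr fun i hi => by rw [skip_of_lt (by omega)]
      have e2 : ∑ m ∈ Finset.range (n + 2), staircase (n + 1) J (fun i => y (skip m i)) *
            stripHit ((-1) ^ (n + 1)) (y (skip m (n + 1))) (y (skip m (n + 1 + 1))) J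
          = (∑ m ∈ Finset.range (n + 2), staircase (n + 1) J (fun i => y (skip m i))) *
            stripHit ((-1) ^ (n + 1)) (y (n + 2)) (y (n + 3)) J := by
        rw [Finset.sum_mul]
        refine Finset.sum_congr rfl fun m hm => ?_
        have := Finset.mem_range.1 hm
        rw [skip_of_le (by omega), skip_of_le (by omega)]
      rw [Finset.sum_range_succ, Finset.sum_range_succ, e2, e0, e1, skip_of_lt (by omega),
        skip_of_le (by omega : n + 2 ≤ n + 1 + 1), skip_of_lt (by omega), skip_of_lt (by omega)]
      rw [e0] at ihn
      have hz := h.axisHit_mul_stripHit (s := (-1) ^ n) (neg_one_pow_cases _) (t := J) (by omega)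
        (mem_slab n J) (mem_slab (n + 1) J) (mem_slab (n + 2) J) (n + 2) (n + 3)
      have ha := aux n J (by omega) (J + 1) (by simp) (n + 1) (n + 2) (n + 3)
      have two : (2 : ZMod 2) = 0 := rfl
      rw [show ((-1 : ℝ)) ^ n = -(-1) ^ (n + 1) by ring, neg_neg] at hz
      rw [show ((-1 : ℝ)) ^ n = -(-1) ^ (n + 1) by ring] at ihn
      simp only [show n + 1 + 1 = n + 2 from rfl, show n + 1 + 2 = n + 3 from rfl]
      rw [staircase_succ_time] at ha ⊢
      linear_combination stripHit ((-1) ^ (n + 1)) (y (n + 2)) (y (n + 3)) J * ihn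
        + staircase n J y * hz + staircase (n + 1) J y * hc - ha
        + (staircase (n + 1) J y * axisHit ((-1) ^ (n + 1)) (y (n + 1) J) (y (n + 2) J)
          (y (n + 3) J) - staircase (n + 1) J y *
          stripHit ((-1) ^ (n + 1)) (y (n + 2)) (y (n + 3)) J) * two

/-- The indicator of a vertex of the unit cube, as a displacement in the discrete torus. -/
def cubeStep {n : ℕ} (K : ℕ) (S : Fin n → Prop) [DecidablePred S] : Fin n → ZMod K :=
  fun j => if S j then 1 else 0

/-- The value of the discrete iterated integral on the fundamental class of the torus
`(ZMod K) ^ n`, triangulated by the standard simplicial subdivision of the cubes. -/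
def torusCount (n K L : ℕ) [NeZero K] (G : (Fin n → ZMod K) → ℕ → E3) : ZMod 2 :=
  ∑ τ : Equiv.Perm (Fin (n + 1)) with τ (Fin.last n) = Fin.last n, ∑ v : Fin n → ZMod K,
    staircase n L (fun i => G (v + cubeStep K fun j => (τ j.castSucc).val < i))

/-- Two discrete families of paths that are close to each other and vary little on cubes. -/
structure GridClose {n K : ℕ} (ε : ℝ) (L : ℕ) (G : Bool → (Fin n → ZMod K) → ℕ → E3) :
    Prop where
  pos : 0 < ε
  far : ∀ b v t, t ≤ L → 10 * ε ≤ ‖G b v t‖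
  close : ∀ v (S S' : Fin n → Prop) [DecidablePred S] [DecidablePred S'] b b' t, t < L →
    ∀ t₁ ∈ ({t, t + 1} : Set ℕ), ∀ t₂ ∈ ({t, t + 1} : Set ℕ),
    ‖G b (v + cubeStep K S) t₁ - G b' (v + cubeStep K S') t₂‖ ≤ ε
  start : ∀ b v, 0 < G b v 0 0
  terminal : ∀ b v, 0 < G b v L 0

/-- The path in the prism over the cube at `v` determined by an ordering of the directions. -/
def prismPath {n K : ℕ} (G : Bool → (Fin n → ZMod K) → ℕ → E3) (τ : Equiv.Perm (Fin (n + 1)))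
    (v : Fin n → ZMod K) (i : ℕ) : ℕ → E3 :=
  G (decide ((τ (Fin.last n)).val < i)) (v + cubeStep K fun j => (τ j.castSucc).val < i)

lemma GridClose.smallChain {n K L : ℕ} {ε : ℝ} {G : Bool → (Fin n → ZMod K) → ℕ → E3}
    (h : GridClose ε L G) (τ : Equiv.Perm (Fin (n + 1))) (v : Fin n → ZMod K) :
    SmallChain ε L (prismPath G τ v) where
  pos := h.pos
  far _ t ht := h.far _ _ t ht
  close _ _ t ht a ha b hb := h.close v _ _ _ _ t ht a ha b hb
  start _ := h.start _ _

lemma sum_prismPath_interior {n K : ℕ} (G : Bool → (Fin n → ZMod K) → ℕ → E3) (L : ℕ)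
    (v : Fin n → ZMod K) {m : ℕ} (hm : m + 1 < n + 1) :
    ∑ τ : Equiv.Perm (Fin (n + 1)), staircase n L (fun i => prismPath G τ v (skip (m + 1) i))
      = 0 := by
  set s : Equiv.Perm (Fin (n + 1)) := Equiv.swap ⟨m, by omega⟩ ⟨m + 1, hm⟩ with hs
  have hlt : ∀ (x : Fin (n + 1)) (k : ℕ), k ≠ m + 1 → ((s x).val < k ↔ x.val < k) := by
    intro x k hk
    rw [hs, Equiv.swap_apply_def]
    split_ifs with h1 h2
    · subst h1; simp only; omega
    · subst h2; simp only; omega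
    · rfl
  have hskip : ∀ i, skip (m + 1) i ≠ m + 1 := by
    intro i; unfold skip; split_ifs <;> omega
  refine Finset.sum_involution (fun τ _ => s * τ) ?_ ?_ (fun _ _ => Finset.mem_univ _) ?_
  · intro τ _
    have : (fun i => prismPath G (s * τ) v (skip (m + 1) i))
        = fun i => prismPath G τ v (skip (m + 1) i) := by
      funext i
      unfold prismPath cubeStep
      simp only [Equiv.Perm.mul_apply, hlt _ _ (hskip i)]
    rw [this]
    exact CharTwo.add_self_eq_zero _
  · intro τ _ _ h
    have : s = 1 := by simpa using h
    have h2 := congrArg (fun e : Equiv.Perm (Fin (n + 1)) => (e ⟨m, by omega⟩).val) this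
    simp [hs] at h2
  · intro τ _
    rw [← mul_assoc, hs, Equiv.swap_mul_self, one_mul]

lemma finRotate_symm_lt {n : ℕ} (x : Fin (n + 1)) (i : ℕ) :
    x.val < i + 1 ↔ (x = 0 ∨ ((finRotate (n + 1)).symm x).val < i) := by
  obtain ⟨y, rfl⟩ := (finRotate (n + 1)).surjective x
  rw [Equiv.symm_apply_apply]
  have h0 : finRotate (n + 1) y = 0 ↔ y = Fin.last n := by
    rw [← finRotate_last, (finRotate (n + 1)).injective.eq_iff]
  rw [h0, coe_finRotate]
  split_ifs with h
  · simp [h]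
  · simp [h]

lemma sum_prismPath_ends {n K : ℕ} [NeZero K] (G : Bool → (Fin n → ZMod K) → ℕ → E3) (L : ℕ)
    (τ : Equiv.Perm (Fin (n + 1))) :
    ∑ v, staircase n L (fun i => prismPath G (finRotate (n + 1) * τ) v (skip 0 i))
      + ∑ v, staircase n L (fun i => prismPath G τ v (skip (n + 1) i))
    = if τ (Fin.last n) = Fin.last n then
        ∑ v, staircase n L (fun i => G true (v + cubeStep K fun j => (τ j.castSucc).val < i))
        + ∑ v, staircase n L (fun i => G false (v + cubeStep K fun j => (τ j.castSucc).val < i))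
      else 0 := by
  have h0 : ∀ j, finRotate (n + 1) (τ j) = 0 ↔ τ j = Fin.last n := fun j => by
    rw [← finRotate_last, (finRotate (n + 1)).injective.eq_iff]
  have hrot : ∀ j i, ((finRotate (n + 1)) (τ j)).val < i + 1 ↔
      (τ j = Fin.last n ∨ (τ j).val < i) := by
    intro j i
    rw [finRotate_symm_lt, h0, Equiv.symm_apply_apply]
  split_ifs with h
  · have hne : ∀ j : Fin n, τ j.castSucc ≠ Fin.last n := fun j hj => by
      rw [← h, τ.injective.eq_iff] at hj; exact (Fin.castSucc_lt_last j).ne hj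
    congr 1
    · refine Finset.sum_congr rfl fun v _ => staircase_congr fun i hi => ?_
      unfold prismPath cubeStep
      simp only [skip_of_le (Nat.zero_le i), Equiv.Perm.mul_apply, hrot, hne, false_or]
      rw [decide_eq_true (by simp [h])]
    · refine Finset.sum_congr rfl fun v _ => staircase_congr fun i hi => ?_
      unfold prismPath
      rw [skip_of_lt (by omega), h, decide_eq_false (by simp [hi])]
  · obtain ⟨j0, hj0⟩ : ∃ j0 : Fin n, τ j0.castSucc = Fin.last n := by
      obtain ⟨x, hx⟩ := τ.surjective (Fin.last n)
      have : x ≠ Fin.last n := fun e => h (e ▸ hx)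
      exact ⟨x.castPred this, by simpa using hx⟩
    have key : ∑ v, staircase n L (fun i => prismPath G (finRotate (n + 1) * τ) v (skip 0 i))
        = ∑ v, staircase n L (fun i => prismPath G τ v (skip (n + 1) i)) := by
      rw [← Equiv.sum_comp (Equiv.addRight (Pi.single j0 (1 : ZMod K)))
        (fun v => staircase n L (fun i => prismPath G τ v (skip (n + 1) i)))]
      refine Finset.sum_congr rfl fun v _ => staircase_congr fun i hi => ?_
      unfold prismPath
      rw [skip_of_le (Nat.zero_le i), skip_of_lt (by omega : i < n + 1)]
      simp only [Equiv.Perm.mul_apply, hrot, h, false_or, Equiv.coe_addRight, add_assoc]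
      congr 2
      funext j
      simp only [cubeStep, Pi.add_apply, hrot]
      by_cases hj : j = j0
      · subst hj
        have : ¬ n < i := by omega
        simp [hj0, this]
      · have : τ j.castSucc ≠ Fin.last n := fun e => hj <| by
          rw [← hj0, τ.injective.eq_iff] at e; simpa using e
        simp [hj, this]
    rw [key]
    exact CharTwo.add_self_eq_zero _

/-- The count is unchanged when the discrete family is moved a little. -/
theorem GridClose.torusCount_eq {n K L : ℕ} [NeZero K] {ε : ℝ}
    {G : Bool → (Fin (n + 1) → ZMod K) → ℕ → E3} (h : GridClose ε L G) :
    torusCount (n + 1) K L (G true) = torusCount (n + 1) K L (G false) := by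
  have hfaces : ∀ τ v, ∑ m ∈ Finset.range (n + 3),
      staircase (n + 1) L (fun i => prismPath G τ v (skip m i)) = 0 := fun τ v => by
    rw [(h.smallChain τ v).sum_faces n L le_rfl, prismPath, prismPath,
      axisHit_of_sector_zero (h.terminal _ _) (h.terminal _ _), mul_zero]
  have htot : ∑ τ, ∑ v, ∑ m ∈ Finset.range (n + 3),
      staircase (n + 1) L (fun i => prismPath G τ v (skip m i)) = 0 :=
    Finset.sum_eq_zero fun τ _ => Finset.sum_eq_zero fun v _ => hfaces τ v
  have hint : ∑ τ, ∑ v, ∑ m ∈ Finset.range (n + 1),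
      staircase (n + 1) L (fun i => prismPath G τ v (skip (m + 1) i)) = 0 := by
    rw [Finset.sum_comm]
    refine Finset.sum_eq_zero fun v _ => ?_
    rw [Finset.sum_comm]
    exact Finset.sum_eq_zero fun m hm =>
      sum_prismPath_interior G L v (by have := Finset.mem_range.1 hm; omega)
  simp only [Finset.sum_range_succ _ (n + 2), Finset.sum_range_succ' _ (n + 1),
    Finset.sum_add_distrib, hint, zero_add] at htot
  rw [← Equiv.sum_comp (Equiv.mulLeft (finRotate (n + 2)))
    (fun τ => ∑ v, staircase (n + 1) L (fun i => prismPath G τ v (skip 0 i))),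
    ← Finset.sum_add_distrib] at htot
  simp only [Equiv.coe_mulLeft, sum_prismPath_ends] at htot
  rw [← Finset.sum_filter, Finset.sum_add_distrib] at htot
  exact CharTwo.add_eq_zero.1 htot

/-- A nonzero iterated integral yields alternate crossings of the two half axes. -/
lemma exists_strictMono_of_staircase_ne_zero {n L : ℕ} {y : ℕ → ℕ → E3}
    (h : staircase n L y ≠ 0) : ∃ t : ℕ → ℕ, (∀ i < n, t i < L) ∧
      (∀ i j, i < j → j < n → t i < t j) ∧
      ∀ i < n, stripHit ((-1) ^ i) (y i) (y (i + 1)) (t i) ≠ 0 := by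
  induction n generalizing L with
  | zero => exact ⟨fun _ => 0, by simp, by simp, by simp⟩
  | succ n ih =>
    obtain ⟨k, hk, hne⟩ := Finset.exists_ne_zero_of_sum_ne_zero h
    obtain ⟨h1, h2⟩ := mul_ne_zero_iff.1 hne
    obtain ⟨t, ht, hmono, hhit⟩ := ih h1
    have hk := Finset.mem_range.1 hk
    refine ⟨fun i => if i < n then t i else k, fun i hi => ?_, fun i j hij hj => ?_, fun i hi => ?_⟩
    · dsimp only
      split_ifs with hin
      · exact (ht i hin).trans hk
      · exact hk
    · have hin : i < n := by omega
      simp only [hin, if_true]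
      split_ifs with hjn
      · exact hmono i j hij hjn
      · exact ht i (by omega)
    · dsimp only
      split_ifs with hin
      · exact hhit i hin
      · obtain rfl : i = n := by omega
        exact h2

lemma sector_smul {r : ℝ} (hr : 0 < r) (x : E3) : sector (r • x) = sector x := by
  simp [sector, hr]

lemma axisHit_smul {r : ℝ} (hr : 0 < r) (s : ℝ) (x y z : E3) :
    axisHit s (r • x) (r • y) (r • z) = axisHit s x y z := by
  have h : ∀ w : E3, 0 < s * (r • w) 2 ↔ 0 < s * w 2 := fun w => by
    rw [PiLp.smul_apply, smul_eq_mul, mul_left_comm, mul_pos_iff_of_pos_left hr]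
  simp only [axisHit, sector_smul hr, h]

/-- A map from the torus to `ℝ³ \ {0}` of degree one that is constant along a circle. -/
def bubble (σ τ : ℝ) : E3 :=
  !₂[max (Real.cos (2 * Real.pi * σ)) (Real.cos (2 * Real.pi * τ)),
    Real.sin (2 * Real.pi * σ) * (1 - Real.cos (2 * Real.pi * τ)), Real.sin (2 * Real.pi * τ)]

lemma angle_eq (i κ : ℕ) (hκ : 0 < κ) :
    2 * Real.pi * ((i : ℝ) / (4 * κ : ℕ)) = (i : ℝ) / κ * (Real.pi / 2) := by
  push_cast; field_simp; ring

lemma cos_grid_pos {i κ : ℕ} (hκ : 0 < κ) (hi : i ≤ 4 * κ) :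
    0 < Real.cos (2 * Real.pi * ((i : ℝ) / (4 * κ : ℕ))) ↔ ¬ (κ ≤ i ∧ i ≤ 3 * κ) := by
  have hk : (0 : ℝ) < κ := by exact_mod_cast hκ
  have hpi := Real.pi_pos
  rw [angle_eq i κ hκ]
  have hi' : (i : ℝ) / κ ≤ 4 := by rw [div_le_iff₀ hk]; exact_mod_cast hi
  constructor
  · rintro h ⟨h1, h2⟩
    have h1 : 1 ≤ (i : ℝ) / κ := by rw [le_div_iff₀ hk]; simpa using h1
    have h2 : (i : ℝ) / κ ≤ 3 := by rw [div_le_iff₀ hk]; exact_mod_cast h2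
    have := Real.cos_nonpos_of_pi_div_two_le_of_le (x := (i : ℝ) / κ * (Real.pi / 2))
      (by nlinarith) (by nlinarith)
    linarith
  · intro h
    by_cases h1 : κ ≤ i
    · have h2 : 3 < (i : ℝ) / κ := by
        rw [lt_div_iff₀ hk]; exact_mod_cast (by omega : 3 * κ < i)
      rw [← Real.cos_sub_two_pi]
      exact Real.cos_pos_of_mem_Ioo ⟨by nlinarith, by nlinarith⟩
    · have h2 : (i : ℝ) / κ < 1 := by
        rw [div_lt_one hk]; exact_mod_cast (by omega : i < κ)
      have h3 : 0 ≤ (i : ℝ) / κ := by positivity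
      exact Real.cos_pos_of_mem_Ioo ⟨by nlinarith, by nlinarith⟩

lemma sin_grid_pos {i κ : ℕ} (hκ : 0 < κ) (hi : i ≤ 4 * κ) :
    0 < Real.sin (2 * Real.pi * ((i : ℝ) / (4 * κ : ℕ))) ↔ 0 < i ∧ i < 2 * κ := by
  have hk : (0 : ℝ) < κ := by exact_mod_cast hκ
  have hpi := Real.pi_pos
  rw [angle_eq i κ hκ]
  have hi' : (i : ℝ) / κ ≤ 4 := by rw [div_le_iff₀ hk]; exact_mod_cast hi
  constructor
  · intro h
    by_contra hne
    rcases Nat.eq_zero_or_pos i with rfl | h0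
    · simp at h
    · have h1 : 2 ≤ (i : ℝ) / κ := by
        rw [le_div_iff₀ hk]; exact_mod_cast (by omega : 2 * κ ≤ i)
      rw [← Real.sin_sub_two_pi] at h
      have := Real.sin_nonpos_of_nonpos_of_neg_pi_le
        (x := (i : ℝ) / κ * (Real.pi / 2) - 2 * Real.pi) (by nlinarith) (by nlinarith)
      linarith
  · rintro ⟨h0, h1⟩
    have h0 : 0 < (i : ℝ) / κ := by have : (0 : ℝ) < i := by exact_mod_cast h0
                                    positivity
    have h1 : (i : ℝ) / κ < 2 := by rw [div_lt_iff₀ hk]; exact_mod_cast h1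
    exact Real.sin_pos_of_pos_of_lt_pi (by positivity) (by nlinarith)

lemma sin_grid_neg {i κ : ℕ} (hκ : 0 < κ) (hi : i ≤ 4 * κ) :
    Real.sin (2 * Real.pi * ((i : ℝ) / (4 * κ : ℕ))) < 0 ↔ 2 * κ < i ∧ i < 4 * κ := by
  have h := sin_grid_pos hκ (i := 4 * κ - i) (by omega)
  have : 2 * Real.pi * (((4 * κ - i : ℕ) : ℝ) / (4 * κ : ℕ))
      = 2 * Real.pi - 2 * Real.pi * ((i : ℝ) / (4 * κ : ℕ)) := by
    have hk : (0 : ℝ) < κ := by exact_mod_cast hκ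
    rw [Nat.cast_sub hi]; push_cast; field_simp
  rw [this, Real.sin_two_pi_sub] at h
  constructor
  · intro h'; have := h.1 (by linarith); omega
  · intro h'; have := h.2 (by omega); linarith

lemma sector_bubble_grid {i k κ : ℕ} (hκ : 0 < κ) (hi : i ≤ 4 * κ) (hk : k ≤ 4 * κ) :
    sector (bubble ((i : ℝ) / (4 * κ : ℕ)) ((k : ℝ) / (4 * κ : ℕ)))
      = if (κ ≤ i ∧ i ≤ 3 * κ) ∧ (κ ≤ k ∧ k ≤ 3 * κ) then (if i < 2 * κ then 1 else 2) else 0 := by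
  have h0 : 0 < bubble ((i : ℝ) / (4 * κ : ℕ)) ((k : ℝ) / (4 * κ : ℕ)) 0 ↔
      ¬ ((κ ≤ i ∧ i ≤ 3 * κ) ∧ (κ ≤ k ∧ k ≤ 3 * κ)) := by
    simp only [bubble]
    rw [not_and_or, ← cos_grid_pos hκ hi, ← cos_grid_pos hκ hk, ← lt_max_iff]; rfl
  simp only [sector, h0]
  by_cases h : (κ ≤ i ∧ i ≤ 3 * κ) ∧ (κ ≤ k ∧ k ≤ 3 * κ)
  · rw [if_neg (by tauto), if_pos h]
    have h1 : 0 < bubble ((i : ℝ) / (4 * κ : ℕ)) ((k : ℝ) / (4 * κ : ℕ)) 1 ↔ i < 2 * κ := by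
      have hc := (cos_grid_pos hκ hk).not.2 (not_not.2 h.2)
      have : (0 : ℝ) < 1 - Real.cos (2 * Real.pi * ((k : ℝ) / (4 * κ : ℕ))) := by linarith
      change 0 < Real.sin _ * _ ↔ _
      rw [mul_pos_iff_of_pos_right this, sin_grid_pos hκ hi]
      omega
    simp only [h1]
  · rw [if_pos (by tauto), if_neg h]

/-- Parity of crossings in one block of the base family. -/
lemma bubble_axisHit {s : ℝ} {κ i₁ i₂ i₃ k₁ k₂ k₃ : ℕ} (hκ : 0 < κ)
    (hi₁ : i₁ ≤ 4 * κ) (hi₂ : i₂ ≤ 4 * κ) (hi₃ : i₃ ≤ 4 * κ)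
    (hk₁ : k₁ ≤ 4 * κ) (hk₂ : k₂ ≤ 4 * κ) (hk₃ : k₃ ≤ 4 * κ) {P : ℕ → Prop} [DecidablePred P]
    (hP : ∀ k : ℕ, k ≤ 4 * κ →
      (0 < s * Real.sin (2 * Real.pi * ((k : ℝ) / (4 * κ : ℕ))) ↔ P k)) :
    let σ : ℕ → ℕ → ℕ := fun i k => if (κ ≤ i ∧ i ≤ 3 * κ) ∧ (κ ≤ k ∧ k ≤ 3 * κ) then
      (if i < 2 * κ then 1 else 2) else 0
    let p : ℕ → ℕ → E3 := fun i k => bubble ((i : ℝ) / (4 * κ : ℕ)) ((k : ℝ) / (4 * κ : ℕ))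
    axisHit s (p i₁ k₁) (p i₂ k₂) (p i₃ k₃)
      = if (σ i₁ k₁ ≠ σ i₂ k₂ ∧ σ i₂ k₂ ≠ σ i₃ k₃ ∧ σ i₁ k₁ ≠ σ i₃ k₃) ∧ P k₁ ∧ P k₂ ∧ P k₃
        then 1 else 0 := by
  intro σ p
  have hσ : ∀ i k, i ≤ 4 * κ → k ≤ 4 * κ → (sector (p i k)).val = σ i k := by
    intro i k hi hk
    simp only [p, σ, sector_bubble_grid hκ hi hk]
    split_ifs <;> rfl
  have hp : ∀ i k, k ≤ 4 * κ → (0 < s * (p i k) 2 ↔ P k) := fun i k hk => hP k hk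
  simp only [axisHit, hp _ _ hk₁, hp _ _ hk₂, hp _ _ hk₃, ne_eq, ← hσ _ _ hi₁ hk₁, ← hσ _ _ hi₂ hk₂, ← hσ _ _ hi₃ hk₃, Fin.val_inj]

/-- The discretised paths of a bubble. -/
def bubbleGrid (κ : ℕ) (i : ZMod (4 * κ)) (k : ℕ) : E3 :=
  bubble ((i.val : ℝ) / (4 * κ : ℕ)) ((k : ℝ) / (4 * κ : ℕ))

lemma stripHit_self (s : ℝ) (x : ℕ → E3) (t : ℕ) : stripHit s x x t = 0 := by
  simp [stripHit, axisHit_self_left, axisHit_self_right]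

lemma val_add_one_cases {K : ℕ} (hK : 1 < K) (i : ZMod K) :
    ((i + 1).val = i.val + 1 ∧ i.val + 1 < K) ∨ ((i + 1).val = 0 ∧ i.val + 1 = K) := by
  have : NeZero K := ⟨by omega⟩
  have : Fact (1 < K) := ⟨hK⟩
  have hv := ZMod.val_lt i
  rw [ZMod.val_add, ZMod.val_one]
  rcases Nat.lt_or_ge (i.val + 1) K with h | h
  · left; exact ⟨Nat.mod_eq_of_lt h, h⟩
  · right
    have : i.val + 1 = K := by omega
    rw [this]; simp

lemma stripHit_bubbleGrid_even {κ : ℕ} (hκ : 2 ≤ κ) (i : ZMod (4 * κ)) {k : ℕ} (hk : k < 4 * κ) :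
    stripHit 1 (bubbleGrid κ i) (bubbleGrid κ (i + 1)) k
      = if k = κ - 1 ∧ i.val = 2 * κ - 1 then 1 else 0 := by
  have : NeZero (4 * κ) := ⟨by omega⟩
  have hi := ZMod.val_lt i
  have hi' := ZMod.val_lt (i + 1)
  have hP : ∀ k : ℕ, k ≤ 4 * κ →
      (0 < 1 * Real.sin (2 * Real.pi * ((k : ℝ) / (4 * κ : ℕ))) ↔ 0 < k ∧ k < 2 * κ) :=
    fun k hk => by rw [one_mul]; exact sin_grid_pos (by omega) hk
  unfold stripHit bubbleGrid
  rw [bubble_axisHit (by omega) hi.le hi'.le hi'.le hk.le hk.le hk hP,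
    bubble_axisHit (by omega) hi.le hi.le hi'.le hk.le hk hk hP, if_neg, zero_add]
  · congr 1
    rw [eq_iff_iff]
    rcases val_add_one_cases (by omega) i with ⟨h, h'⟩ | ⟨h, h'⟩ <;> rw [h] <;> clear hP <;>
      grind (splits := 20)
  · rcases val_add_one_cases (by omega) i with ⟨h, h'⟩ | ⟨h, h'⟩ <;> rw [h] <;> clear hP <;>
      grind (splits := 20)

lemma stripHit_bubbleGrid_odd {κ : ℕ} (hκ : 2 ≤ κ) (i : ZMod (4 * κ)) {k : ℕ} (hk : k < 4 * κ) :
    stripHit (-1) (bubbleGrid κ i) (bubbleGrid κ (i + 1)) k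
      = if k = 3 * κ ∧ i.val = 2 * κ - 1 then 1 else 0 := by
  have : NeZero (4 * κ) := ⟨by omega⟩
  have hi := ZMod.val_lt i
  have hi' := ZMod.val_lt (i + 1)
  have hP : ∀ k : ℕ, k ≤ 4 * κ → (0 < (-1) * Real.sin (2 * Real.pi * ((k : ℝ) / (4 * κ : ℕ))) ↔
      2 * κ < k ∧ k < 4 * κ) :=
    fun k hk => by rw [neg_one_mul, neg_pos]; exact sin_grid_neg (by omega) hk
  unfold stripHit bubbleGrid
  rw [bubble_axisHit (by omega) hi.le hi'.le hi'.le hk.le hk.le hk hP,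
    bubble_axisHit (by omega) hi.le hi.le hi'.le hk.le hk hk hP, add_comm, if_neg, zero_add]
  · congr 1
    rw [eq_iff_iff]
    rcases val_add_one_cases (by omega) i with ⟨h, h'⟩ | ⟨h, h'⟩ <;> rw [h] <;> clear hP <;>
      grind (splits := 20)
  · rcases val_add_one_cases (by omega) i with ⟨h, h'⟩ | ⟨h, h'⟩ <;> rw [h] <;> clear hP <;>
      grind (splits := 20)

lemma staircase_eq_one {n L : ℕ} {y : ℕ → ℕ → E3} {p : ℕ → ℕ}
    (hp : ∀ i j, i < j → j < n → p i < p j) (hL : ∀ i < n, p i < L)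
    (h : ∀ i < n, ∀ t < L, stripHit ((-1) ^ i) (y i) (y (i + 1)) t = if t = p i then 1 else 0) :
    staircase n L y = 1 := by
  induction n generalizing L with
  | zero => rfl
  | succ n ih =>
    rw [staircase, Finset.sum_eq_single (p n)]
    · rw [h n (by omega) _ (hL n (by omega)), if_pos rfl, mul_one]
      exact ih (fun i j hij hj => hp i j hij (by omega)) (fun i hi => hp i n hi (by omega))
        fun i hi t ht => h i (by omega) t (ht.trans (hL n (by omega)))
    · intro t ht hne
      rw [h n (by omega) t (Finset.mem_range.1 ht), if_neg hne, mul_zero]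
    · intro hne
      exact absurd (Finset.mem_range.2 (hL n (by omega))) hne

lemma stripHit_congr {s r : ℝ} (hr : 0 < r) {x y x' y' : ℕ → E3} {t t' : ℕ}
    (hx : x t = r • x' t') (hy : y t = r • y' t') (hx' : x (t + 1) = r • x' (t' + 1))
    (hy' : y (t + 1) = r • y' (t' + 1)) : stripHit s x y t = stripHit s x' y' t' := by
  simp only [stripHit, hx, hy, hx', hy', axisHit_smul hr]

/-- The position inside a block of the crossing of the `i`-th half axis. -/
def hitTime (κ i : ℕ) : ℕ := if Even i then κ - 1 else 3 * κ

lemma hitTime_lt {κ : ℕ} (hκ : 2 ≤ κ) (i : ℕ) : hitTime κ i < 4 * κ := by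
  unfold hitTime; split_ifs <;> omega

lemma stripHit_bubbleGrid {κ : ℕ} (hκ : 2 ≤ κ) (n : ℕ) (i : ZMod (4 * κ)) {k : ℕ}
    (hk : k < 4 * κ) : stripHit ((-1) ^ n) (bubbleGrid κ i) (bubbleGrid κ (i + 1)) k
      = if k = hitTime κ n ∧ i.val = 2 * κ - 1 then 1 else 0 := by
  unfold hitTime
  split_ifs with h1 h2 h2
  · rw [h1.neg_one_pow, stripHit_bubbleGrid_even hκ i hk, if_pos h2]
  · rw [h1.neg_one_pow, stripHit_bubbleGrid_even hκ i hk, if_neg h2]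
  · rw [(Nat.not_even_iff_odd.1 h1).neg_one_pow, stripHit_bubbleGrid_odd hκ i hk, if_pos h2]
  · rw [(Nat.not_even_iff_odd.1 h1).neg_one_pow, stripHit_bubbleGrid_odd hκ i hk, if_neg h2]

lemma stripHit_concat {n κ : ℕ} (hκ : 2 ≤ κ) {r : ℝ} (hr : 0 < r)
    {G : (Fin n → ZMod (4 * κ)) → ℕ → E3}
    (hG : ∀ w (b : Fin n) k, k ≤ 4 * κ → G w (4 * κ * b + k) = r • bubbleGrid κ (w b) k)
    (τ : Equiv.Perm (Fin (n + 1))) (v : Fin n → ZMod (4 * κ)) (i : ℕ) (b : Fin n) {k : ℕ}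
    (hk : k < 4 * κ) :
    stripHit ((-1) ^ i) (G (v + cubeStep (4 * κ) fun j => (τ j.castSucc).val < i))
      (G (v + cubeStep (4 * κ) fun j => (τ j.castSucc).val < i + 1)) (4 * κ * b + k)
      = if (τ b.castSucc).val = i ∧ k = hitTime κ i ∧ (v b).val = 2 * κ - 1 then 1 else 0 := by
  rw [stripHit_congr hr (hG _ b k hk.le) (hG _ b k hk.le) (hG _ b (k + 1) hk)
    (hG _ b (k + 1) hk)]
  by_cases h : (τ b.castSucc).val = i
  · simp [cubeStep, h, stripHit_bubbleGrid hκ i _ hk]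
  · rw [if_neg (by tauto)]
    have : ((τ b.castSucc).val < i + 1) ↔ (τ b.castSucc).val < i := by omega
    simp only [cubeStep, Pi.add_apply, this]
    exact stripHit_self _ _ _

/-- The base family has nontrivial count. -/
theorem torusCount_concat {n κ : ℕ} [NeZero (4 * κ)] (hκ : 2 ≤ κ) {r : ℝ} (hr : 0 < r)
    {G : (Fin n → ZMod (4 * κ)) → ℕ → E3}
    (hG : ∀ w (b : Fin n) k, k ≤ 4 * κ → G w (4 * κ * b + k) = r • bubbleGrid κ (w b) k) :
    torusCount n (4 * κ) (4 * κ * n) G = 1 := by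
  have hdiv : ∀ t < 4 * κ * n, ∃ b : Fin n, ∃ k < 4 * κ, t = 4 * κ * b + k := fun t ht =>
    ⟨⟨t / (4 * κ), Nat.div_lt_of_lt_mul ht⟩, t % (4 * κ), Nat.mod_lt _ (by omega),
      (Nat.div_add_mod t (4 * κ)).symm⟩
  have hblock : ∀ b b' k k' : ℕ, k < 4 * κ → 4 * κ * b + k < 4 * κ * b' + k' → k' < 4 * κ →
      b ≤ b' := by
    intro b b' k k' hk hlt hk'
    by_contra hb
    have := Nat.mul_le_mul_left (4 * κ) (by omega : b' + 1 ≤ b)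
    rw [mul_add] at this; omega
  set v₀ : Fin n → ZMod (4 * κ) := fun _ => ((2 * κ - 1 : ℕ) : ZMod (4 * κ)) with hv₀
  have hv₀' : ∀ b, (v₀ b).val = 2 * κ - 1 := fun b => ZMod.val_cast_of_lt (by omega)
  have main : ∀ (τ : Equiv.Perm (Fin (n + 1))) (v : Fin n → ZMod (4 * κ)),
      τ (Fin.last n) = Fin.last n → staircase n (4 * κ * n)
        (fun i => G (v + cubeStep (4 * κ) fun j => (τ j.castSucc).val < i)) ≠ 0 →
      τ = 1 ∧ v = v₀ := by
    intro τ v hτ hne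
    obtain ⟨t, htL, hmono, hhit⟩ := exists_strictMono_of_staircase_ne_zero hne
    choose b k hk htk using fun i : Fin n => hdiv (t i) (htL i i.2)
    have hb : ∀ i : Fin n, (τ (b i).castSucc).val = i ∧ (v (b i)).val = 2 * κ - 1 := by
      intro i
      have := hhit i i.2
      rw [htk i, stripHit_concat hκ hr hG τ v i (b i) (hk i)] at this
      have := (ite_ne_right_iff.1 this).1
      exact ⟨this.1, this.2.2⟩
    have hinj : Function.Injective b := fun i j hij => by
      have h1 := (hb i).1; rw [hij, (hb j).1] at h1; exact Fin.ext h1.symm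
    have hbm : StrictMono b := by
      intro i j hij
      have h1 := hmono i j hij j.2
      rw [htk i, htk j] at h1
      have h2 := hblock _ _ _ _ (hk i) h1 (hk j)
      exact lt_of_le_of_ne h2 (hinj.ne hij.ne)
    have hid : b = id := (hbm.range_inj strictMono_id).1
      (by rw [(Finite.injective_iff_surjective.1 hinj).range_eq, Set.range_id])
    simp only [hid, id] at hb
    constructor
    · ext x
      induction x using Fin.lastCases with
      | last => simp [hτ]
      | cast i => simpa using (hb i).1
    · funext i
      exact ZMod.val_injective _ ((hb i).2.trans (hv₀' i).symm)
  rw [torusCount, Finset.sum_eq_single 1, Finset.sum_eq_single v₀]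
  · refine staircase_eq_one (p := fun i => 4 * κ * i + hitTime κ i) ?_ ?_ ?_
    · intro i j hij _
      have := Nat.mul_le_mul_left (4 * κ) (by omega : i + 1 ≤ j)
      have := hitTime_lt hκ i
      rw [mul_add] at *; omega
    · intro i hi
      have := Nat.mul_le_mul_left (4 * κ) (by omega : i + 1 ≤ n)
      have := hitTime_lt hκ i
      rw [mul_add] at *; omega
    · intro i hi t ht
      obtain ⟨b, k, hk, rfl⟩ := hdiv t ht
      rw [stripHit_concat hκ hr hG 1 v₀ i b hk]
      congr 1
      simp only [Equiv.Perm.one_apply, Fin.val_castSucc, hv₀' b, and_true, eq_iff_iff]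
      constructor
      · rintro ⟨rfl, rfl⟩; rfl
      · intro h
        have h1 := hitTime_lt hκ i
        have h2 : (b : ℕ) = i := by
          have e1 : (4 * κ * (b : ℕ) + k) / (4 * κ) = b := by
            rw [Nat.mul_add_div (by omega), Nat.div_eq_of_lt hk, add_zero]
          have e2 : (4 * κ * i + hitTime κ i) / (4 * κ) = i := by
            rw [Nat.mul_add_div (by omega), Nat.div_eq_of_lt h1, add_zero]
          rw [← e1, h, e2]
        refine ⟨h2, ?_⟩
        rw [h2] at h; omega
  · intro v _ hv
    by_contra hne
    exact hv (main 1 v rfl hne).2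
  · simp
  · intro τ hτ hτ1
    refine Finset.sum_eq_zero fun v _ => ?_
    by_contra hne
    exact hτ1 (main τ v (Finset.mem_filter.1 hτ).2 hne).1
  · simp

/-- An isometry close to the identity that turns `u'` into the direction of `u`. -/
def alignIso (u u' : E3) : E3 ≃ₗᵢ[ℝ] E3 :=
  ((Submodule.span ℝ {u'}).reflection).trans
    ((Submodule.span ℝ {‖u'‖⁻¹ • u' + ‖u‖⁻¹ • u}).reflection)

lemma norm_normalize_sub_le {u u' : E3} (hu : u ≠ 0) (hu' : u' ≠ 0) :
    ‖‖u'‖⁻¹ • u' - ‖u‖⁻¹ • u‖ ≤ 2 * ‖u - u'‖ / ‖u‖ := by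
  have h0 : 0 < ‖u‖ := norm_pos_iff.2 hu
  have h0' : 0 < ‖u'‖ := norm_pos_iff.2 hu'
  have e : ‖u'‖⁻¹ • u' - ‖u‖⁻¹ • u = ‖u‖⁻¹ • (u' - u) + (‖u'‖⁻¹ - ‖u‖⁻¹) • u' := by module
  rw [e]
  refine (norm_add_le _ _).trans ?_
  rw [norm_smul, norm_smul, norm_inv, norm_norm, Real.norm_eq_abs, norm_sub_rev u' u]
  have e2 : |‖u'‖⁻¹ - ‖u‖⁻¹| * ‖u'‖ = |‖u‖ - ‖u'‖| / ‖u‖ := by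
    rw [inv_sub_inv h0'.ne' h0.ne', abs_div, abs_of_pos (mul_pos h0' h0)]
    field_simp
  rw [e2]
  have := div_le_div_of_nonneg_right (abs_norm_sub_norm_le u u') h0.le
  calc _ ≤ ‖u‖⁻¹ * ‖u - u'‖ + ‖u - u'‖ / ‖u‖ := by gcongr
    _ = _ := by field_simp; ring

lemma add_ne_zero_of_near {a b : E3} (ha : ‖a‖ = 1) (h : ‖a - b‖ < 2) : a + b ≠ 0 := by
  intro e
  have : a - b = (2 : ℝ) • a := by rw [eq_neg_of_add_eq_zero_right e]; module
  rw [this, norm_smul, ha] at h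
  norm_num at h

lemma reflection_span_add {a b : E3} (ha : ‖a‖ = 1) (hb : ‖b‖ = 1) (h : a + b ≠ 0) :
    (Submodule.span ℝ {a + b}).reflection a = b := by
  rw [Submodule.reflection_singleton_apply]
  have h1 : ‖a + b‖ ^ 2 = 2 * inner ℝ (a + b) a := by
    rw [@norm_add_sq_real, inner_add_left, real_inner_self_eq_norm_sq, ha, hb, real_inner_comm]
    ring
  have h0 : 0 < ‖a + b‖ ^ 2 := by have := norm_pos_iff.2 h; positivity
  have : (inner ℝ (a + b) a / ‖a + b‖ ^ 2 : ℝ) = 1 / 2 := by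
    rw [div_eq_iff h0.ne', h1]; ring
  simp only [RCLike.ofReal_real_eq_id, id]
  rw [this]; module

lemma reflection_self (u : E3) : (Submodule.span ℝ {u}).reflection u = u :=
  Submodule.reflection_mem_subspace_eq_self (Submodule.mem_span_singleton_self u)

lemma norm_normalize {u : E3} (hu : u ≠ 0) : ‖‖u‖⁻¹ • u‖ = 1 := by
  rw [norm_smul, norm_inv, norm_norm, inv_mul_cancel₀ (norm_ne_zero_iff.2 hu)]

lemma alignIso_apply_self {u u' : E3} (hu : u ≠ 0) (hu' : u' ≠ 0)
    (h : ‖u'‖⁻¹ • u' + ‖u‖⁻¹ • u ≠ 0) : alignIso u u' u' = (‖u'‖ / ‖u‖) • u := by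
  have e : u' = ‖u'‖ • (‖u'‖⁻¹ • u') := by
    rw [smul_smul, mul_inv_cancel₀ (norm_ne_zero_iff.2 hu'), one_smul]
  unfold alignIso
  rw [LinearIsometryEquiv.trans_apply, reflection_self]
  conv_lhs => rw [e, map_smul]
  rw [← e, reflection_span_add (norm_normalize hu') (norm_normalize hu) h, smul_smul, div_eq_mul_inv]

lemma reflection_unit_apply {a : E3} (ha : ‖a‖ = 1) (y : E3) :
    (Submodule.span ℝ {a}).reflection y = 2 • (inner ℝ a y : ℝ) • a - y := by
  rw [Submodule.reflection_singleton_apply]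
  simp [ha]

lemma norm_alignIso_sub_le {u u' : E3} (hu : u ≠ 0) (hu' : u' ≠ 0)
    (h : ‖u'‖⁻¹ • u' + ‖u‖⁻¹ • u ≠ 0) (x : E3) :
    ‖alignIso u u' x - x‖ ≤ 8 * ‖u - u'‖ / ‖u‖ * ‖x‖ := by
  set a := ‖u'‖⁻¹ • u' with ha
  set b := ‖u‖⁻¹ • u with hb
  have ha1 : ‖a‖ = 1 := norm_normalize hu'
  set w := ‖a + b‖⁻¹ • (a + b) with hw
  have hw1 : ‖w‖ = 1 := norm_normalize h
  have hsa : (Submodule.span ℝ {u'} : Submodule ℝ E3) = Submodule.span ℝ {a} :=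
    (Submodule.span_singleton_smul_eq (IsUnit.mk0 _ (inv_ne_zero (norm_ne_zero_iff.2 hu'))) u').symm
  have hsw : (Submodule.span ℝ {a + b} : Submodule ℝ E3) = Submodule.span ℝ {w} :=
    (Submodule.span_singleton_smul_eq (IsUnit.mk0 _ (inv_ne_zero (norm_ne_zero_iff.2 h))) _).symm
  set y := (Submodule.span ℝ {a}).reflection x with hy
  have hyn : ‖y‖ = ‖x‖ := LinearIsometryEquiv.norm_map _ _
  have hx : x = (Submodule.span ℝ {a}).reflection y := (Submodule.reflection_reflection _ _).symm
  have hal : alignIso u u' x = (Submodule.span ℝ {w}).reflection y := by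
    simp only [alignIso, LinearIsometryEquiv.trans_apply, ← ha, ← hb, hsa, hsw, ← hy]
  have hwa : ‖w - a‖ ≤ ‖a - b‖ := by
    have e1 : w - a = (‖a + b‖⁻¹ * (1 - ‖a + b‖ / 2)) • (a + b) + (2 : ℝ)⁻¹ • (b - a) := by
      rw [mul_sub, mul_div_assoc', inv_mul_cancel₀ (norm_ne_zero_iff.2 h), sub_smul, mul_one, ← hw]
      module
    have e2 : |1 - ‖a + b‖ / 2| ≤ ‖a - b‖ / 2 := by
      have h1 : ‖(2 : ℝ)⁻¹ • (a + b)‖ = ‖a + b‖ / 2 := by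
        rw [norm_smul]; norm_num; ring
      have h2 := abs_norm_sub_norm_le a ((2 : ℝ)⁻¹ • (a + b))
      rw [ha1, h1] at h2
      refine h2.trans (le_of_eq ?_)
      have : a - (2 : ℝ)⁻¹ • (a + b) = (2 : ℝ)⁻¹ • (a - b) := by module
      rw [this, norm_smul]; norm_num; ring
    rw [e1]
    refine (norm_add_le _ _).trans ?_
    rw [norm_smul, norm_smul, norm_mul, norm_inv, norm_norm, norm_sub_rev b a, mul_right_comm,
      inv_mul_cancel₀ (norm_ne_zero_iff.2 h), one_mul, Real.norm_eq_abs]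
    norm_num
    linarith
  have hab := norm_normalize_sub_le hu hu'
  rw [← ha, ← hb] at hab
  have hdiff : alignIso u u' x - x
      = (2 • (inner ℝ w y : ℝ) • w - y) - (2 • (inner ℝ a y : ℝ) • a - y) := by
    rw [hal, reflection_unit_apply hw1, ← reflection_unit_apply ha1, ← hx]
  rw [hdiff]
  have e : (2 • (inner ℝ w y : ℝ) • w - y) - (2 • (inner ℝ a y : ℝ) • a - y)
      = 2 • ((inner ℝ (w - a) y : ℝ) • w + (inner ℝ a y : ℝ) • (w - a)) := by
    rw [inner_sub_left]; module
  rw [e]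
  have h1 : ‖(inner ℝ (w - a) y : ℝ) • w‖ ≤ ‖w - a‖ * ‖y‖ := by
    rw [norm_smul, hw1, mul_one]; exact norm_inner_le_norm _ _
  have h2 : ‖(inner ℝ a y : ℝ) • (w - a)‖ ≤ ‖y‖ * ‖w - a‖ := by
    rw [norm_smul]
    gcongr
    simpa [ha1] using norm_inner_le_norm (𝕜 := ℝ) a y
  have h3 := norm_add_le ((inner ℝ (w - a) y : ℝ) • w) ((inner ℝ a y : ℝ) • (w - a))
  have h4 : ‖w - a‖ * ‖x‖ ≤ (2 * ‖u - u'‖ / ‖u‖) * ‖x‖ := by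
    gcongr; exact hwa.trans hab
  rw [two_nsmul]
  refine (norm_add_le _ _).trans ?_
  rw [hyn] at h1 h2
  have e5 : 8 * ‖u - u'‖ / ‖u‖ * ‖x‖ = 4 * ((2 * ‖u - u'‖ / ‖u‖) * ‖x‖) := by ring
  rw [e5]; linarith

lemma continuous_reflection {X : Type*} [TopologicalSpace X] {u x : X → E3} (hu : Continuous u)
    (hx : Continuous x) (h0 : ∀ p, u p ≠ 0) :
    Continuous fun p => (Submodule.span ℝ {u p}).reflection (x p) := by
  have : (fun p => (Submodule.span ℝ {u p}).reflection (x p))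
      = fun p => 2 • ((inner ℝ (u p) (x p) : ℝ) / (‖u p‖ ^ 2 : ℝ)) • u p - x p := by
    funext p; rw [Submodule.reflection_singleton_apply]; rfl
  rw [this]
  have hd : ∀ p, ‖u p‖ ^ 2 ≠ 0 := fun p => pow_ne_zero _ (norm_ne_zero_iff.2 (h0 p))
  exact ((((hu.inner hx).div (hu.norm.pow 2) hd).smul hu).const_smul 2).sub hx

lemma continuous_alignIso {X : Type*} [TopologicalSpace X] {u u' x : X → E3} (hu : Continuous u)
    (hu' : Continuous u') (hx : Continuous x) (h0 : ∀ p, u p ≠ 0) (h0' : ∀ p, u' p ≠ 0)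
    (h : ∀ p, ‖u' p‖⁻¹ • u' p + ‖u p‖⁻¹ • u p ≠ 0) :
    Continuous fun p => alignIso (u p) (u' p) (x p) := by
  have hn : ∀ p, ‖u p‖ ≠ 0 := fun p => norm_ne_zero_iff.2 (h0 p)
  have hn' : ∀ p, ‖u' p‖ ≠ 0 := fun p => norm_ne_zero_iff.2 (h0' p)
  simp only [alignIso, LinearIsometryEquiv.trans_apply]
  exact continuous_reflection (((hu'.norm.inv₀ hn').smul hu').add ((hu.norm.inv₀ hn).smul hu))
    (continuous_reflection hu' hx h0') h

/-- The point of the torus `ℝⁿ / ℤⁿ` corresponding to a vertex of the discrete torus. -/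
def gridPt {n K : ℕ} (v : Fin n → ZMod K) : Fin n → ℝ := fun i => (v i).val / (K : ℝ)

/-- A family of closed paths parametrized by the unit interval, continuous and `ℤⁿ`-periodic in
the parameters. -/
structure LoopFamily {n : ℕ} (g : (Fin n → ℝ) → ℝ → E3) : Prop where
  cont : Continuous fun p : (Fin n → ℝ) × ℝ => g p.1 p.2
  per : ∀ s (z : Fin n → ℤ) u, g (s + fun i => (z i : ℝ)) u = g s u
  closed : ∀ s, g s 1 = g s 0

/-- The restriction of a family of closed paths to the discrete torus. -/
def gridOf {n : ℕ} (K : ℕ) (g : (Fin n → ℝ) → ℝ → E3) (v : Fin n → ZMod K) (j : ℕ) : E3 :=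
  g (gridPt v) (j / (K * n : ℕ))

/-- A family of closed paths avoiding the origin whose discretizations, after a continuous
rotation putting the base points in the half space `{x₀ > 0}`, have nontrivial count. -/
def Essential {n : ℕ} (g : (Fin n → ℝ) → ℝ → E3) : Prop :=
  ∃ R : (Fin n → ℝ) → (E3 ≃ₗᵢ[ℝ] E3),
    (∀ s (z : Fin n → ℤ), R (s + fun i => (z i : ℝ)) = R s) ∧
    (∀ {X : Type} [TopologicalSpace X] {a : X → Fin n → ℝ} {b : X → E3}, Continuous a →
      Continuous b → Continuous fun p => R (a p) (b p)) ∧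
    (∀ s, 0 < R s (g s 0) 0) ∧
    ∃ κ₀ : ℕ, ∀ κ ≥ κ₀, ∀ [NeZero (4 * κ)],
      torusCount n (4 * κ) (4 * κ * n) (gridOf (4 * κ) fun s u => R s (g s u)) = 1

lemma gridPt_mem {n K : ℕ} [NeZero K] (v : Fin n → ZMod K) :
    gridPt v ∈ Set.Icc (0 : Fin n → ℝ) 1 := by
  have hK : (0 : ℝ) < K := by exact_mod_cast NeZero.pos K
  constructor
  · intro i; simp only [gridPt, Pi.zero_apply]; positivity
  · intro i
    simp only [gridPt, Pi.one_apply]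
    rw [div_le_one hK]
    exact_mod_cast (ZMod.val_lt (v i)).le

lemma gridPt_add_cubeStep {n K : ℕ} (hK : 1 < K) (v : Fin n → ZMod K) (S : Fin n → Prop)
    [DecidablePred S] : ∃ z : Fin n → ℤ,
      (gridPt v + fun i => if S i then 1 / (K : ℝ) else 0) =
        gridPt (v + cubeStep K S) + fun i => (z i : ℝ) := by
  have hK0 : (K : ℝ) ≠ 0 := by exact_mod_cast (by omega : K ≠ 0)
  have : ∀ i, ∃ z : ℤ, (gridPt v i + if S i then 1 / (K : ℝ) else 0) =
      gridPt (v + cubeStep K S) i + z := by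
    intro i
    simp only [gridPt, Pi.add_apply, cubeStep]
    by_cases h : S i
    · simp only [if_pos h]
      rcases val_add_one_cases hK (v i) with ⟨h1, -⟩ | ⟨h1, h2⟩
      · refine ⟨0, ?_⟩
        rw [h1]; push_cast; ring
      · refine ⟨1, ?_⟩
        rw [h1, ← add_div]
        have : ((v i).val : ℝ) + 1 = K := by exact_mod_cast h2
        rw [this, div_self hK0]; simp
    · exact ⟨0, by simp [h]⟩
  choose z hz using this
  exact ⟨z, funext fun i => hz i⟩

/-- Discretizations of a continuous family vary little on small cubes. -/
lemma LoopFamily.exists_grid_close {n : ℕ} {g : (Fin n → ℝ) → ℝ → E3} (hg : LoopFamily g) {ε : ℝ}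
    (hε : 0 < ε) : ∃ κ₀ : ℕ, 1 ≤ κ₀ ∧ ∀ κ ≥ κ₀, ∀ (v : Fin n → ZMod (4 * κ))
      (S S' : Fin n → Prop) [DecidablePred S] [DecidablePred S'], ∀ u ∈ Set.Icc (0 : ℝ) 1,
      ∀ u' ∈ Set.Icc (0 : ℝ) 1, |u - u'| ≤ 1 / (4 * κ : ℕ) →
        ‖g (gridPt (v + cubeStep (4 * κ) S)) u - g (gridPt (v + cubeStep (4 * κ) S')) u'‖ ≤ ε := by
  have hcomp : IsCompact (Set.Icc (0 : Fin n → ℝ) 2 ×ˢ Set.Icc (0 : ℝ) 1) :=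
    isCompact_Icc.prod isCompact_Icc
  have huc := hcomp.uniformContinuousOn_of_continuous hg.cont.continuousOn
  obtain ⟨η, hη, H⟩ := Metric.uniformContinuousOn_iff.1 huc ε hε
  obtain ⟨κ₀, hκ₀⟩ := exists_nat_gt (1 / η)
  refine ⟨max 1 κ₀, le_max_left _ _, fun κ hκ v S S' _ _ u hu u' hu' huu => ?_⟩
  have hκ1 : 1 ≤ κ := (le_max_left _ _).trans hκ
  have : NeZero (4 * κ) := ⟨by omega⟩
  have hK : (1 : ℝ) ≤ (4 * κ : ℕ) := by exact_mod_cast (by omega : 1 ≤ 4 * κ)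
  have hsmall : 1 / ((4 * κ : ℕ) : ℝ) < η := by
    have h1 : (κ₀ : ℝ) ≤ (4 * κ : ℕ) := by
      exact_mod_cast ((le_max_right _ _).trans hκ).trans (by omega)
    rw [one_div_lt (by linarith) hη]
    linarith
  have hle1 : 1 / ((4 * κ : ℕ) : ℝ) ≤ 1 := by rw [div_le_one (by linarith)]; exact hK
  have hpos : 0 ≤ 1 / ((4 * κ : ℕ) : ℝ) := by positivity
  obtain ⟨z, hz⟩ := gridPt_add_cubeStep (by omega : 1 < 4 * κ) v S
  obtain ⟨z', hz'⟩ := gridPt_add_cubeStep (by omega : 1 < 4 * κ) v S'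
  rw [← hg.per _ z, ← hz, ← hg.per (gridPt (v + cubeStep (4 * κ) S')) z', ← hz']
  have hmem : ∀ (P : Fin n → Prop) [DecidablePred P],
      (gridPt v + fun i => if P i then 1 / ((4 * κ : ℕ) : ℝ) else 0) ∈
        Set.Icc (0 : Fin n → ℝ) 2 := by
    intro P _
    obtain ⟨h0, h1⟩ := gridPt_mem v
    constructor
    · intro i
      have := h0 i
      simp only [Pi.add_apply, Pi.zero_apply] at this ⊢
      split_ifs <;> linarith
    · intro i
      have := h1 i
      simp only [Pi.add_apply, Pi.ofNat_apply] at this ⊢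
      split_ifs <;> linarith
  rw [← dist_eq_norm]
  refine (H (_, u) ⟨hmem S, hu⟩ (_, u') ⟨hmem S', hu'⟩ ?_).le
  rw [Prod.dist_eq]
  refine max_lt ?_ (lt_of_le_of_lt (by rw [Real.dist_eq]; exact huu) hsmall)
  refine lt_of_le_of_lt ((dist_pi_le_iff hpos).2 fun i => ?_) hsmall
  simp only [Pi.add_apply, dist_add_left, Real.dist_eq]
  split_ifs <;> simp [abs_of_nonneg]

lemma LoopFamily.comp {n : ℕ} {g : (Fin n → ℝ) → ℝ → E3} (hg : LoopFamily g)
    {R : (Fin n → ℝ) → (E3 ≃ₗᵢ[ℝ] E3)} (hper : ∀ s (z : Fin n → ℤ), R (s + fun i => (z i : ℝ)) = R s)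
    (hcont : ∀ {X : Type} [TopologicalSpace X] {a : X → Fin n → ℝ} {b : X → E3}, Continuous a →
      Continuous b → Continuous fun p => R (a p) (b p)) : LoopFamily fun s u => R s (g s u) where
  cont := hcont continuous_fst hg.cont
  per s z u := by simp only [hper, hg.per]
  closed s := by simp only [hg.closed]

lemma div_mem_Icc_of_le {a b : ℕ} (h : a ≤ b) : (a / b : ℝ) ∈ Set.Icc (0 : ℝ) 1 :=
  ⟨by positivity, div_le_one_of_le₀ (by exact_mod_cast h) (by positivity)⟩

lemma abs_div_sub_div_le {K n t a b : ℕ} (hn : 1 ≤ n) (ha : a = t ∨ a = t + 1)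
    (hb : b = t ∨ b = t + 1) : |(a / (K * n : ℕ) : ℝ) - b / (K * n : ℕ)| ≤ 1 / (K : ℕ) := by
  rcases Nat.eq_zero_or_pos K with rfl | hK
  · simp
  have hK' : (0 : ℝ) < K := by exact_mod_cast hK
  rw [← sub_div, abs_div, abs_of_nonneg (by positivity : (0 : ℝ) ≤ (K * n : ℕ))]
  have h1 : |(a : ℝ) - b| ≤ 1 := by
    rcases ha with rfl | rfl <;> rcases hb with rfl | rfl <;> simp
  have h2 : (K : ℝ) ≤ (K * n : ℕ) := by exact_mod_cast Nat.le_mul_of_pos_right K hn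
  gcongr

/-- The rotated and discretized families are close when the families are. -/
theorem Essential.of_close {n : ℕ} {g g' : (Fin (n + 1) → ℝ) → ℝ → E3} (hE : Essential g)
    (hg : LoopFamily g) (hg' : LoopFamily g') {δ r B : ℝ} (hδ : 0 < δ) (h : ∀ s u, δ ≤ ‖g s u‖)
    (h' : ∀ s u, δ ≤ ‖g' s u‖) (hB : ∀ s u, ‖g' s u‖ ≤ B) (hr : ∀ s u, ‖g s u - g' s u‖ ≤ r)
    (hrδ : r * (8 * B / δ + 1) ≤ δ / 30) : Essential g' := by
  obtain ⟨R, hRper, hRcont, hR0, κ₁, hκ₁⟩ := hE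
  have hr0 : 0 ≤ r := (norm_nonneg _).trans (hr 0 0)
  have hB0 : 0 ≤ B := (norm_nonneg _).trans (hB 0 0)
  have hrs : r ≤ δ / 30 := by
    have : 0 ≤ r * (8 * B / δ) := by positivity
    linarith
  have hne : ∀ s, g s 0 ≠ 0 := fun s => norm_pos_iff.1 (hδ.trans_le (h s 0))
  have hne' : ∀ s, g' s 0 ≠ 0 := fun s => norm_pos_iff.1 (hδ.trans_le (h' s 0))
  have hadd : ∀ s, ‖g' s 0‖⁻¹ • g' s 0 + ‖g s 0‖⁻¹ • g s 0 ≠ 0 := by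
    intro s
    refine add_ne_zero_of_near (norm_normalize (hne' s)) ?_
    refine (norm_normalize_sub_le (hne s) (hne' s)).trans_lt ?_
    rw [div_lt_iff₀ (hδ.trans_le (h s 0))]
    have := hr s 0
    have := h s 0
    linarith
  set R' : (Fin (n + 1) → ℝ) → (E3 ≃ₗᵢ[ℝ] E3) := fun s => (alignIso (g s 0) (g' s 0)).trans (R s)
    with hR'
  have hR'per : ∀ s (z : Fin (n + 1) → ℤ), R' (s + fun i => (z i : ℝ)) = R' s := fun s z => by
    simp only [hR', hRper, hg.per, hg'.per]
  have hR'cont : ∀ {X : Type} [TopologicalSpace X] {a : X → Fin (n + 1) → ℝ} {b : X → E3},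
      Continuous a → Continuous b → Continuous fun p => R' (a p) (b p) := by
    intro X _ a b ha hb
    exact hRcont ha (continuous_alignIso (hg.cont.comp (ha.prodMk continuous_const))
      (hg'.cont.comp (ha.prodMk continuous_const)) hb (fun p => hne _) (fun p => hne' _)
      (fun p => hadd _))
  have hR'0 : ∀ s, 0 < R' s (g' s 0) 0 := by
    intro s
    simp only [hR', LinearIsometryEquiv.trans_apply,
      alignIso_apply_self (hne s) (hne' s) (hadd s), map_smul]
    have h1 : 0 < ‖g' s 0‖ / ‖g s 0‖ :=
      div_pos (norm_pos_iff.2 (hne' s)) (norm_pos_iff.2 (hne s))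
    exact mul_pos h1 (hR0 s)
  have hG := hg.comp hRper hRcont
  have hG' := hg'.comp hR'per hR'cont
  have hclose : ∀ s u, ‖R s (g s u) - R' s (g' s u)‖ ≤ δ / 30 := by
    intro s u
    simp only [hR', LinearIsometryEquiv.trans_apply, ← map_sub, LinearIsometryEquiv.norm_map]
    have h1 := norm_alignIso_sub_le (hne s) (hne' s) (hadd s) (g' s u)
    have h2 : 8 * ‖g s 0 - g' s 0‖ / ‖g s 0‖ * ‖g' s u‖ ≤ 8 * r / δ * B := by
      gcongr
      · exact hr s 0
      · exact h s 0
      · exact hB s u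
    have h3 : g s u - alignIso (g s 0) (g' s 0) (g' s u)
        = (g s u - g' s u) - (alignIso (g s 0) (g' s 0) (g' s u) - g' s u) := by abel
    rw [h3]
    have h4 := norm_sub_le (g s u - g' s u) (alignIso (g s 0) (g' s 0) (g' s u) - g' s u)
    have h5 := hr s u
    have h6 : r * (8 * B / δ + 1) = 8 * r / δ * B + r := by ring
    linarith
  obtain ⟨κ₂, hκ₂1, hκ₂⟩ := hG.exists_grid_close (by linarith : 0 < δ / 30)
  refine ⟨R', hR'per, hR'cont, hR'0, max κ₁ κ₂, fun κ hκ _ => ?_⟩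
  have hκa : κ₁ ≤ κ := (le_max_left _ _).trans hκ
  have hκb : κ₂ ≤ κ := (le_max_right _ _).trans hκ
  rw [← hκ₁ κ hκa]
  set G : Bool → (Fin (n + 1) → ZMod (4 * κ)) → ℕ → E3 := fun b =>
    gridOf (4 * κ) (if b then fun s u => R' s (g' s u) else fun s u => R s (g s u)) with hGdef
  have hnear : ∀ b v j, ‖G b v j - G false v j‖ ≤ δ / 30 := by
    intro b v j
    cases b
    · simp only [sub_self, norm_zero]; positivity
    · rw [norm_sub_rev]; exact hclose _ _
  have hGC : GridClose (δ / 10) (4 * κ * (n + 1)) G := by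
    refine ⟨by positivity, ?_, ?_, ?_, ?_⟩
    · intro b v t _
      have : 10 * (δ / 10) = δ := by ring
      rw [this]
      cases b
      · exact (h _ _).trans_eq (LinearIsometryEquiv.norm_map _ _).symm
      · exact (h' _ _).trans_eq (LinearIsometryEquiv.norm_map _ _).symm
    · intro v S S' _ _ b b' t ht t₁ ht₁ t₂ ht₂
      simp only [Set.mem_insert_iff, Set.mem_singleton_iff] at ht₁ ht₂
      have h1 := hnear b (v + cubeStep (4 * κ) S) t₁
      have h2 := hnear b' (v + cubeStep (4 * κ) S') t₂
      have h3 : ‖G false (v + cubeStep (4 * κ) S) t₁ - G false (v + cubeStep (4 * κ) S') t₂‖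
          ≤ δ / 30 :=
        hκ₂ κ hκb v S S' _ (div_mem_Icc_of_le (by omega)) _ (div_mem_Icc_of_le (by omega))
          (abs_div_sub_div_le (by omega) ht₁ ht₂)
      rw [← dist_eq_norm] at h1 h2 h3 ⊢
      rw [dist_comm] at h2
      have := dist_triangle4 (G b (v + cubeStep (4 * κ) S) t₁)
        (G false (v + cubeStep (4 * κ) S) t₁) (G false (v + cubeStep (4 * κ) S') t₂)
        (G b' (v + cubeStep (4 * κ) S') t₂)
      linarith
    · intro b v
      cases b
      · simpa [hGdef, gridOf] using hR0 _
      · simpa [hGdef, gridOf] using hR'0 _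
    · have hone : ((4 * κ * (n + 1) : ℕ) : ℝ) / ((4 * κ * (n + 1) : ℕ) : ℝ) = 1 :=
        div_self (by exact_mod_cast (mul_ne_zero (NeZero.ne (4 * κ)) (by omega)))
      intro b v
      cases b
      · simp only [hGdef, gridOf, hone, Bool.false_eq_true, if_false, hg.closed]
        exact hR0 _
      · simp only [hGdef, gridOf, hone, if_true, hg'.closed]
        exact hR'0 _
  have := hGC.torusCount_eq
  simpa only [hGdef, if_true, Bool.false_eq_true, if_false] using this

/-- An essential family contains a path with many long oscillations. -/
theorem Essential.lipschitz_bound {n : ℕ} {g : (Fin n → ℝ) → ℝ → E3} (hE : Essential g)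
    (hg : LoopFamily g) {δ Λ : ℝ} (hδ : 0 < δ) (h : ∀ s u, δ ≤ ‖g s u‖)
    (hΛ : ∀ s u u', ‖g s u - g s u'‖ ≤ Λ * |u - u'|) : (n - 1) * δ ≤ Λ := by
  obtain ⟨R, hRper, hRcont, -, κ₁, hκ₁⟩ := hE
  have hΛ0 : 0 ≤ Λ := by simpa using (norm_nonneg _).trans (hΛ 0 1 0)
  rcases Nat.lt_or_ge n 2 with hn | hn
  · have : (n : ℝ) ≤ 1 := by exact_mod_cast Nat.lt_succ_iff.1 hn
    nlinarith
  have hG := hg.comp hRper hRcont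
  set ε := δ / 10 with hεdef
  have hε : 0 < ε := by positivity
  obtain ⟨κ₂, hκ₂1, hκ₂⟩ := hG.exists_grid_close hε
  set κ := max κ₁ κ₂
  have hκa : κ₁ ≤ κ := le_max_left _ _
  have hκb : κ₂ ≤ κ := le_max_right _ _
  have : NeZero (4 * κ) := ⟨by omega⟩
  have hne : torusCount n (4 * κ) (4 * κ * n) (gridOf (4 * κ) fun s u => R s (g s u)) ≠ 0 := by
    rw [hκ₁ κ hκa]; exact one_ne_zero
  obtain ⟨τ, -, hτ⟩ := Finset.exists_ne_zero_of_sum_ne_zero hne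
  obtain ⟨v, -, hv⟩ := Finset.exists_ne_zero_of_sum_ne_zero hτ
  obtain ⟨t, htL, htm, hhit⟩ := exists_strictMono_of_staircase_ne_zero hv
  set L := 4 * κ * n with hL
  have hL0 : (0 : ℝ) < L := by
    have : 0 < L := Nat.mul_pos (by omega) (by omega)
    exact_mod_cast this
  set y : ℕ → ℕ → E3 := fun i => gridOf (4 * κ) (fun s u => R s (g s u))
    (v + cubeStep (4 * κ) fun j => (τ j.castSucc).val < i) with hy
  have hfar : ∀ i k, 10 * ε ≤ ‖y i k‖ := by
    intro i k
    have : 10 * ε = δ := by rw [hεdef]; ring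
    rw [this]
    exact (h _ _).trans_eq (LinearIsometryEquiv.norm_map _ _).symm
  have hcl : ∀ i i' a b k, k < L → (a = k ∨ a = k + 1) → (b = k ∨ b = k + 1) →
      ‖y i a - y i' b‖ ≤ ε := by
    intro i i' a b k hk ha hb
    exact hκ₂ κ hκb v _ _ _ (div_mem_Icc_of_le (by omega)) _ (div_mem_Icc_of_le (by omega))
      (abs_div_sub_div_le (by omega) ha hb)
  have hlip : ∀ i a b, a ≤ b → ‖y i a - y i b‖ ≤ Λ * ((b - a) / L) := by
    intro i a b hab
    have h1 := hΛ (gridPt (v + cubeStep (4 * κ) fun j => (τ j.castSucc).val < i)) (a / L) (b / L)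
    have h2 : |(a / L : ℝ) - b / L| = (b - a) / L := by
      rw [← sub_div, abs_div, abs_of_pos hL0, abs_sub_comm, abs_of_nonneg]
      have : (a : ℝ) ≤ b := by exact_mod_cast hab
      linarith
    rw [h2] at h1
    refine le_trans (le_of_eq ?_) h1
    simp only [hy, gridOf, ← map_sub, LinearIsometryEquiv.norm_map, hL]
  have hheight : ∀ i < n, 9 * ε ≤ (-1) ^ i * y i (t i) 2 := by
    intro i hi
    have hs := neg_one_pow_cases i
    rcases ne_or_eq (axisHit ((-1) ^ i) (y i (t i)) (y (i + 1) (t i)) (y (i + 1) (t i + 1))) 0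
      with h0 | h0
    · exact height_of_axisHit hs hε (hfar _ _) (hcl _ _ _ _ _ (htL i hi) (.inl rfl) (.inl rfl))
        (hcl _ _ _ _ _ (htL i hi) (.inl rfl) (.inr rfl))
        (hcl _ _ _ _ _ (htL i hi) (.inl rfl) (.inr rfl)) h0
    · have h1 := hhit i hi
      rw [stripHit, h0, zero_add] at h1
      exact height_of_axisHit hs hε (hfar _ _) (hcl _ _ _ _ _ (htL i hi) (.inl rfl) (.inr rfl))
        (hcl _ _ _ _ _ (htL i hi) (.inr rfl) (.inr rfl))
        (hcl _ _ _ _ _ (htL i hi) (.inl rfl) (.inr rfl)) h1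
  have hstep : ∀ i, i + 1 < n → 17 * ε ≤ Λ * ((t (i + 1) - t i) / L) := by
    intro i hi
    have h1 := hheight i (by omega)
    have h2 := hheight (i + 1) hi
    have h3 := coord_sub_le (hcl i (i + 1) (t i) (t i) (t i) (htL i (by omega)) (.inl rfl)
      (.inl rfl)) 2
    have h4 := coord_sub_le (hlip (i + 1) (t i) (t (i + 1)) (htm i (i + 1) (by omega) hi).le) 2
    rw [pow_succ] at h2
    rw [abs_le] at h3 h4
    rcases neg_one_pow_cases i with h5 | h5 <;> rw [h5] at h1 h2 <;> linarith
  have hsum : ∀ k, k + 1 ≤ n → k * (17 * ε) ≤ Λ * ((t k - t 0) / L) := by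
    intro k
    induction k with
    | zero => intro _; simp
    | succ k ih =>
      intro hk
      have h1 := ih (by omega)
      have h2 := hstep k (by omega)
      have h3 : Λ * ((t (k + 1) - t 0) / L) =
        Λ * ((t (k + 1) - t k) / L) + Λ * ((t k - t 0) / L) := by ring
      rw [h3]; push_cast; linarith
  have hfin := hsum (n - 1) (by omega)
  rw [Nat.cast_sub (by omega), Nat.cast_one] at hfin
  have h6 : Λ * (((t (n - 1) : ℝ) - t 0) / L) ≤ Λ * 1 := by
    gcongr
    rw [div_le_one hL0]
    have h7 : (t (n - 1) : ℝ) ≤ L := by exact_mod_cast (htL (n - 1) (by omega)).le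
    have h8 : (0 : ℝ) ≤ t 0 := by positivity
    linarith
  have h9 : (0 : ℝ) ≤ n - 1 := by
    have : (1 : ℝ) ≤ n := by exact_mod_cast (by omega : 1 ≤ n)
    linarith
  have h10 : ((n : ℝ) - 1) * δ ≤ (n - 1) * (17 * ε) := by
    gcongr; rw [hεdef]; linarith
  linarith

/-- The loop on the circle of length `T` induced by a continuous periodic function. -/
def loopOf {T : ℝ} (x : ℝ → E3) (hx : Continuous x) (hp : Periodic x T) : C(AddCircle T, E3) where
  toFun := hp.lift
  continuous_toFun := continuous_coinduced_dom.2 hx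

@[simp] lemma loopOf_coe {T : ℝ} (x : ℝ → E3) (hx : Continuous x) (hp : Periodic x T) (t : ℝ) :
    loopOf x hx hp t = x t := hp.lift_coe t

/-- Loops of speed at most `c`. -/
def SpeedLE {T : ℝ} (c : ℝ) (x : C(AddCircle T, E3)) : Prop :=
  ∀ s t : ℝ, ‖x s - x t‖ ≤ c * |s - t|

lemma norm_le_sum_abs (x : E3) : ‖x‖ ≤ |x 0| + |x 1| + |x 2| := by
  refine abs_le_of_sq_le_sq' ?_ (by positivity) |>.2
  rw [norm_sq_eq, ← sq_abs (x 0), ← sq_abs (x 1), ← sq_abs (x 2)]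
  nlinarith [abs_nonneg (x 0), abs_nonneg (x 1), abs_nonneg (x 2),
    mul_nonneg (abs_nonneg (x 0)) (abs_nonneg (x 1)),
    mul_nonneg (abs_nonneg (x 0)) (abs_nonneg (x 2)),
    mul_nonneg (abs_nonneg (x 2)) (abs_nonneg (x 1))]

lemma norm_bubble_sub_le (σ τ σ' τ' : ℝ) :
    ‖bubble σ τ - bubble σ' τ'‖ ≤ 60 * (|σ - σ'| + |τ - τ'|) := by
  have hπ := Real.pi_lt_four
  have hπ0 := Real.pi_pos
  have e : ∀ a b : ℝ, |2 * Real.pi * a - 2 * Real.pi * b| ≤ 8 * |a - b| := by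
    intro a b
    rw [← mul_sub, abs_mul, abs_of_pos (by positivity)]
    gcongr; linarith
  have hcs := (Real.abs_cos_sub_cos_le _ _).trans (e σ σ')
  have hct := (Real.abs_cos_sub_cos_le _ _).trans (e τ τ')
  have hss := (Real.abs_sin_sub_sin_le _ _).trans (e σ σ')
  have hst := (Real.abs_sin_sub_sin_le _ _).trans (e τ τ')
  have h0 := abs_max_sub_max_le_max (Real.cos (2 * Real.pi * σ)) (Real.cos (2 * Real.pi * τ))
    (Real.cos (2 * Real.pi * σ')) (Real.cos (2 * Real.pi * τ'))
  have h0' := h0.trans (max_le_add_of_nonneg (abs_nonneg _) (abs_nonneg _))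
  have h1 : |Real.sin (2 * Real.pi * σ) * (1 - Real.cos (2 * Real.pi * τ)) -
      Real.sin (2 * Real.pi * σ') * (1 - Real.cos (2 * Real.pi * τ'))| ≤
      |Real.sin (2 * Real.pi * σ) - Real.sin (2 * Real.pi * σ')| * 2 +
      1 * |Real.cos (2 * Real.pi * τ) - Real.cos (2 * Real.pi * τ')| := by
    have e2 : Real.sin (2 * Real.pi * σ) * (1 - Real.cos (2 * Real.pi * τ)) -
      Real.sin (2 * Real.pi * σ') * (1 - Real.cos (2 * Real.pi * τ')) =
      (Real.sin (2 * Real.pi * σ) - Real.sin (2 * Real.pi * σ')) *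
        (1 - Real.cos (2 * Real.pi * τ)) -
      Real.sin (2 * Real.pi * σ') *
        (Real.cos (2 * Real.pi * τ) - Real.cos (2 * Real.pi * τ')) := by ring
    rw [e2]
    refine (abs_sub _ _).trans ?_
    rw [abs_mul, abs_mul]
    gcongr
    · rw [abs_le]
      constructor <;> linarith [Real.cos_le_one (2 * Real.pi * τ),
        Real.neg_one_le_cos (2 * Real.pi * τ)]
    · exact Real.abs_sin_le_one _
  refine (norm_le_sum_abs _).trans ?_
  simp only [bubble, PiLp.sub_apply]
  simp
  linarith [abs_nonneg (σ - σ'), abs_nonneg (τ - τ')]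

lemma bubble_zero (σ : ℝ) : bubble σ 0 = !₂[1, 0, 0] := by
  simp [bubble, Real.cos_le_one]

lemma bubble_one (σ : ℝ) : bubble σ 1 = !₂[1, 0, 0] := by
  simp [bubble, Real.cos_le_one]

lemma bubble_add_int (σ τ : ℝ) (z : ℤ) : bubble (σ + z) τ = bubble σ τ := by
  have h : 2 * Real.pi * (σ + z) = 2 * Real.pi * σ + z * (2 * Real.pi) := by ring
  simp only [bubble, h, Real.cos_add_int_mul_two_pi, Real.sin_add_int_mul_two_pi]

lemma le_norm_bubble (σ τ : ℝ) : 1 / 4 ≤ ‖bubble σ τ‖ := by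
  by_contra! h
  have h0 := (coord_abs_le (bubble σ τ) 0).trans_lt h
  have h1 := (coord_abs_le (bubble σ τ) 1).trans_lt h
  have h2 := (coord_abs_le (bubble σ τ) 2).trans_lt h
  simp only [bubble] at h0 h1 h2
  simp at h0 h1 h2
  have p1 := Real.sin_sq_add_cos_sq (2 * Real.pi * σ)
  have p2 := Real.sin_sq_add_cos_sq (2 * Real.pi * τ)
  set a := Real.cos (2 * Real.pi * σ)
  set b := Real.cos (2 * Real.pi * τ)
  set u := Real.sin (2 * Real.pi * σ)
  set v := Real.sin (2 * Real.pi * τ)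
  rw [← abs_mul] at h1
  rw [abs_lt] at h0 h1 h2
  have ha := (le_max_left a b).trans_lt h0.2
  have hb := (le_max_right a b).trans_lt h0.2
  have hb2 : b < -1 / 2 := by nlinarith
  have hu1 : u < 1 / 4 := by nlinarith
  have hu2 : -(1 / 4) < u := by nlinarith
  have ha2 : a < -1 / 2 := by nlinarith
  have := max_lt ha2 hb2
  linarith

/-- The truncation to the unit interval. -/
def clampUnit (w : ℝ) : ℝ := max 0 (min 1 w)

lemma clampUnit_sub_le (w w' : ℝ) : |clampUnit w - clampUnit w'| ≤ |w - w'| := by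
  have h1 := abs_max_sub_max_le_max 0 (min 1 w) 0 (min 1 w')
  have h2 := abs_min_sub_min_le_max 1 w 1 w'
  simp only [sub_self, abs_zero] at h1 h2
  unfold clampUnit
  exact h1.trans (max_le (abs_nonneg _) (h2.trans (max_le (abs_nonneg _) le_rfl)))

lemma clampUnit_of_nonpos {w : ℝ} (h : w ≤ 0) : clampUnit w = 0 :=
  max_eq_left ((min_le_right _ _).trans h)

lemma clampUnit_of_one_le {w : ℝ} (h : 1 ≤ w) : clampUnit w = 1 := by
  simp [clampUnit, min_eq_left h]

lemma clampUnit_of_mem {w : ℝ} (h0 : 0 ≤ w) (h1 : w ≤ 1) : clampUnit w = w := by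
  simp [clampUnit, h0, h1]

/-- The successive concatenation of bubbles, on the unit interval. -/
def chain {n : ℕ} (s : Fin n → ℝ) (u : ℝ) : E3 :=
  !₂[1, 0, 0] + ∑ b : Fin n, (bubble (s b) (clampUnit (n * u - b)) - !₂[1, 0, 0])

lemma chain_eq {n : ℕ} (s : Fin n → ℝ) {u : ℝ} (b : Fin n) (h0 : b ≤ n * u) (h1 : n * u ≤ b + 1) :
    chain s u = bubble (s b) (n * u - b) := by
  rw [chain, Finset.sum_eq_single b, clampUnit_of_mem (by linarith) (by linarith)]
  · abel
  · intro b' _ hb'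
    rcases lt_or_gt_of_ne hb' with h | h
    · have : (b' : ℝ) + 1 ≤ b := by exact_mod_cast h
      rw [clampUnit_of_one_le (by linarith), bubble_one, sub_self]
    · have : (b : ℝ) + 1 ≤ b' := by exact_mod_cast h
      rw [clampUnit_of_nonpos (by linarith), bubble_zero, sub_self]
  · simp

lemma chain_zero {n : ℕ} (s : Fin n → ℝ) : chain s 0 = !₂[1, 0, 0] := by
  rw [chain, Finset.sum_eq_zero, add_zero]
  intro b _
  rw [clampUnit_of_nonpos (by simp), bubble_zero, sub_self]

lemma chain_one {n : ℕ} (s : Fin n → ℝ) : chain s 1 = !₂[1, 0, 0] := by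
  rw [chain, Finset.sum_eq_zero, add_zero]
  intro b _
  have : (b : ℝ) + 1 ≤ n := by exact_mod_cast b.2
  rw [clampUnit_of_one_le (by linarith), bubble_one, sub_self]

lemma norm_chain_sub_le {n : ℕ} (s s' : Fin n → ℝ) (u u' : ℝ) :
    ‖chain s u - chain s' u'‖ ≤ 60 * n * (‖s - s'‖ + n * |u - u'|) := by
  have e : chain s u - chain s' u' = ∑ b : Fin n, (bubble (s b) (clampUnit (n * u - b)) -
      bubble (s' b) (clampUnit (n * u' - b))) := by
    simp only [chain, add_sub_add_left_eq_sub, ← Finset.sum_sub_distrib, sub_sub_sub_cancel_right]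
  rw [e]
  have : ∀ b ∈ (Finset.univ : Finset (Fin n)), ‖bubble (s b) (clampUnit (n * u - b)) -
      bubble (s' b) (clampUnit (n * u' - b))‖ ≤ 60 * (‖s - s'‖ + n * |u - u'|) := by
    intro b _
    refine (norm_bubble_sub_le _ _ _ _).trans ?_
    have h1 : |s b - s' b| ≤ ‖s - s'‖ := norm_le_pi_norm (s - s') b
    have h2 := clampUnit_sub_le (n * u - b) (n * u' - b)
    have h3 : |(n : ℝ) * u - b - (n * u' - b)| = n * |u - u'| := by
      rw [sub_sub_sub_cancel_right, ← mul_sub, abs_mul, Nat.abs_cast]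
    rw [h3] at h2
    gcongr
  refine (norm_sum_le_of_le _ this).trans (le_of_eq ?_)
  simp; ring

lemma chain_add_int {n : ℕ} (s : Fin n → ℝ) (z : Fin n → ℤ) (u : ℝ) :
    chain (s + fun i => (z i : ℝ)) u = chain s u := by
  simp only [chain, Pi.add_apply, bubble_add_int]

lemma le_norm_chain {n : ℕ} (hn : 0 < n) (s : Fin n → ℝ) {u : ℝ} (h0 : 0 ≤ u) (h1 : u < 1) :
    1 / 4 ≤ ‖chain s u‖ := by
  have hn' : (0 : ℝ) < n := by exact_mod_cast hn
  have hnu : 0 ≤ n * u := by positivity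
  have hlt : ⌊n * u⌋₊ < n := (Nat.floor_lt hnu).2 (by nlinarith)
  rw [chain_eq s ⟨⌊n * u⌋₊, hlt⟩ (Nat.floor_le hnu) (Nat.lt_floor_add_one _).le]
  exact le_norm_bubble _ _

lemma norm_fract_sub_le {E : Type*} [SeminormedAddCommGroup E] {P : ℝ → E} {Λ : ℝ}
    (hP : ∀ u u', ‖P u - P u'‖ ≤ Λ * |u - u'|) (h01 : P 0 = P 1) (a b : ℝ) :
    ‖P (Int.fract a) - P (Int.fract b)‖ ≤ Λ * |a - b| := by
  wlog hab : a ≤ b generalizing a b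
  · rw [norm_sub_rev, abs_sub_comm]; exact this b a (le_of_not_ge hab)
  have hΛ : 0 ≤ Λ := by simpa using (norm_nonneg _).trans (hP 1 0)
  rcases (Int.floor_mono hab).eq_or_lt with h | h
  · have : Int.fract a - Int.fract b = a - b := by rw [Int.fract, Int.fract, h]; ring
    rw [← this]; exact hP _ _
  · have h1 := hP (Int.fract a) 1
    have h2 := hP 0 (Int.fract b)
    rw [h01] at h2
    have h3 := norm_sub_le_norm_sub_add_norm_sub (P (Int.fract a)) (P 1) (P (Int.fract b))
    have ha := Int.fract_lt_one a
    have hb := Int.fract_nonneg b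
    rw [abs_of_nonpos (by linarith)] at h1 h2
    rw [abs_of_nonpos (by linarith)]
    have h4 : (⌊a⌋ : ℝ) + 1 ≤ ⌊b⌋ := by exact_mod_cast h
    have h5 : 1 - Int.fract a + Int.fract b ≤ b - a := by
      rw [Int.fract, Int.fract]; linarith
    have h6 := mul_le_mul_of_nonneg_left h5 hΛ
    linarith

/-- Essential families of slow loops exist in every dimension. -/
theorem exists_essential (T : ℝ) [hT : Fact (0 < T)] {c : ℝ} (hc : 0 < c) (n : ℕ) :
    ∃ f : (Fin (n + 1) → ℝ) → C(AddCircle T, E3), Continuous f ∧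
      (∀ s (z : Fin (n + 1) → ℤ), f (s + fun i => (z i : ℝ)) = f s) ∧ (∀ s, SpeedLE c (f s)) ∧
      (∃ δ > 0, ∀ s t, δ ≤ ‖f s t‖) ∧ (∃ B, ∀ s, ‖f s‖ ≤ B) ∧
      Essential fun s u => f s ((T * u : ℝ) : AddCircle T) := by
  have hT0 : 0 < T := hT.out
  set N : ℝ := 60 * (n + 1 : ℕ) * (n + 1 : ℕ) with hN
  have hN0 : 0 < N := by positivity
  set ρ : ℝ := c * T / N with hρ
  have hρ0 : 0 < ρ := by positivity
  set x : (Fin (n + 1) → ℝ) → ℝ → E3 := fun s t => ρ • chain s (Int.fract (t / T)) with hx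
  have hlip : ∀ s a b, ‖x s a - x s b‖ ≤ c * |a - b| := by
    intro s a b
    have h1 : ∀ u u', ‖chain s u - chain s u'‖ ≤ N * |u - u'| := fun u u' => by
      refine (norm_chain_sub_le s s u u').trans (le_of_eq ?_)
      rw [sub_self, norm_zero, hN]; ring
    have h2 := norm_fract_sub_le h1 (by rw [chain_zero, chain_one]) (a / T) (b / T)
    simp only [hx, ← smul_sub, norm_smul, Real.norm_of_nonneg hρ0.le]
    refine (mul_le_mul_of_nonneg_left h2 hρ0.le).trans (le_of_eq ?_)
    rw [← sub_div, abs_div, abs_of_pos hT0, hρ]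
    field_simp
  have hcont : ∀ s, Continuous (x s) := fun s =>
    (LipschitzWith.of_dist_le_mul (K := ⟨c, hc.le⟩) fun a b => by
      rw [dist_eq_norm, Real.dist_eq]; exact hlip s a b).continuous
  have hper : ∀ s, Periodic (x s) T := fun s t => by
    simp only [hx, add_div, div_self hT0.ne', Int.fract_add_one]
  set f : (Fin (n + 1) → ℝ) → C(AddCircle T, E3) := fun s => loopOf (x s) (hcont s) (hper s) with hf
  have hfx : ∀ s (t : ℝ), f s t = x s t := fun s t => loopOf_coe _ _ _ _
  have hfs : ∀ s s', ‖f s - f s'‖ ≤ ρ * (60 * (n + 1 : ℕ)) * ‖s - s'‖ := by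
    intro s s'
    rw [ContinuousMap.norm_le _ (by positivity)]
    intro t
    induction t using QuotientAddGroup.induction_on with | H t => ?_
    rw [ContinuousMap.sub_apply]
    change ‖f s (t : AddCircle T) - f s' (t : AddCircle T)‖ ≤ _
    rw [hfx, hfx]
    simp only [hx, ← smul_sub, norm_smul, Real.norm_of_nonneg hρ0.le]
    rw [mul_assoc]
    refine mul_le_mul_of_nonneg_left ((norm_chain_sub_le s s' _ _).trans (le_of_eq ?_)) hρ0.le
    simp
  have hfper : ∀ s (z : Fin (n + 1) → ℤ), f (s + fun i => (z i : ℝ)) = f s := fun s z => by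
    ext1 t
    induction t using QuotientAddGroup.induction_on with | H t => ?_
    rw [hfx, hfx]
    simp only [hx, chain_add_int]
  refine ⟨f, ?_, hfper, ?_, ⟨ρ / 4, by positivity, ?_⟩, ?_, ?_⟩
  · refine (LipschitzWith.of_dist_le_mul (K := ⟨ρ * (60 * (n + 1 : ℕ)), by positivity⟩)
      fun a b => ?_).continuous
    rw [dist_eq_norm, dist_eq_norm]; exact hfs a b
  · intro s a b
    rw [hfx, hfx]; exact hlip s a b
  · intro s t
    induction t using QuotientAddGroup.induction_on with | H t => ?_
    rw [hfx]
    simp only [hx, norm_smul, Real.norm_of_nonneg hρ0.le]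
    have := le_norm_chain (Nat.succ_pos n) s (Int.fract_nonneg (t / T)) (Int.fract_lt_one _)
    rw [div_eq_mul_inv]
    gcongr
    linarith
  · refine ⟨‖f 0‖ + ρ * (60 * (n + 1 : ℕ)), fun s => ?_⟩
    have h1 := hfper s fun i => -⌊s i⌋
    have h2 : (s + fun i => ((-⌊s i⌋ : ℤ) : ℝ)) = fun i => Int.fract (s i) := by
      funext i
      simp only [Pi.add_apply, Int.fract]; push_cast; ring
    rw [← h1, h2]
    have h3 := hfs (fun i => Int.fract (s i)) 0
    have h4 : ‖(fun i => Int.fract (s i)) - (0 : Fin (n + 1) → ℝ)‖ ≤ 1 := by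
      rw [sub_zero]
      refine (pi_norm_le_iff_of_nonneg zero_le_one).2 fun i => ?_
      rw [Real.norm_of_nonneg (Int.fract_nonneg _)]
      exact (Int.fract_lt_one _).le
    have h5 := norm_le_norm_add_norm_sub' (f fun i => Int.fract (s i)) (f 0)
    have h6 := mul_le_mul_of_nonneg_left h4
      (by positivity : 0 ≤ ρ * (60 * ((n + 1 : ℕ) : ℝ)))
    linarith
  · refine ⟨fun _ => LinearIsometryEquiv.refl ℝ E3, fun _ _ => rfl, fun _ hb => hb, ?_, 2, ?_⟩
    · intro s
      change 0 < f s ((T * 0 : ℝ) : AddCircle T) 0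
      rw [hfx]
      simp [hx, chain_zero, hρ0]
    · intro κ hκ _
      refine torusCount_concat hκ hρ0 fun w b k hk => ?_
      have hκ0 : (0 : ℝ) < (4 * κ : ℕ) := by exact_mod_cast (by omega : 0 < 4 * κ)
      have hn0 : (0 : ℝ) < (n + 1 : ℕ) := by positivity
      simp only [gridOf, LinearIsometryEquiv.coe_refl, id, hfx]
      set u : ℝ := ((4 * κ * b + k : ℕ) : ℝ) / (4 * κ * (n + 1) : ℕ) with hu
      have hnu : ((n + 1 : ℕ) : ℝ) * u = b + (k : ℝ) / (4 * κ : ℕ) := by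
        have hκ1 : (0 : ℝ) < κ := by exact_mod_cast (by omega : 0 < κ)
        rw [hu]; push_cast
        field_simp
      have hk1 : (k : ℝ) / (4 * κ : ℕ) ≤ 1 := (div_le_one hκ0).2 (by exact_mod_cast hk)
      have hk0 : 0 ≤ (k : ℝ) / (4 * κ : ℕ) := by positivity
      have hb : (b : ℝ) + 1 ≤ (n + 1 : ℕ) := by exact_mod_cast b.2
      have hu0 : 0 ≤ u := by positivity
      have hu1 : u ≤ 1 := by
        by_contra! h
        nlinarith
      have hfr : chain (gridPt w) (Int.fract u) = chain (gridPt w) u := by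
        rcases hu1.eq_or_lt with h | h
        · rw [h, Int.fract_one, chain_zero, chain_one]
        · rw [Int.fract_eq_self.2 ⟨hu0, h⟩]
      simp only [hx, mul_div_cancel_left₀ _ hT0.ne', hfr]
      rw [chain_eq _ b (by linarith) (by linarith), hnu, add_sub_cancel_left]
      rfl

/-- The relativistic energy `√(μ² + |p|²)`, up to the factor `c`, as a function of momentum. -/
def energy (μ : ℝ) (p : E3) : ℝ := Real.sqrt (μ ^ 2 + ‖p‖ ^ 2)

/-- The relativistic kinetic Hamiltonian. -/
def ham (c μ : ℝ) (p : E3) : ℝ := c * energy μ p - c * μ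

/-- The velocity as a function of momentum. -/
def velocity (c μ : ℝ) (p : E3) : E3 := (c / energy μ p) • p

section ham

variable {c μ : ℝ}

lemma energy_sq (μ : ℝ) (p : E3) : energy μ p ^ 2 = μ ^ 2 + ‖p‖ ^ 2 := Real.sq_sqrt (by positivity)

lemma le_energy (μ : ℝ) (p : E3) : μ ≤ energy μ p :=
  Real.le_sqrt_of_sq_le (by nlinarith [sq_nonneg ‖p‖])

lemma energy_pos (hμ : 0 < μ) (p : E3) : 0 < energy μ p := hμ.trans_le (le_energy μ p)

lemma norm_le_energy (μ : ℝ) (p : E3) : ‖p‖ ≤ energy μ p :=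
  Real.le_sqrt_of_sq_le (by nlinarith [sq_nonneg μ])

lemma continuous_energy (μ : ℝ) : Continuous (energy μ) := by unfold energy; fun_prop

@[fun_prop] lemma continuous_ham (c μ : ℝ) : Continuous (ham c μ) :=
  (continuous_const.mul (continuous_energy μ)).sub continuous_const

lemma continuous_velocity (hμ : 0 < μ) : Continuous (velocity c μ) :=
  (continuous_const.div (continuous_energy μ) fun p => (energy_pos hμ p).ne').smul continuous_id

@[simp] lemma ham_zero (hμ : 0 < μ) : ham c μ 0 = 0 := by
  simp [ham, energy, Real.sqrt_sq hμ.le]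

lemma le_ham (hc : 0 < c) (p : E3) : c * ‖p‖ - c * μ ≤ ham c μ p := by
  have := mul_le_mul_of_nonneg_left (norm_le_energy μ p) hc.le
  unfold ham; linarith

lemma norm_velocity_lt (hc : 0 < c) (hμ : 0 < μ) (p : E3) : ‖velocity c μ p‖ < c := by
  have h := energy_pos hμ p
  rw [velocity, norm_smul, Real.norm_of_nonneg (by positivity), div_mul_eq_mul_div, div_lt_iff₀ h]
  have : ‖p‖ < energy μ p := by
    refine lt_of_pow_lt_pow_left₀ 2 h.le ?_
    rw [energy_sq]; nlinarith
  exact mul_lt_mul_of_pos_left this hc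

lemma ham_add_le (hc : 0 < c) (hμ : 0 < μ) (q h : E3) :
    ham c μ (q + h) ≤ ham c μ q + inner ℝ (velocity c μ q) h + c / (2 * μ) * ‖h‖ ^ 2 := by
  have hA := energy_pos hμ q
  have hB := energy_pos hμ (q + h)
  have e := energy_sq μ (q + h)
  rw [@norm_add_sq_real] at e
  have e' := energy_sq μ q
  have h1 : energy μ (q + h) ≤ energy μ q + inner ℝ q h / energy μ q +
      ‖h‖ ^ 2 / (2 * energy μ q) := by
    have : energy μ q + inner ℝ q h / energy μ q + ‖h‖ ^ 2 / (2 * energy μ q) =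
        (energy μ q ^ 2 + energy μ (q + h) ^ 2) / (2 * energy μ q) := by
      rw [e]; field_simp; linarith
    rw [this, le_div_iff₀ (by positivity)]
    nlinarith [sq_nonneg (energy μ q - energy μ (q + h))]
  have h2 : ‖h‖ ^ 2 / (2 * energy μ q) ≤ ‖h‖ ^ 2 / (2 * μ) := by
    gcongr; exact le_energy μ q
  have h3 := mul_le_mul_of_nonneg_left (h1.trans (add_le_add_right h2 _)) hc.le
  rw [ham, ham, velocity, real_inner_smul_left]
  have : c * (energy μ q + inner ℝ q h / energy μ q + ‖h‖ ^ 2 / (2 * μ)) =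
    c * energy μ q + c / energy μ q * inner ℝ q h + c / (2 * μ) * ‖h‖ ^ 2 := by ring
  linarith

lemma le_ham_add (hc : 0 < c) (hμ : 0 < μ) (q p : E3) :
    ham c μ q + inner ℝ (velocity c μ q) (p - q) ≤ ham c μ p := by
  have hA := energy_pos hμ q
  have hB := energy_pos hμ p
  have eB := energy_sq μ p
  have eA := energy_sq μ q
  have h1 : μ ^ 2 + inner ℝ q p ≤ energy μ p * energy μ q := by
    have h2 := real_inner_le_norm q p
    have h3 : (μ ^ 2 + ‖q‖ * ‖p‖) ^ 2 ≤ (energy μ p * energy μ q) ^ 2 := by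
      rw [mul_pow, eB, eA]
      nlinarith [mul_nonneg (sq_nonneg μ) (sq_nonneg (‖q‖ - ‖p‖))]
    have := le_of_sq_le_sq h3 (by positivity)
    linarith
  have h4 : inner ℝ (velocity c μ q) (p - q) =
      c / energy μ q * (μ ^ 2 + inner ℝ q p) - c * energy μ q := by
    rw [velocity, real_inner_smul_left, inner_sub_right, real_inner_self_eq_norm_sq]
    field_simp
    linear_combination eA
  have h5 := mul_le_mul_of_nonneg_left h1 (by positivity : 0 ≤ c / energy μ q)
  have h6 : c / energy μ q * (energy μ p * energy μ q) = c * energy μ p := by field_simp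
  rw [ham, ham]; linarith

lemma momentum_velocity {m : ℝ} (hc : 0 < c) (hm : 0 < m) (q : E3) :
    (Real.sqrt (1 - ‖velocity c (m * c) q‖ ^ 2 / c ^ 2))⁻¹ • (m • velocity c (m * c) q) = q := by
  have hμ : 0 < m * c := by positivity
  have hA := energy_pos hμ q
  have e := energy_sq (m * c) q
  have h1 : 1 - ‖velocity c (m * c) q‖ ^ 2 / c ^ 2 = (m * c / energy (m * c) q) ^ 2 := by
    rw [velocity, norm_smul, Real.norm_of_nonneg (by positivity)]
    generalize energy (m * c) q = A at hA e ⊢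
    field_simp; linarith
  rw [h1, Real.sqrt_sq (by positivity), velocity, smul_smul, smul_smul]
  have : (m * c / energy (m * c) q)⁻¹ * (m * (c / energy (m * c) q)) = 1 := by field_simp
  rw [mul_assoc, this, one_smul]

end ham

/-- `C¹` periodic momenta together with their derivative. -/
structure IsTest (T : ℝ) (q q' : ℝ → E3) : Prop where
  hasDerivAt : ∀ t, HasDerivAt q (q' t) t
  cont : Continuous q'
  per : Periodic q T

@[fun_prop] lemma continuous_loop {T : ℝ} (x : C(AddCircle T, E3)) :
    Continuous fun t : ℝ => x (t : AddCircle T) := x.continuous.comp (AddCircle.continuous_mk' T)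

lemma periodic_loop {T : ℝ} (x : C(AddCircle T, E3)) : Periodic (fun t : ℝ => x (t : AddCircle T)) T :=
  fun t => by simp

lemma IsTest.continuous {T : ℝ} {q q' : ℝ → E3} (h : IsTest T q q') : Continuous q :=
  continuous_iff_continuousAt.2 fun t => (h.hasDerivAt t).continuousAt

lemma IsTest.per' {T : ℝ} {q q' : ℝ → E3} (h : IsTest T q q') : Periodic q' T := fun t => by
  have h1 : HasDerivAt (fun s => q (s + T)) (q' (t + T)) t := (h.hasDerivAt (t + T)).comp_add_const t T
  simp only [h.per _] at h1
  exact h1.unique (h.hasDerivAt t)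

lemma exists_norm_le_of_periodic {T : ℝ} (hT : 0 < T) {f : ℝ → E3} (hf : Continuous f)
    (hp : Periodic f T) : ∃ M, 0 ≤ M ∧ ∀ t, ‖f t‖ ≤ M := by
  obtain ⟨M, hM⟩ := (hp.isBounded_of_continuous hT.ne' hf).exists_norm_le
  exact ⟨M, (norm_nonneg _).trans (hM _ ⟨0, rfl⟩), fun t => hM _ ⟨t, rfl⟩⟩

lemma integral_inner_left {f : ℝ → E3} (hf : Continuous f) (a : E3) (u v : ℝ) :
    ∫ t in u..v, (inner ℝ a (f t) : ℝ) = inner ℝ a (∫ t in u..v, f t) :=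
  (innerSL ℝ a).intervalIntegral_comp_comm (hf.intervalIntegrable _ _)

lemma integral_inner_right {f : ℝ → E3} (hf : Continuous f) (a : E3) (u v : ℝ) :
    ∫ t in u..v, (inner ℝ (f t) a : ℝ) = inner ℝ (∫ t in u..v, f t) a := by
  simp_rw [real_inner_comm a, integral_inner_left hf]

lemma IsTest.integral_deriv {T : ℝ} {q q' : ℝ → E3} (h : IsTest T q q') :
    ∫ t in (0 : ℝ)..T, q' t = 0 := by
  rw [intervalIntegral.integral_eq_sub_of_hasDerivAt (fun t _ => h.hasDerivAt t)
    (h.cont.intervalIntegrable _ _), ← zero_add T, h.per, sub_self]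

lemma IsTest.integral_by_parts {T : ℝ} {q q' y y' : ℝ → E3} (h : IsTest T q q')
    (hy : IsTest T y y') :
    ∫ t in (0 : ℝ)..T, (inner ℝ (q' t) (y t) : ℝ) = -∫ t in (0 : ℝ)..T, (inner ℝ (q t) (y' t) : ℝ) := by
  have c1 : Continuous fun t => (inner ℝ (q' t) (y t) : ℝ) := h.cont.inner hy.continuous
  have c2 : Continuous fun t => (inner ℝ (q t) (y' t) : ℝ) := h.continuous.inner hy.cont
  have h1 : ∫ t in (0 : ℝ)..T, ((inner ℝ (q t) (y' t) : ℝ) + inner ℝ (q' t) (y t)) = 0 := by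
    rw [intervalIntegral.integral_eq_sub_of_hasDerivAt
      (fun t _ => (h.hasDerivAt t).inner ℝ (hy.hasDerivAt t))
      ((c2.add c1).intervalIntegrable _ _), ← zero_add T, h.per, hy.per, sub_self]
  rw [intervalIntegral.integral_add (c2.intervalIntegrable _ _) (c1.intervalIntegrable _ _)] at h1
  linarith

lemma abs_integral_deriv_inner_le {T c : ℝ} (hT : 0 < T) (hc : 0 ≤ c) {q q' : ℝ → E3}
    (h : IsTest T q q') {x : C(AddCircle T, E3)} (hx : SpeedLE c x) :
    |∫ t in (0 : ℝ)..T, (inner ℝ (q' t) (x t) : ℝ)| ≤ c * ∫ t in (0 : ℝ)..T, ‖q t‖ := by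
  obtain ⟨M, hM0, hM⟩ := exists_norm_le_of_periodic hT h.cont h.per'
  obtain ⟨N, hN0, hN⟩ := exists_norm_le_of_periodic hT (continuous_loop x) (periodic_loop x)
  have hq := h.continuous
  have hq' := h.cont
  have hxc := continuous_loop x
  have cF : ∀ s, Continuous fun t => (inner ℝ (q (t + s)) (x t) : ℝ) := fun s =>
    (hq.comp (continuous_id.add continuous_const)).inner hxc
  have cF' : ∀ s, Continuous fun t => (inner ℝ (q' (t + s)) (x t) : ℝ) := fun s =>
    (hq'.comp (continuous_id.add continuous_const)).inner hxc
  have hd := (intervalIntegral.hasDerivAt_integral_of_dominated_loc_of_deriv_le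
    (F := fun s t => (inner ℝ (q (t + s)) (x t) : ℝ))
    (F' := fun s t => (inner ℝ (q' (t + s)) (x t) : ℝ)) (x₀ := 0) (s := Set.univ) (a := 0) (b := T)
    (bound := fun _ => M * N) (μ := MeasureTheory.volume) Filter.univ_mem
    (Filter.Eventually.of_forall fun s => (cF s).aestronglyMeasurable)
    ((cF 0).intervalIntegrable _ _) (cF' 0).aestronglyMeasurable
    (Filter.Eventually.of_forall fun t _ s _ => by
      refine (norm_inner_le_norm _ _).trans ?_
      exact mul_le_mul (hM _) (hN _) (norm_nonneg _) hM0)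
    (continuous_const.intervalIntegrable _ _)
    (Filter.Eventually.of_forall fun t _ s _ => by
      have h1 : HasDerivAt (fun s => q (t + s)) (q' (t + s)) s :=
        (h.hasDerivAt (t + s)).comp_const_add t s
      simpa using h1.inner ℝ (hasDerivAt_const s (x (t : AddCircle T))))).2
  have hshift : ∀ s, ∫ t in (0 : ℝ)..T, (inner ℝ (q (t + s)) (x t) : ℝ) =
      ∫ t in (0 : ℝ)..T, (inner ℝ (q t) (x ((t - s : ℝ) : AddCircle T)) : ℝ) := by
    intro s
    have hp : Periodic (fun t : ℝ => (inner ℝ (q t) (x ((t - s : ℝ) : AddCircle T)) : ℝ)) T := by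
      intro t
      have : ((t + T - s : ℝ) : AddCircle T) = ((t - s : ℝ) : AddCircle T) := by
        rw [add_sub_right_comm, AddCircle.coe_add_period]
      simp only [h.per t, this]
    have := hp.intervalIntegral_add_eq 0 s
    rw [zero_add] at this
    rw [this, add_comm s T, ← zero_add s, ← add_assoc, add_zero,
      ← intervalIntegral.integral_comp_add_right]
    simp
  have hbd : ∀ᶠ s in nhds (0 : ℝ), ‖(∫ t in (0 : ℝ)..T, (inner ℝ (q (t + s)) (x t) : ℝ)) -
      ∫ t in (0 : ℝ)..T, (inner ℝ (q (t + 0)) (x t) : ℝ)‖ ≤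
      (c * ∫ t in (0 : ℝ)..T, ‖q t‖) * ‖s - 0‖ := by
    refine Filter.Eventually.of_forall fun s => ?_
    have c1 : Continuous fun t : ℝ => (inner ℝ (q t) (x ((t - s : ℝ) : AddCircle T)) : ℝ) :=
      hq.inner (hxc.comp (continuous_id.sub continuous_const))
    have c2 : Continuous fun t : ℝ => (inner ℝ (q t) (x (t : AddCircle T)) : ℝ) := hq.inner hxc
    rw [hshift s]
    simp only [add_zero]
    rw [← intervalIntegral.integral_sub (c1.intervalIntegrable _ _) (c2.intervalIntegrable _ _)]
    have e : (c * ∫ t in (0 : ℝ)..T, ‖q t‖) * ‖s - 0‖ =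
        ∫ t in (0 : ℝ)..T, c * |s| * ‖q t‖ := by
      rw [intervalIntegral.integral_const_mul, sub_zero, Real.norm_eq_abs]; ring
    rw [e]
    refine intervalIntegral.norm_integral_le_of_norm_le hT.le
      (Filter.Eventually.of_forall fun t _ => ?_)
      ((continuous_const.mul hq.norm).intervalIntegrable _ _)
    rw [← inner_sub_right]
    refine (norm_inner_le_norm _ _).trans ?_
    rw [mul_comm]
    gcongr
    refine (hx (t - s) t).trans (le_of_eq ?_)
    simp
  have h0 : 0 ≤ c * ∫ t in (0 : ℝ)..T, ‖q t‖ :=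
    mul_nonneg hc (intervalIntegral.integral_nonneg hT.le fun t _ => norm_nonneg _)
  have := hd.le_of_lip' h0 hbd
  simpa using this

/-- The dual kinetic action of a momentum and a loop. -/
def dualAct {T : ℝ} (c μ : ℝ) (q q' : ℝ → E3) (x : C(AddCircle T, E3)) : ℝ :=
  ∫ t in (0 : ℝ)..T, (-(inner ℝ (q' t) (x t) : ℝ) - ham c μ (q t))

/-- The relativistic kinetic action of a loop, as a convex conjugate. -/
def kin {T : ℝ} (c μ : ℝ) (x : C(AddCircle T, E3)) : ℝ :=
  sSup {r | ∃ q q', IsTest T q q' ∧ r = dualAct c μ q q' x}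

lemma dualAct_eq {T : ℝ} (c μ : ℝ) {q q' : ℝ → E3} (h : IsTest T q q') (x : C(AddCircle T, E3)) :
    dualAct c μ q q' x =
      -(∫ t in (0 : ℝ)..T, (inner ℝ (q' t) (x t) : ℝ)) - ∫ t in (0 : ℝ)..T, ham c μ (q t) := by
  have c1 : Continuous fun t : ℝ => (inner ℝ (q' t) (x t) : ℝ) := h.cont.inner (continuous_loop x)
  have c2 : Continuous fun t => ham c μ (q t) := (continuous_ham c μ).comp h.continuous
  have c3 : Continuous fun t : ℝ => -(inner ℝ (q' t) (x t) : ℝ) := c1.neg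
  rw [dualAct, intervalIntegral.integral_sub (c3.intervalIntegrable _ _)
    (c2.intervalIntegrable _ _), intervalIntegral.integral_neg]

lemma isTest_zero (T : ℝ) : IsTest T (fun _ => 0) (fun _ => 0) :=
  ⟨fun t => hasDerivAt_const t 0, continuous_const, fun _ => rfl⟩

lemma nonempty_dualAct {T : ℝ} (c μ : ℝ) (x : C(AddCircle T, E3)) :
    {r | ∃ q q', IsTest T q q' ∧ r = dualAct c μ q q' x}.Nonempty :=
  ⟨_, _, _, isTest_zero T, rfl⟩

lemma kin_le {T c μ : ℝ} {x : C(AddCircle T, E3)} {B : ℝ}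
    (h : ∀ q q', IsTest T q q' → dualAct c μ q q' x ≤ B) : kin c μ x ≤ B := by
  refine csSup_le (nonempty_dualAct c μ x) ?_
  rintro _ ⟨q, q', hq, rfl⟩
  exact h q q' hq

lemma exists_lt_kin {T c μ : ℝ} {x : C(AddCircle T, E3)} {B : ℝ} (h : B < kin c μ x) :
    ∃ q q', IsTest T q q' ∧ B < dualAct c μ q q' x := by
  obtain ⟨_, ⟨q, q', hq, rfl⟩, hB⟩ := exists_lt_of_lt_csSup (nonempty_dualAct c μ x) h
  exact ⟨q, q', hq, hB⟩

section

variable {T c μ : ℝ} [hT : Fact (0 < T)]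

lemma dualAct_le (hc : 0 < c) {q q' : ℝ → E3} (h : IsTest T q q') {x : C(AddCircle T, E3)}
    (hx : SpeedLE c x) : dualAct c μ q q' x ≤ c * μ * T := by
  have h1 := abs_integral_deriv_inner_le hT.out hc.le h hx
  rw [dualAct_eq c μ h]
  have c2 : Continuous fun t => ham c μ (q t) := (continuous_ham c μ).comp h.continuous
  have h2 : ∫ t in (0 : ℝ)..T, (c * ‖q t‖ - c * μ) ≤ ∫ t in (0 : ℝ)..T, ham c μ (q t) :=
    intervalIntegral.integral_mono_on hT.out.le
      (((continuous_const.mul h.continuous.norm).sub continuous_const).intervalIntegrable _ _)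
      (c2.intervalIntegrable _ _) fun t _ => le_ham hc _
  have c3 : Continuous fun t => c * ‖q t‖ := continuous_const.mul h.continuous.norm
  rw [intervalIntegral.integral_sub (c3.intervalIntegrable _ _)
    (continuous_const.intervalIntegrable _ _), intervalIntegral.integral_const_mul,
    intervalIntegral.integral_const, smul_eq_mul, sub_zero] at h2
  rw [abs_le] at h1
  linarith

lemma bddAbove_dualAct (hc : 0 < c) {x : C(AddCircle T, E3)} (hx : SpeedLE c x) :
    BddAbove {r | ∃ q q', IsTest T q q' ∧ r = dualAct c μ q q' x} := by
  refine ⟨c * μ * T, ?_⟩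
  rintro _ ⟨q, q', h, rfl⟩
  exact dualAct_le hc h hx

lemma le_kin (hc : 0 < c) {x : C(AddCircle T, E3)} (hx : SpeedLE c x) {q q' : ℝ → E3}
    (h : IsTest T q q') : dualAct c μ q q' x ≤ kin c μ x :=
  le_csSup (bddAbove_dualAct hc hx) ⟨q, q', h, rfl⟩

lemma kin_le_const (hc : 0 < c) {x : C(AddCircle T, E3)} (hx : SpeedLE c x) :
    kin c μ x ≤ c * μ * T := kin_le fun _ _ h => dualAct_le hc h hx

lemma kin_nonneg (hc : 0 < c) (hμ : 0 < μ) {x : C(AddCircle T, E3)} (hx : SpeedLE c x) :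
    0 ≤ kin c μ x := by
  have := le_kin (μ := μ) hc hx (isTest_zero T)
  simpa [dualAct, hμ] using this

end

lemma convex_speedLE {T c : ℝ} : Convex ℝ {x : C(AddCircle T, E3) | SpeedLE c x} := by
  intro x hx y hy a b ha hb hab s t
  have e : (a • x + b • y) (s : AddCircle T) - (a • x + b • y) (t : AddCircle T) =
      a • (x s - x t) + b • (y s - y t) := by
    simp only [ContinuousMap.add_apply, ContinuousMap.smul_apply]; module
  rw [e]
  refine (norm_add_le _ _).trans ?_
  rw [norm_smul, norm_smul, Real.norm_of_nonneg ha, Real.norm_of_nonneg hb]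
  have h1 := mul_le_mul_of_nonneg_left (hx s t) ha
  have h2 := mul_le_mul_of_nonneg_left (hy s t) hb
  have h3 : a * (c * |s - t|) + b * (c * |s - t|) = c * |s - t| := by rw [← add_mul, hab, one_mul]
  linarith

lemma isClosed_speedLE {T c : ℝ} : IsClosed {x : C(AddCircle T, E3) | SpeedLE c x} := by
  simp only [SpeedLE, Set.ofPred_forall]
  refine isClosed_iInter fun s => isClosed_iInter fun t => ?_
  exact isClosed_le ((continuous_eval_const _).sub (continuous_eval_const _)).norm continuous_const

lemma dualAct_combo {T : ℝ} (c μ : ℝ) {q q' : ℝ → E3} (h : IsTest T q q')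
    (x y : C(AddCircle T, E3)) {a b : ℝ} (hab : a + b = 1) :
    dualAct c μ q q' (a • x + b • y) = a * dualAct c μ q q' x + b * dualAct c μ q q' y := by
  have c1 : ∀ x : C(AddCircle T, E3), Continuous fun t : ℝ => (inner ℝ (q' t) (x t) : ℝ) :=
    fun x => h.cont.inner (continuous_loop x)
  have c2 : ∀ (a : ℝ) (x : C(AddCircle T, E3)),
    Continuous fun t : ℝ => a * (inner ℝ (q' t) (x t) : ℝ) := fun a x => continuous_const.mul (c1 x)
  simp only [dualAct_eq c μ h, ContinuousMap.add_apply, ContinuousMap.smul_apply, inner_add_right,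
    inner_smul_right]
  rw [intervalIntegral.integral_add ((c2 a x).intervalIntegrable _ _)
    ((c2 b y).intervalIntegrable _ _), intervalIntegral.integral_const_mul,
    intervalIntegral.integral_const_mul]
  linear_combination (∫ t in (0 : ℝ)..T, ham c μ (q t)) * hab

lemma exists_dualAct_lipschitz {T : ℝ} [hT : Fact (0 < T)] (c μ : ℝ) {q q' : ℝ → E3} (h : IsTest T q q') :
    ∃ M, 0 ≤ M ∧ ∀ x y : C(AddCircle T, E3),
      dualAct c μ q q' x - dualAct c μ q q' y ≤ M * ‖x - y‖ := by
  obtain ⟨M, hM0, hM⟩ := exists_norm_le_of_periodic hT.out h.cont h.per'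
  refine ⟨M * T, mul_nonneg hM0 hT.out.le, fun x y => ?_⟩
  have c1 : ∀ x : C(AddCircle T, E3), Continuous fun t : ℝ => (inner ℝ (q' t) (x t) : ℝ) :=
    fun x => h.cont.inner (continuous_loop x)
  have e : dualAct c μ q q' x - dualAct c μ q q' y =
      ∫ t in (0 : ℝ)..T, ((inner ℝ (q' t) (y t) : ℝ) - inner ℝ (q' t) (x t)) := by
    rw [dualAct_eq c μ h, dualAct_eq c μ h, intervalIntegral.integral_sub
      ((c1 y).intervalIntegrable _ _) ((c1 x).intervalIntegrable _ _)]
    ring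
  rw [e]
  have := intervalIntegral.norm_integral_le_of_norm_le_const (a := 0) (b := T)
    (f := fun t : ℝ => (inner ℝ (q' t) (y t) : ℝ) - inner ℝ (q' t) (x t)) (C := M * ‖x - y‖)
    fun t _ => by
      rw [← inner_sub_right]
      refine (norm_inner_le_norm _ _).trans ?_
      have h1 : ‖y (t : AddCircle T) - x t‖ ≤ ‖x - y‖ := by
        rw [norm_sub_rev]; exact ContinuousMap.norm_coe_le_norm (x - y) t
      exact mul_le_mul (hM t) h1 (norm_nonneg _) hM0
  rw [sub_zero, abs_of_pos hT.out] at this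
  exact (le_abs_self _).trans (this.trans (le_of_eq (by ring)))

lemma SpeedLE.add_const {T c : ℝ} {x : C(AddCircle T, E3)} (hx : SpeedLE c x) (a : E3) :
    SpeedLE c (x + ContinuousMap.const _ a) := fun s t => by
  simpa using hx s t

lemma periodic_primitive {T : ℝ} {f : ℝ → E3} (hf : Continuous f) (hp : Periodic f T)
    (h0 : ∫ t in (0 : ℝ)..T, f t = 0) (a : E3) :
    IsTest T (fun t => (∫ s in (0 : ℝ)..t, f s) + a) f where
  hasDerivAt t := (hf.integral_hasStrictDerivAt 0 t).hasDerivAt.add_const a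
  cont := hf
  per t := by
    have h1 := hp.intervalIntegral_add_eq t 0
    rw [zero_add, h0] at h1
    have := intervalIntegral.integral_add_adjacent_intervals (hf.intervalIntegrable 0 t)
      (hf.intervalIntegrable (μ := MeasureTheory.volume) t (t + T))
    simp only [← this, h1, add_zero]

section kin

variable {T c μ : ℝ} [hT : Fact (0 < T)]

lemma convexOn_kin (hc : 0 < c) : ConvexOn ℝ {x : C(AddCircle T, E3) | SpeedLE c x} (kin c μ) := by
  refine ⟨convex_speedLE, fun x hx y hy a b ha hb hab => kin_le fun q q' h => ?_⟩
  rw [dualAct_combo c μ h x y hab, smul_eq_mul, smul_eq_mul]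
  gcongr
  · exact le_kin hc hx h
  · exact le_kin hc hy h

lemma exists_kin_lower (hc : 0 < c) (x : C(AddCircle T, E3)) {e : ℝ} (he : 0 < e) :
    ∃ r > 0, ∀ y, SpeedLE c y → ‖y - x‖ < r → kin c μ x - e ≤ kin c μ y := by
  obtain ⟨q, q', h, hB⟩ := exists_lt_kin (c := c) (μ := μ) (B := kin c μ x - e / 2) (x := x) (by linarith)
  obtain ⟨M, hM0, hM⟩ := exists_dualAct_lipschitz c μ h
  refine ⟨e / 2 / (M + 1), by positivity, fun y hy hxy => ?_⟩
  have h1 := hM x y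
  have h2 := le_kin (μ := μ) hc hy h
  rw [lt_div_iff₀ (by positivity)] at hxy
  rw [norm_sub_rev] at h1
  nlinarith [norm_nonneg (y - x)]

lemma kin_add_const_le (hc : 0 < c) {x : C(AddCircle T, E3)} (hx : SpeedLE c x) (a : E3) :
    kin c μ (x + ContinuousMap.const _ a) ≤ kin c μ x := by
  refine kin_le fun q q' h => ?_
  have e : dualAct c μ q q' (x + ContinuousMap.const _ a) = dualAct c μ q q' x := by
    have c1 : Continuous fun t : ℝ => (inner ℝ (q' t) (x t) : ℝ) := h.cont.inner (continuous_loop x)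
    have c2 : Continuous fun t : ℝ => (inner ℝ (q' t) a : ℝ) := h.cont.inner continuous_const
    simp only [dualAct_eq c μ h, ContinuousMap.add_apply, ContinuousMap.const_apply, inner_add_right]
    rw [intervalIntegral.integral_add (c1.intervalIntegrable _ _) (c2.intervalIntegrable _ _),
      integral_inner_right h.cont, h.integral_deriv, inner_zero_left, add_zero]
  rw [e]; exact le_kin hc hx h

/-- A bounded-below convex integral of momenta attains its minimum on translates. -/
lemma exists_integral_velocity_eq_zero (hc : 0 < c) (hμ : 0 < μ) {F : ℝ → E3} (hF : Continuous F)
    (hFp : Periodic F T) : ∃ b, ∫ t in (0 : ℝ)..T, velocity c μ (F t + b) = 0 := by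
  have hT0 : 0 < T := hT.out
  obtain ⟨M, hM0, hM⟩ := exists_norm_le_of_periodic hT0 hF hFp
  set G : E3 → ℝ := fun b => ∫ t in (0 : ℝ)..T, ham c μ (F t + b) with hG
  have cH : ∀ b, Continuous fun t => ham c μ (F t + b) := fun b =>
    (continuous_ham c μ).comp (hF.add continuous_const)
  have hGc : Continuous G := intervalIntegral.continuous_parametric_intervalIntegral_of_continuous'
    (f := fun b t => ham c μ (F t + b)) ((continuous_ham c μ).comp ((hF.comp continuous_snd).add continuous_fst)) 0 T
  have hlow : ∀ b, T * (c * (‖b‖ - M) - c * μ) ≤ G b := by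
    intro b
    have h1 : ∫ _ in (0 : ℝ)..T, (c * (‖b‖ - M) - c * μ) ≤ G b :=
      intervalIntegral.integral_mono_on hT0.le (continuous_const.intervalIntegrable _ _)
        ((cH b).intervalIntegrable _ _) fun t _ => by
          refine le_trans ?_ (le_ham hc _)
          have : ‖b‖ - M ≤ ‖F t + b‖ := by
            have h2 := norm_sub_le (F t + b) (F t)
            rw [add_sub_cancel_left] at h2
            linarith [hM t]
          gcongr
    simpa only [intervalIntegral.integral_const, sub_zero, smul_eq_mul] using h1
  obtain ⟨b, hb⟩ := hGc.exists_forall_le' 0 (by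
    have h1 : Filter.Tendsto (fun b : E3 => T * (c * (‖b‖ - M) - c * μ)) (Filter.cocompact E3)
        Filter.atTop := by
      refine Filter.Tendsto.const_mul_atTop hT0 ?_
      refine Filter.tendsto_atTop_add_const_right _ _ ?_
      refine Filter.Tendsto.const_mul_atTop hc ?_
      exact Filter.tendsto_atTop_add_const_right _ _ (tendsto_norm_cocompact_atTop)
    exact (h1.eventually_ge_atTop (G 0)).mono fun b hb => hb.trans (hlow b))
  refine ⟨b, ?_⟩
  set w := ∫ t in (0 : ℝ)..T, velocity c μ (F t + b) with hw
  have hcv : Continuous fun t => velocity c μ (F t + b) :=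
    (continuous_velocity hμ).comp (hF.add continuous_const)
  have key : ∀ ε > (0 : ℝ), ‖w‖ ^ 2 ≤ ε * (T * (c / (2 * μ) * ‖w‖ ^ 2)) := by
    intro ε hε
    have h1 := hb (b + (-ε) • w)
    have c1 : Continuous fun t => (inner ℝ (velocity c μ (F t + b)) ((-ε) • w) : ℝ) :=
      hcv.inner continuous_const
    have c2 : Continuous fun t => ham c μ (F t + b) +
        (inner ℝ (velocity c μ (F t + b)) ((-ε) • w) : ℝ) := (cH b).add c1
    have h2 : G (b + (-ε) • w) ≤ ∫ t in (0 : ℝ)..T, (ham c μ (F t + b) +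
        (inner ℝ (velocity c μ (F t + b)) ((-ε) • w) : ℝ) + c / (2 * μ) * ‖(-ε) • w‖ ^ 2) :=
      intervalIntegral.integral_mono_on hT0.le ((cH _).intervalIntegrable _ _)
        ((c2.add continuous_const).intervalIntegrable _ _) fun t _ => by
          rw [← add_assoc]; exact ham_add_le hc hμ _ _
    rw [intervalIntegral.integral_add (c2.intervalIntegrable _ _)
      (continuous_const.intervalIntegrable _ _), intervalIntegral.integral_add
      ((cH b).intervalIntegrable _ _) (c1.intervalIntegrable _ _), integral_inner_right hcv, ← hw,
      inner_smul_right, real_inner_self_eq_norm_sq, intervalIntegral.integral_const, norm_smul,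
      smul_eq_mul, sub_zero, mul_pow, norm_neg, Real.norm_of_nonneg hε.le] at h2
    have h3 : ε * ‖w‖ ^ 2 ≤ ε * (ε * (T * (c / (2 * μ) * ‖w‖ ^ 2))) := by
      simp only [hG] at h1 h2
      linarith
    exact le_of_mul_le_mul_left h3 hε
  by_contra hne
  have hw0 : 0 < ‖w‖ ^ 2 := by have := norm_pos_iff.2 hne; positivity
  have hK : 0 < T * (c / (2 * μ) * ‖w‖ ^ 2) := by positivity
  have := key (‖w‖ ^ 2 / (2 * (T * (c / (2 * μ) * ‖w‖ ^ 2)))) (by positivity)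
  have e : ‖w‖ ^ 2 / (2 * (T * (c / (2 * μ) * ‖w‖ ^ 2))) * (T * (c / (2 * μ) * ‖w‖ ^ 2)) =
      ‖w‖ ^ 2 / 2 := by field_simp
  rw [e] at this
  linarith

end kin

lemma speedLE_of_hasDerivAt {T c : ℝ} {x : C(AddCircle T, E3)} {v : ℝ → E3}
    (hx : ∀ t : ℝ, HasDerivAt (fun t : ℝ => x t) (v t) t) (hv : ∀ t, ‖v t‖ ≤ c) :
    SpeedLE c x := fun s t => by
  have := convex_univ.norm_image_sub_le_of_norm_hasDerivWithin_le (f := fun t : ℝ => x t)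
    (fun t _ => (hx t).hasDerivWithinAt) (fun t _ => hv t) (Set.mem_univ t) (Set.mem_univ s)
  simpa using this

lemma IsTest.add_smul {T : ℝ} {q f η η' : ℝ → E3} (hq : IsTest T q f) (hη : IsTest T η η') (ε : ℝ) :
    IsTest T (fun t => q t + ε • η t) (fun t => f t + ε • η' t) where
  hasDerivAt t := (hq.hasDerivAt t).add ((hη.hasDerivAt t).const_smul ε)
  cont := hq.cont.add (hη.cont.const_smul ε)
  per t := by simp only [hq.per t, hη.per t]

section

variable {T c μ : ℝ} [hT : Fact (0 < T)]

lemma kin_le_of_hasDerivAt (hc : 0 < c) (hμ : 0 < μ) {x : C(AddCircle T, E3)} {q f : ℝ → E3}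
    (hq : IsTest T q f) (hx : ∀ t : ℝ, HasDerivAt (fun t : ℝ => x t) (velocity c μ (q t)) t) :
    kin c μ x ≤ dualAct c μ q f x := by
  have hvc : Continuous fun t => velocity c μ (q t) := (continuous_velocity hμ).comp hq.continuous
  have hxt : IsTest T (fun t : ℝ => x t) fun t => velocity c μ (q t) :=
    ⟨hx, hvc, periodic_loop x⟩
  have key : ∀ p p', IsTest T p p' → dualAct c μ p p' x =
      ∫ t in (0 : ℝ)..T, ((inner ℝ (p t) (velocity c μ (q t)) : ℝ) - ham c μ (p t)) := by
    intro p p' hp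
    have c1 : Continuous fun t => (inner ℝ (p t) (velocity c μ (q t)) : ℝ) :=
      hp.continuous.inner hvc
    have c2 : Continuous fun t => ham c μ (p t) := (continuous_ham c μ).comp hp.continuous
    rw [dualAct_eq c μ hp, hp.integral_by_parts hxt, neg_neg, intervalIntegral.integral_sub
      (c1.intervalIntegrable _ _) (c2.intervalIntegrable _ _)]
  refine kin_le fun p p' hp => ?_
  rw [key p p' hp, key q f hq]
  refine intervalIntegral.integral_mono_on hT.out.le
    (((hp.continuous.inner hvc).sub ((continuous_ham c μ).comp hp.continuous)).intervalIntegrable _ _)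
    (((hq.continuous.inner hvc).sub ((continuous_ham c μ).comp hq.continuous)).intervalIntegrable _ _)
    fun t _ => ?_
  have := le_ham_add hc hμ (q t) (p t)
  rw [inner_sub_right, real_inner_comm, real_inner_comm (q t)] at this
  linarith

lemma dualAct_add_smul_le (hc : 0 < c) (hμ : 0 < μ) {q f η η' : ℝ → E3}
    (hq : IsTest T q f) (hη : IsTest T η η') {x y : C(AddCircle T, E3)}
    (hy : ∀ t : ℝ, HasDerivAt (fun t : ℝ => y t) (velocity c μ (q t)) t) (ε : ℝ) :
    dualAct c μ q f x + ε * (∫ t in (0 : ℝ)..T, (inner ℝ (η' t) (y t - x t) : ℝ)) -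
      ε ^ 2 * (c / (2 * μ) * ∫ t in (0 : ℝ)..T, ‖η t‖ ^ 2) ≤
    dualAct c μ (fun t => q t + ε • η t) (fun t => f t + ε • η' t) x := by
  have hvc : Continuous fun t => velocity c μ (q t) := (continuous_velocity hμ).comp hq.continuous
  have hyt : IsTest T (fun t : ℝ => y t) fun t => velocity c μ (q t) :=
    ⟨hy, hvc, periodic_loop y⟩
  have hxc := continuous_loop x
  have hyc := continuous_loop y
  have cη := hη.continuous
  have cη' := hη.cont
  have cq := hq.continuous
  have cf := hq.cont
  have i1 : Continuous fun t : ℝ => (inner ℝ (η' t) (y t) : ℝ) := cη'.inner hyc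
  have i2 : Continuous fun t : ℝ => (inner ℝ (η' t) (x t) : ℝ) := cη'.inner hxc
  have i3 : Continuous fun t : ℝ => (inner ℝ (η t) (velocity c μ (q t)) : ℝ) := cη.inner hvc
  have i4 : Continuous fun t : ℝ => ‖η t‖ ^ 2 := cη.norm.pow 2
  have i5 : Continuous fun t : ℝ => -(inner ℝ (f t) (x t) : ℝ) - ham c μ (q t) :=
    (cf.inner hxc).neg.sub ((continuous_ham c μ).comp cq)
  have i0 : Continuous fun t => ham c μ (q t + ε • η t) :=
    (continuous_ham c μ).comp (hq.add_smul hη ε).continuous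
  have i6 : Continuous fun t : ℝ => -(inner ℝ (f t + ε • η' t) (x t) : ℝ) - ham c μ (q t + ε • η t) :=
    ((hq.add_smul hη ε).cont.inner hxc).neg.sub i0
  have h1 : ∫ t in (0 : ℝ)..T, (inner ℝ (η' t) (y t - x t) : ℝ) =
      -(∫ t in (0 : ℝ)..T, (inner ℝ (η t) (velocity c μ (q t)) : ℝ)) -
      ∫ t in (0 : ℝ)..T, (inner ℝ (η' t) (x t) : ℝ) := by
    simp_rw [inner_sub_right]
    rw [intervalIntegral.integral_sub (i1.intervalIntegrable _ _) (i2.intervalIntegrable _ _),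
      hη.integral_by_parts hyt]
  have i2' : Continuous fun t : ℝ => (-ε) * (inner ℝ (η' t) (x t) : ℝ) := continuous_const.mul i2
  have i3' : Continuous fun t : ℝ => (-ε) * (inner ℝ (η t) (velocity c μ (q t)) : ℝ) :=
    continuous_const.mul i3
  have i7 : Continuous fun t : ℝ => (-(inner ℝ (f t) (x t) : ℝ) - ham c μ (q t)) +
      (-ε) * (inner ℝ (η t) (velocity c μ (q t)) : ℝ) := i5.add i3'
  have i8 : Continuous fun t : ℝ => (-(inner ℝ (f t) (x t) : ℝ) - ham c μ (q t)) +
      (-ε) * (inner ℝ (η t) (velocity c μ (q t)) : ℝ) + (-ε) * (inner ℝ (η' t) (x t) : ℝ) :=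
    i7.add i2'
  have i9 : Continuous fun t : ℝ => -(ε ^ 2 * (c / (2 * μ))) * ‖η t‖ ^ 2 := continuous_const.mul i4
  have h2 : ∫ t in (0 : ℝ)..T, ((-(inner ℝ (f t) (x t) : ℝ) - ham c μ (q t)) +
      (-ε) * (inner ℝ (η t) (velocity c μ (q t)) : ℝ) + (-ε) * (inner ℝ (η' t) (x t) : ℝ) +
      -(ε ^ 2 * (c / (2 * μ))) * ‖η t‖ ^ 2) ≤
      dualAct c μ (fun t => q t + ε • η t) (fun t => f t + ε • η' t) x := by
    refine intervalIntegral.integral_mono_on hT.out.le ((i8.add i9).intervalIntegrable _ _)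
      (i6.intervalIntegrable _ _) fun t _ => ?_
    have h3 := ham_add_le hc hμ (q t) (ε • η t)
    rw [inner_smul_right, norm_smul, mul_pow, Real.norm_eq_abs, sq_abs, real_inner_comm] at h3
    rw [inner_add_left, real_inner_smul_left]
    linarith
  rw [intervalIntegral.integral_add (i8.intervalIntegrable _ _) (i9.intervalIntegrable _ _),
    intervalIntegral.integral_add (i7.intervalIntegrable _ _)
      (i2'.intervalIntegrable _ _),
    intervalIntegral.integral_add (i5.intervalIntegrable _ _)
      (i3'.intervalIntegrable _ _),
    intervalIntegral.integral_const_mul, intervalIntegral.integral_const_mul,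
    intervalIntegral.integral_const_mul] at h2
  rw [h1]
  unfold dualAct at h2 ⊢
  linarith

/-- A loop whose action cannot decrease to first order in any admissible direction solves the
equation of motion with force `f`. -/
lemma exists_momentum (hc : 0 < c) (hμ : 0 < μ) {x : C(AddCircle T, E3)} (hx : SpeedLE c x)
    {f : ℝ → E3} (hf : Continuous f) (hfp : Periodic f T)
    (hcrit : ∀ y : C(AddCircle T, E3), SpeedLE c y →
      0 ≤ kin c μ y - kin c μ x + ∫ t in (0 : ℝ)..T, (inner ℝ (f t) (y t - x t) : ℝ)) :
    ∃ q : ℝ → E3, (∀ t, HasDerivAt q (f t) t) ∧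
      ∀ t : ℝ, HasDerivAt (fun t : ℝ => x t) (velocity c μ (q t)) t := by
  have hf0 : ∫ t in (0 : ℝ)..T, f t = 0 := by
    set w := ∫ t in (0 : ℝ)..T, f t with hw
    have h1 := hcrit _ (hx.add_const (-w))
    have h2 := kin_add_const_le (μ := μ) hc hx (-w)
    simp only [ContinuousMap.add_apply, ContinuousMap.const_apply, add_sub_cancel_left] at h1
    rw [integral_inner_right hf, ← hw, inner_neg_right, real_inner_self_eq_norm_sq] at h1
    have h3 : ‖w‖ ^ 2 ≤ 0 := by linarith
    simpa using le_antisymm h3 (sq_nonneg _)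
  have hF := periodic_primitive hf hfp hf0 0
  obtain ⟨b, hb⟩ := exists_integral_velocity_eq_zero (μ := μ) hc hμ hF.continuous hF.per
  simp only [add_zero] at hb
  have hq := periodic_primitive hf hfp hf0 b
  set q : ℝ → E3 := fun t => (∫ s in (0 : ℝ)..t, f s) + b with hqdef
  refine ⟨q, hq.hasDerivAt, ?_⟩
  have hvc : Continuous fun t => velocity c μ (q t) := (continuous_velocity hμ).comp hq.continuous
  have hvp : Periodic (fun t => velocity c μ (q t)) T := fun t => by simp only [hq.per t]
  have hY := periodic_primitive hvc hvp hb 0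
  set y := loopOf _ hY.continuous hY.per with hy
  have hyd : ∀ t : ℝ, HasDerivAt (fun t : ℝ => y t) (velocity c μ (q t)) t := by
    simpa [hy] using hY.hasDerivAt
  have hys : SpeedLE c y := speedLE_of_hasDerivAt hyd fun t => (norm_velocity_lt hc hμ _).le
  have hxc := continuous_loop x
  have hyc := continuous_loop y
  have hky := kin_le_of_hasDerivAt hc hμ hq hyd
  have hkx : kin c μ x ≤ dualAct c μ q f x := by
    have h1 := hcrit y hys
    simp_rw [inner_sub_right] at h1
    rw [intervalIntegral.integral_sub ((hf.inner hyc).intervalIntegrable _ _)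
      ((hf.inner hxc).intervalIntegrable _ _)] at h1
    rw [dualAct_eq c μ hq] at hky ⊢
    linarith
  have hvar : ∀ η η', IsTest T η η' →
      ∫ t in (0 : ℝ)..T, (inner ℝ (η' t) (y t - x t) : ℝ) ≤ 0 := by
    intro η η' hη
    by_contra! hpos
    set A := ∫ t in (0 : ℝ)..T, (inner ℝ (η' t) (y t - x t) : ℝ)
    set B := c / (2 * μ) * ∫ t in (0 : ℝ)..T, ‖η t‖ ^ 2 with hB
    have hB0 : 0 ≤ B := mul_nonneg (by positivity)
      (intervalIntegral.integral_nonneg hT.out.le fun t _ => by positivity)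
    have h1 := dualAct_add_smul_le hc hμ hq hη (x := x) hyd (A / (B + 1))
    have h2 := le_kin (μ := μ) hc hx (hq.add_smul hη (A / (B + 1)))
    have h3 : A / (B + 1) * A ≤ (A / (B + 1)) ^ 2 * B := by linarith
    have h4 : 0 < A / (B + 1) := by positivity
    have h5 : A ≤ A / (B + 1) * B := by nlinarith
    rw [div_mul_eq_mul_div, le_div_iff₀ (by positivity)] at h5
    nlinarith
  set w : ℝ → E3 := fun t => y (t : AddCircle T) - x t with hw
  have hwc : Continuous w := hyc.sub hxc
  have hwp : Periodic w T := fun t => by simp [hw]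
  set a : E3 := T⁻¹ • ∫ t in (0 : ℝ)..T, w t with ha
  have hT0 := hT.out
  have hwa : ∫ t in (0 : ℝ)..T, (w t - a) = 0 := by
    rw [intervalIntegral.integral_sub (hwc.intervalIntegrable _ _)
      (continuous_const.intervalIntegrable _ _), intervalIntegral.integral_const, sub_zero, ha,
      smul_smul, mul_inv_cancel₀ hT0.ne', one_smul, sub_self]
  have hwac : Continuous fun t => w t - a := hwc.sub continuous_const
  have hη := periodic_primitive hwac
    (fun t => by simp only [hwp t]) hwa 0
  have h1 := hvar _ _ hη
  have h2 : ∫ t in (0 : ℝ)..T, ‖w t - a‖ ^ 2 = ∫ t in (0 : ℝ)..T, (inner ℝ (w t - a) (w t) : ℝ) := by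
    have c1 : Continuous fun t => (inner ℝ (w t - a) (w t) : ℝ) :=
      hwac.inner hwc
    have c2 : Continuous fun t => (inner ℝ (w t - a) a : ℝ) :=
      hwac.inner continuous_const
    have e : ∀ t, ‖w t - a‖ ^ 2 = (inner ℝ (w t - a) (w t) : ℝ) - inner ℝ (w t - a) a := fun t => by
      rw [← inner_sub_right, real_inner_self_eq_norm_sq]
    simp_rw [e]
    rw [intervalIntegral.integral_sub (c1.intervalIntegrable _ _) (c2.intervalIntegrable _ _),
      integral_inner_right hwac, hwa, inner_zero_left, sub_zero]
  have hcn : Continuous fun t => ‖w t - a‖ ^ 2 := hwac.norm.pow 2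
  have h3 : ∀ t ∈ Set.Icc 0 T, w t = a := by
    intro t ht
    by_contra hne
    have : 0 < ∫ t in (0 : ℝ)..T, ‖w t - a‖ ^ 2 :=
      intervalIntegral.integral_pos hT0 hcn.continuousOn (fun t _ => by positivity)
        ⟨t, ht, by have := norm_pos_iff.2 (sub_ne_zero.2 hne); positivity⟩
    rw [h2] at this
    exact absurd h1 (not_le.2 this)
  have h4 : ∀ t, w t = a := fun t => by
    obtain ⟨s, hs, hst⟩ := hwp.exists_mem_Ico₀ hT0 t
    rw [hst, h3 s ⟨hs.1, hs.2.le⟩]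
  have h5 : (fun t : ℝ => x (t : AddCircle T)) = fun t : ℝ => y t - a := by
    funext t
    rw [← h4 t, hw, sub_sub_cancel]
  intro t
  rw [h5]
  exact (hyd t).sub_const a

end

/-- `V` is a periodic potential with force field `F` and a Newtonian singularity of strength `α`. -/
structure IsPotential (T α S : ℝ) (V : ℝ → E3 → ℝ) (F : ℝ → E3 → E3) : Prop where
  cont : ContinuousOn (fun p : ℝ × E3 => V p.1 p.2) {p | p.2 ≠ 0}
  cont_force : ContinuousOn (fun p : ℝ × E3 => F p.1 p.2) {p | p.2 ≠ 0}
  per : Periodic V T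
  per_force : Periodic F T
  hasGradientAt : ∀ t p, p ≠ 0 → HasGradientAt (V t) (F t p) p
  lower : ∀ t p, α / ‖p‖ ≤ V t p
  upper : ∀ t p, V t p ≤ α / ‖p‖ + S

/-- The action functional. -/
def action {T : ℝ} (c μ : ℝ) (V : ℝ → E3 → ℝ) (x : C(AddCircle T, E3)) : ℝ :=
  kin c μ x + ∫ t in (0 : ℝ)..T, V t (x t)

lemma ne_zero_of_le_norm {δ : ℝ} (hδ : 0 < δ) {p : E3} (h : δ ≤ ‖p‖) : p ≠ 0 :=
  norm_pos_iff.1 (hδ.trans_le h)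

section potential

variable {T α S c μ : ℝ} {V : ℝ → E3 → ℝ} {F : ℝ → E3 → E3}

lemma IsPotential.continuous_comp (h : IsPotential T α S V F) {x : ℝ → E3} (hx : Continuous x)
    (h0 : ∀ t, x t ≠ 0) : Continuous fun t => V t (x t) :=
  h.cont.comp_continuous (continuous_id.prodMk hx) h0

lemma IsPotential.continuous_force_comp (h : IsPotential T α S V F) {x : ℝ → E3}
    (hx : Continuous x) (h0 : ∀ t, x t ≠ 0) : Continuous fun t => F t (x t) :=
  h.cont_force.comp_continuous (continuous_id.prodMk hx) h0

lemma IsPotential.exists_force_close (h : IsPotential T α S V F) (hT : 0 < T) {δ e : ℝ} (R : ℝ)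
    (hδ : 0 < δ) (he : 0 < e) : ∃ ρ > 0, ρ ≤ δ / 2 ∧ ∀ t p p', δ ≤ ‖p‖ → ‖p‖ ≤ R →
      ‖p' - p‖ ≤ ρ → ‖F t p' - F t p‖ ≤ e := by
  set K : Set (ℝ × E3) := Set.Icc 0 T ×ˢ (Metric.closedBall 0 (R + δ) ∩ {p | δ / 2 ≤ ‖p‖}) with hK
  have hKc : IsCompact K := isCompact_Icc.prod
    ((isCompact_closedBall _ _).inter_right (isClosed_le continuous_const continuous_norm))
  have hu := hKc.uniformContinuousOn_of_continuous
    (h.cont_force.mono fun p hp => ne_zero_of_le_norm (half_pos hδ) hp.2.2)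
  obtain ⟨ρ, hρ, H⟩ := Metric.uniformContinuousOn_iff.1 hu e he
  refine ⟨min (ρ / 2) (δ / 2), by positivity, min_le_right _ _, fun t p p' hp hpR hpp => ?_⟩
  obtain ⟨s, hs, hst⟩ := h.per_force.exists_mem_Ico₀ hT t
  rw [hst]
  have h1 := hpp.trans (min_le_left _ _)
  have h2 := hpp.trans (min_le_right _ _)
  have h3 := norm_sub_norm_le p p'
  have h4 := norm_sub_norm_le p' p
  rw [norm_sub_rev] at h3
  have := H (s, p') ⟨⟨hs.1, hs.2.le⟩, by simpa using by linarith, by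
    change _ ≤ ‖p'‖; linarith⟩ (s, p) ⟨⟨hs.1, hs.2.le⟩, by simpa using by linarith, by
    change _ ≤ ‖p‖; linarith⟩ (by
      rw [dist_prod_same_left, dist_eq_norm]; linarith)
  rw [dist_eq_norm] at this
  exact this.le

lemma IsPotential.exists_taylor (h : IsPotential T α S V F) (hT : 0 < T) {δ e : ℝ} (R : ℝ)
    (hδ : 0 < δ) (he : 0 < e) : ∃ ρ > 0, ρ ≤ δ / 2 ∧ ∀ t p p', δ ≤ ‖p‖ → ‖p‖ ≤ R →
      ‖p' - p‖ ≤ ρ → ‖F t p' - F t p‖ ≤ e ∧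
        |V t p' - V t p - inner ℝ (F t p) (p' - p)| ≤ e * ‖p' - p‖ := by
  obtain ⟨ρ, hρ, hρδ, H⟩ := h.exists_force_close hT R hδ he
  refine ⟨ρ, hρ, hρδ, fun t p p' hp hpR hpp => ⟨H t p p' hp hpR hpp, ?_⟩⟩
  have := (convex_closedBall p ρ).norm_image_sub_le_of_norm_hasFDerivWithin_le'
    (f := V t) (f' := fun z => (InnerProductSpace.toDual ℝ E3) (F t z))
    (φ := (InnerProductSpace.toDual ℝ E3) (F t p)) (C := e) (x := p) (y := p')
    (fun z hz => by
      refine (hasGradientAt_iff_hasFDerivAt.1 (h.hasGradientAt t z ?_)).hasFDerivWithinAt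
      rw [mem_closedBall_iff_norm] at hz
      refine ne_zero_of_le_norm (half_pos hδ) ?_
      have h3 := norm_sub_norm_le p z
      rw [norm_sub_rev] at h3
      linarith)
    (fun z hz => by
      rw [← map_sub, LinearIsometryEquiv.norm_map]
      exact H t p z hp hpR (mem_closedBall_iff_norm.1 hz))
    (Metric.mem_closedBall_self hρ.le) (mem_closedBall_iff_norm.2 hpp)
  simpa using this

lemma IsPotential.log_le_integral (h : IsPotential T α S V F) (hT : 0 < T) (hc : 0 < c)
    (hα : 0 < α) {x : C(AddCircle T, E3)} (hx : SpeedLE c x) (h0 : ∀ t : ℝ, x t ≠ 0) (t₀ : ℝ) :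
    α / c * Real.log ((‖x t₀‖ + c * T) / ‖x t₀‖) ≤ ∫ t in (0 : ℝ)..T, V t (x t) := by
  set d := ‖x (t₀ : AddCircle T)‖ with hd
  have hd0 : 0 < d := norm_pos_iff.2 (h0 t₀)
  have hp : Periodic (fun t : ℝ => V t (x t)) T := fun t => by simp [h.per t]
  have hcV := h.continuous_comp (continuous_loop x) h0
  have e1 := hp.intervalIntegral_add_eq t₀ 0
  rw [zero_add] at e1
  rw [← e1]
  have hpos : ∀ t ∈ Set.uIcc t₀ (t₀ + T), 0 < d + c * (t - t₀) := fun t ht => by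
    rw [Set.uIcc_of_le (by linarith)] at ht
    have := mul_nonneg hc.le (sub_nonneg.2 ht.1)
    linarith
  have hcont : ContinuousOn (fun t => α / (d + c * (t - t₀))) (Set.uIcc t₀ (t₀ + T)) :=
    continuousOn_const.div (by fun_prop) fun t ht => (hpos t ht).ne'
  have hint : ∫ t in t₀..(t₀ + T), α / (d + c * (t - t₀)) = α / c * Real.log ((d + c * T) / d) := by
    rw [intervalIntegral.integral_eq_sub_of_hasDerivAt
      (f := fun t => α / c * Real.log (d + c * (t - t₀))) (fun t ht => ?_) hcont.intervalIntegrable]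
    · rw [Real.log_div (by positivity) hd0.ne']
      simp only [add_sub_cancel_left, sub_self, mul_zero, add_zero]
      ring
    · have h1 : HasDerivAt (fun t => d + c * (t - t₀)) c t := by
        simpa using (((hasDerivAt_id t).sub_const t₀).const_mul c).const_add d
      refine ((h1.log (hpos t ht).ne').const_mul (α / c)).congr_deriv ?_
      have := hpos t ht
      field_simp
  rw [← hint]
  refine intervalIntegral.integral_mono_on (by linarith) hcont.intervalIntegrable
    (hcV.intervalIntegrable _ _) fun t ht => (le_trans ?_ (h.lower t _))
  have h1 := hx t t₀
  rw [abs_of_nonneg (sub_nonneg.2 ht.1)] at h1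
  have h2 := norm_sub_norm_le (x (t : AddCircle T)) (x t₀)
  have h3 : 0 < ‖x (t : AddCircle T)‖ := norm_pos_iff.2 (h0 t)
  gcongr
  linarith

variable [hT : Fact (0 < T)]

/-- First-order expansion of the potential part of the action, uniform away from collisions. -/
lemma IsPotential.exists_integral_taylor (h : IsPotential T α S V F) {δ e : ℝ} (R : ℝ)
    (hδ : 0 < δ) (he : 0 < e) : ∃ ρ > 0, ρ ≤ δ / 2 ∧ ∀ x y : C(AddCircle T, E3),
      (∀ t : ℝ, δ ≤ ‖x t‖) → ‖x‖ ≤ R → ‖y - x‖ ≤ ρ →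
      |(∫ t in (0 : ℝ)..T, V t (y t)) - (∫ t in (0 : ℝ)..T, V t (x t)) -
        ∫ t in (0 : ℝ)..T, (inner ℝ (F t (x t)) (y t - x t) : ℝ)| ≤ e * ‖y - x‖ ∧
      ∀ z : C(AddCircle T, E3), |(∫ t in (0 : ℝ)..T, (inner ℝ (F t (y t)) (z t) : ℝ)) -
        ∫ t in (0 : ℝ)..T, (inner ℝ (F t (x t)) (z t) : ℝ)| ≤ e * ‖z‖ := by
  have hT := hT.out
  obtain ⟨ρ, hρ, hρδ, H⟩ := h.exists_taylor hT R hδ (div_pos he hT)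
  refine ⟨ρ, hρ, hρδ, fun x y hx hxR hxy => ?_⟩
  have hxc := continuous_loop x
  have hyc := continuous_loop y
  have hn : ∀ t : ℝ, ‖y (t : AddCircle T) - x t‖ ≤ ‖y - x‖ := fun t =>
    ContinuousMap.norm_coe_le_norm (y - x) _
  have hT' := fun t : ℝ => H t (x t) (y t) (hx t) ((x.norm_coe_le_norm _).trans hxR)
    ((hn t).trans hxy)
  have hx0 : ∀ t : ℝ, x t ≠ 0 := fun t => ne_zero_of_le_norm hδ (hx t)
  have hy0 : ∀ t : ℝ, y t ≠ 0 := fun t => by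
    refine ne_zero_of_le_norm (half_pos hδ) ?_
    have h1 := norm_sub_norm_le (x (t : AddCircle T)) (y t)
    rw [norm_sub_rev] at h1
    linarith [hn t, hx t]
  have cx := h.continuous_comp hxc hx0
  have cy := h.continuous_comp hyc hy0
  have cFx := h.continuous_force_comp hxc hx0
  have cFy := h.continuous_force_comp hyc hy0
  constructor
  · have ci : Continuous fun t : ℝ => (inner ℝ (F t (x t)) (y t - x t) : ℝ) :=
      cFx.inner (hyc.sub hxc)
    have cxy : Continuous fun t : ℝ => V t (y t) - V t (x t) := cy.sub cx
    rw [← intervalIntegral.integral_sub (cy.intervalIntegrable _ _) (cx.intervalIntegrable _ _),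
      ← intervalIntegral.integral_sub (cxy.intervalIntegrable _ _)
      (ci.intervalIntegrable _ _)]
    rw [← Real.norm_eq_abs]
    refine (intervalIntegral.norm_integral_le_of_norm_le_const
      (C := e / T * ‖y - x‖) fun t _ => (hT' t).2.trans ?_).trans (le_of_eq ?_)
    · have := hn t
      gcongr
    · rw [sub_zero, abs_of_pos hT]; field_simp
  · intro z
    have hzc := continuous_loop z
    have c1 : Continuous fun t : ℝ => (inner ℝ (F t (y t)) (z t) : ℝ) := cFy.inner hzc
    have c2 : Continuous fun t : ℝ => (inner ℝ (F t (x t)) (z t) : ℝ) := cFx.inner hzc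
    rw [← intervalIntegral.integral_sub (c1.intervalIntegrable _ _) (c2.intervalIntegrable _ _)]
    rw [← Real.norm_eq_abs]
    refine (intervalIntegral.norm_integral_le_of_norm_le_const
      (C := e / T * ‖z‖) fun t _ => ?_).trans (le_of_eq ?_)
    · rw [← inner_sub_left]
      refine (norm_inner_le_norm _ _).trans ?_
      have := z.norm_coe_le_norm (t : AddCircle T)
      have := (hT' t).1
      gcongr
    · rw [sub_zero, abs_of_pos hT]; field_simp

/-- Bounded action keeps loops away from collisions. -/
lemma IsPotential.exists_le_norm (h : IsPotential T α S V F) (hc : 0 < c) (hμ : 0 < μ)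
    (hα : 0 < α) (C : ℝ) : ∃ δ > 0, ∀ x : C(AddCircle T, E3), SpeedLE c x → (∀ t : ℝ, x t ≠ 0) →
      action c μ V x ≤ C → ∀ t : ℝ, δ ≤ ‖x t‖ := by
  have hT0 := hT.out
  refine ⟨c * T * Real.exp (-(c * C / α)), by positivity, fun x hx h0 hC t => ?_⟩
  by_contra! hlt
  have h1 := h.log_le_integral hT0 hc hα hx h0 t
  have h2 := kin_nonneg (μ := μ) hc hμ hx
  unfold action at hC
  have hd := norm_pos_iff.2 (h0 t)
  set d := ‖x (t : AddCircle T)‖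
  have h3 : Real.exp (c * C / α) < (d + c * T) / d := by
    rw [lt_div_iff₀ hd]
    rw [Real.exp_neg, ← div_eq_mul_inv, lt_div_iff₀ (Real.exp_pos _)] at hlt
    linarith
  have h4 : c * C / α < Real.log ((d + c * T) / d) := by
    rwa [Real.lt_log_iff_exp_lt (by positivity)]
  have h5 : α / c * (c * C / α) < α / c * Real.log ((d + c * T) / d) := by gcongr
  have h6 : α / c * (c * C / α) = C := by field_simp
  linarith

lemma norm_le_of_norm_lt_one (hc : 0 < c) {x : C(AddCircle T, E3)} (hx : SpeedLE c x) {t : ℝ}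
    (ht : ‖x t‖ < 1) : ‖x‖ ≤ 1 + c * T := by
  have hT0 := hT.out
  refine (ContinuousMap.norm_le _ (by positivity)).2 fun s => ?_
  obtain ⟨s', hs', hst⟩ := AddCircle.eq_coe_Ico (s - (t : AddCircle T))
  obtain rfl : ((s' + t : ℝ) : AddCircle T) = s := by rw [AddCircle.coe_add, hst, sub_add_cancel]
  have h1 := hx (s' + t) t
  rw [add_sub_cancel_right, abs_of_nonneg hs'.1] at h1
  have h2 := norm_sub_norm_le (x ((s' + t : ℝ) : AddCircle T)) (x t)
  have h3 := mul_le_mul_of_nonneg_left hs'.2.le hc.le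
  linarith

/-- Loops of large action stay in a fixed ball. -/
lemma IsPotential.norm_le_of_le_action (h : IsPotential T α S V F) (hc : 0 < c) (hα : 0 < α)
    {x : C(AddCircle T, E3)} (hx : SpeedLE c x) (h0 : ∀ t : ℝ, x t ≠ 0)
    (hC : c * μ * T + T * (α + S) + 1 ≤ action c μ V x) : ‖x‖ ≤ 1 + c * T := by
  have hT0 := hT.out
  suffices ∃ t : ℝ, ‖x t‖ < 1 by
    obtain ⟨t, ht⟩ := this
    exact norm_le_of_norm_lt_one hc hx ht
  by_contra! hge
  have h1 := kin_le_const (μ := μ) hc hx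
  have h2 : ∫ t in (0 : ℝ)..T, V t (x t) ≤ ∫ _ in (0 : ℝ)..T, (α + S) :=
    intervalIntegral.integral_mono_on hT0.le
      ((h.continuous_comp (continuous_loop x) h0).intervalIntegrable _ _)
      (continuous_const.intervalIntegrable _ _) fun t _ => (h.upper t _).trans (by
        have := div_le_self hα.le (hge t)
        linarith)
  rw [intervalIntegral.integral_const, smul_eq_mul, sub_zero] at h2
  unfold action at hC
  linarith

end potential

section

variable {T α S c μ : ℝ} {V : ℝ → E3 → ℝ} {F : ℝ → E3 → E3}

/-- The work of the force field along `x` in the direction `z`. -/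
def work (F : ℝ → E3 → E3) (x z : C(AddCircle T, E3)) : ℝ :=
  ∫ t in (0 : ℝ)..T, (inner ℝ (F t (x t)) (z t) : ℝ)

lemma IsPotential.work_combo (h : IsPotential T α S V F) {x : C(AddCircle T, E3)}
    (h0 : ∀ t : ℝ, x t ≠ 0) (y z : C(AddCircle T, E3)) (a b : ℝ) :
    work F x (a • y + b • z) = a * work F x y + b * work F x z := by
  have cF := h.continuous_force_comp (continuous_loop x) h0
  have c1 : ∀ (a : ℝ) (y : C(AddCircle T, E3)),
    Continuous fun t : ℝ => a * (inner ℝ (F t (x t)) (y t) : ℝ) := fun a y =>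
      continuous_const.mul (cF.inner (continuous_loop y))
  simp only [work, ContinuousMap.add_apply, ContinuousMap.smul_apply, inner_add_right,
    inner_smul_right]
  rw [intervalIntegral.integral_add ((c1 a y).intervalIntegrable _ _)
    ((c1 b z).intervalIntegrable _ _), intervalIntegral.integral_const_mul,
    intervalIntegral.integral_const_mul]

/-- The one-sided first-order variation of the action. -/
def variation (c μ : ℝ) (F : ℝ → E3 → E3) (x y : C(AddCircle T, E3)) : ℝ :=
  kin c μ y - kin c μ x + work F x (y - x)

lemma variation_self (x : C(AddCircle T, E3)) :
    variation c μ F x x = 0 := by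
  simp [variation, work]

variable [hT : Fact (0 < T)]

/-- Admissible loops in a ball that stay away from the origin. -/
def farLoops (T c R δ : ℝ) [Fact (0 < T)] : Set C(AddCircle T, E3) :=
  {x | SpeedLE c x ∧ ‖x‖ ≤ R ∧ ∀ t : ℝ, δ ≤ ‖x t‖}

lemma isCompact_farLoops (hc : 0 < c) (R δ : ℝ) : IsCompact (farLoops T c R δ) := by
  have hcl : IsClosed (farLoops T c R δ) := by
    refine isClosed_speedLE.inter ((isClosed_le continuous_norm continuous_const).inter ?_)
    change IsClosed {x : C(AddCircle T, E3) | ∀ t : ℝ, δ ≤ ‖x t‖}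
    simp only [Set.ofPred_forall]
    exact isClosed_iInter fun t => isClosed_le continuous_const (continuous_eval_const _).norm
  set e := (ContinuousMap.isometryEquivBoundedOfCompact (AddCircle T) E3).toHomeomorph with he
  rw [← e.isCompact_image]
  refine BoundedContinuousFunction.arzela_ascoli₂ (Metric.closedBall 0 R)
    (isCompact_closedBall _ _) _ (e.isClosed_image.2 hcl) ?_ ?_
  · rintro _ t ⟨x, hx, rfl⟩
    rw [mem_closedBall_zero_iff]
    exact (x.norm_coe_le_norm t).trans hx.2.1
  · have h1 : Equicontinuous fun (f : e '' farLoops T c R δ) (t : ℝ) => f.1 (t : AddCircle T) := by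
      refine (LipschitzWith.uniformEquicontinuous _ ⟨c, hc.le⟩ ?_).equicontinuous
      rintro ⟨_, x, hx, rfl⟩
      refine LipschitzWith.of_dist_le_mul fun s t => ?_
      rw [dist_eq_norm, Real.dist_eq]
      exact hx.1 s t
    exact equicontinuous_iff_continuous.2
      (continuous_coinduced_dom.2 (equicontinuous_iff_continuous.1 h1))

lemma convex_ball_speedLE (R : ℝ) :
    Convex ℝ {x : C(AddCircle T, E3) | SpeedLE c x ∧ ‖x‖ ≤ R} := by
  have := (convex_speedLE (T := T) (c := c)).inter (convex_closedBall (0 : C(AddCircle T, E3)) R)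
  convert this using 1
  ext x
  simp

lemma IsPotential.exists_work_le (h : IsPotential T α S V F) {x : C(AddCircle T, E3)}
    (h0 : ∀ t : ℝ, x t ≠ 0) : ∃ M, 0 ≤ M ∧ ∀ z, |work F x z| ≤ M * ‖z‖ := by
  have cF := h.continuous_force_comp (continuous_loop x) h0
  obtain ⟨M, hM0, hM⟩ := exists_norm_le_of_periodic hT.out cF fun t => by simp [h.per_force t]
  refine ⟨M * T, mul_nonneg hM0 hT.out.le, fun z => ?_⟩
  have := intervalIntegral.norm_integral_le_of_norm_le_const (a := 0) (b := T)
    (f := fun t : ℝ => (inner ℝ (F t (x t)) (z t) : ℝ)) (C := M * ‖z‖) fun t _ =>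
      (norm_inner_le_norm _ _).trans (mul_le_mul (hM t) (z.norm_coe_le_norm _) (norm_nonneg _) hM0)
  rw [sub_zero, abs_of_pos hT.out] at this
  exact this.trans (le_of_eq (by ring))

lemma IsPotential.variation_combo_le (h : IsPotential T α S V F) (hc : 0 < c)
    {x y z : C(AddCircle T, E3)} (h0 : ∀ t : ℝ, x t ≠ 0) (hy : SpeedLE c y) (hz : SpeedLE c z)
    {a b : ℝ} (ha : 0 ≤ a) (hb : 0 ≤ b) (hab : a + b = 1) :
    variation c μ F x (a • y + b • z) ≤ a * variation c μ F x y + b * variation c μ F x z := by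
  have h1 := (convexOn_kin (μ := μ) hc).2 hy hz ha hb hab
  have h2 : a • y + b • z - x = a • (y - x) + b • (z - x) := by
    obtain rfl : b = 1 - a := by linarith
    module
  unfold variation
  rw [h2, h.work_combo h0]
  simp only [smul_eq_mul] at h1
  obtain rfl : b = 1 - a := by linarith
  linarith

/-- Local descent directions can be chosen constant near a given loop. -/
lemma IsPotential.exists_local_descent (h : IsPotential T α S V F) (hc : 0 < c) (hα : 0 < α)
    {C R δ : ℝ} (hδ : 0 < δ) (hC : c * μ * T + T * (α + S) + 1 ≤ C) (hR : 2 + c * T ≤ R)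
    (hcrit : ∀ x : C(AddCircle T, E3), SpeedLE c x → (∀ t : ℝ, x t ≠ 0) → C ≤ action c μ V x →
      ∃ y, SpeedLE c y ∧ variation c μ F x y < 0)
    {x₀ : C(AddCircle T, E3)} (hx₀ : x₀ ∈ farLoops T c R δ) :
    ∃ y, (SpeedLE c y ∧ ‖y‖ ≤ R) ∧ ∃ σ > 0, ∃ r > 0, ∀ x ∈ farLoops T c R δ, ‖x - x₀‖ < r →
      variation c μ F x y ≤ max (-σ) (C - 2 * σ - action c μ V x) := by
  have hx0 : ∀ t : ℝ, x₀ t ≠ 0 := fun t => ne_zero_of_le_norm hδ (hx₀.2.2 t)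
  obtain ⟨M, hM0, hM⟩ := h.exists_work_le hx0
  by_cases hlt : action c μ V x₀ < C
  · obtain ⟨ρ, hρ, -, H⟩ := h.exists_integral_taylor R hδ one_pos
    set σ := (C - action c μ V x₀) / 3 with hσ
    have hσ0 : 0 < σ := by rw [hσ]; linarith
    refine ⟨x₀, ⟨hx₀.1, hx₀.2.1⟩, σ, hσ0, min ρ (σ / 2), by positivity, fun x hx hxr => ?_⟩
    have hxρ := (hxr.trans_le (min_le_left _ _)).le
    have hxσ := hxr.trans_le (min_le_right _ _)
    obtain ⟨H1, H2⟩ := H x₀ x hx₀.2.2 hx₀.2.1 hxρ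
    have H3 := H2 (x - x₀)
    have H4 : work F x (x₀ - x) = - work F x (x - x₀) := by
      have := h.work_combo (fun t => ne_zero_of_le_norm hδ (hx.2.2 t)) (x - x₀) 0 (-1) 0
      rw [neg_one_mul, zero_mul, add_zero] at this
      rw [← this]; congr 1; module
    refine le_max_of_le_right ?_
    unfold variation
    rw [H4]
    rw [abs_le] at H1 H3
    have hd : action c μ V x₀ = C - 3 * σ := by rw [hσ]; ring
    simp only [action, work, ContinuousMap.sub_apply] at *
    linarith
  · obtain ⟨y, hy, hQ⟩ := hcrit x₀ hx₀.1 hx0 (not_lt.1 hlt)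
    set θ := 1 / (1 + ‖y - x₀‖) with hθ
    have hθ0 : 0 < θ := by positivity
    have hθ1 : θ ≤ 1 := by
      rw [hθ, div_le_one (by positivity)]; linarith [norm_nonneg (y - x₀)]
    have hθn : θ * ‖y - x₀‖ ≤ 1 := by
      rw [hθ, one_div_mul_eq_div, div_le_one (by positivity)]; linarith
    set z := (1 - θ) • x₀ + θ • y with hz
    have hzs : SpeedLE c z := convex_speedLE hx₀.1 hy (by linarith) hθ0.le (by ring)
    have hzx : z - x₀ = θ • (y - x₀) := by rw [hz]; module
    have hzR : ‖z‖ ≤ R := by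
      have h1 := h.norm_le_of_le_action hc hα hx₀.1 hx0 (hC.trans (not_lt.1 hlt))
      have h2 := norm_sub_norm_le z x₀
      rw [hzx, norm_smul, Real.norm_of_nonneg hθ0.le] at h2
      linarith
    have hQz : variation c μ F x₀ z < 0 := by
      have := h.variation_combo_le (μ := μ) hc hx0 hx₀.1 hy (sub_nonneg.2 hθ1) hθ0.le
        (sub_add_cancel 1 θ)
      rw [variation_self, mul_zero, zero_add] at this
      exact this.trans_lt (mul_neg_of_pos_of_neg hθ0 hQ)
    set σ := -variation c μ F x₀ z / 4 with hσ
    have hσ0 : 0 < σ := by rw [hσ]; linarith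
    have hR0 : 0 < R := by have := mul_pos hc hT.out; linarith
    obtain ⟨ρ, hρ, -, H⟩ := h.exists_integral_taylor R hδ (e := σ / (2 * R)) (by positivity)
    obtain ⟨r, hr, hk⟩ := exists_kin_lower (μ := μ) hc x₀ hσ0
    refine ⟨z, ⟨hzs, hzR⟩, σ, hσ0, min (min ρ r) (σ / (M + 1)), by positivity, fun x hx hxr => ?_⟩
    have hxρ := (hxr.trans_le ((min_le_left _ _).trans (min_le_left _ _))).le
    have hxr' := hxr.trans_le ((min_le_left _ _).trans (min_le_right _ _))
    have hxM := hxr.trans_le (min_le_right _ _)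
    rw [lt_div_iff₀ (by positivity)] at hxM
    have H1 := (H x₀ x hx₀.2.2 hx₀.2.1 hxρ).2 (z - x)
    have H2 := hk x hx.1 hxr'
    have H3 : work F x₀ (z - x) = work F x₀ (z - x₀) - work F x₀ (x - x₀) := by
      have := h.work_combo hx0 (z - x₀) (x - x₀) 1 (-1)
      rw [one_mul, neg_one_mul, ← sub_eq_add_neg] at this
      rw [← this]; congr 1; module
    have H4 := hM (x - x₀)
    have H5 : σ / (2 * R) * ‖z - x‖ ≤ σ := by
      have : ‖z - x‖ ≤ 2 * R := (norm_sub_le z x).trans (by linarith [hx.2.1])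
      calc σ / (2 * R) * ‖z - x‖ ≤ σ / (2 * R) * (2 * R) := by gcongr
        _ = σ := by field_simp
    have H6 : variation c μ F x₀ z = -(4 * σ) := by rw [hσ]; ring
    refine le_max_of_le_left ?_
    change |work F x (z - x) - work F x₀ (z - x)| ≤ _ at H1
    rw [abs_le] at H1 H4
    unfold variation at H6 ⊢
    have H7 : M * ‖x - x₀‖ < σ := lt_of_le_of_lt (by nlinarith [norm_nonneg (x - x₀)]) hxM
    linarith

lemma IsPotential.exists_uniform_descent (h : IsPotential T α S V F) (hc : 0 < c) (hα : 0 < α)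
    {C R δ : ℝ} (hδ : 0 < δ) (hC : c * μ * T + T * (α + S) + 1 ≤ C) (hR : 2 + c * T ≤ R)
    (hcrit : ∀ x : C(AddCircle T, E3), SpeedLE c x → (∀ t : ℝ, x t ≠ 0) → C ≤ action c μ V x →
      ∃ y, SpeedLE c y ∧ variation c μ F x y < 0) :
    ∃ σ > 0, ∃ y : farLoops T c R δ → C(AddCircle T, E3), Continuous y ∧ ∀ x,
      (SpeedLE c (y x) ∧ ‖y x‖ ≤ R) ∧
      variation c μ F x.1 (y x) ≤ max (-σ) (C - 2 * σ - action c μ V x.1) := by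
  obtain ⟨σ, hσ, H⟩ : ∃ σ > 0, ∀ x₀ ∈ farLoops T c R δ, ∃ y, (SpeedLE c y ∧ ‖y‖ ≤ R) ∧
      ∃ r > 0, ∀ x ∈ farLoops T c R δ, ‖x - x₀‖ < r →
      variation c μ F x y ≤ max (-σ) (C - 2 * σ - action c μ V x) := by
    have hmono : ∀ {σ σ' a : ℝ}, σ' ≤ σ → max (-σ) (C - 2 * σ - a) ≤ max (-σ') (C - 2 * σ' - a) :=
      fun hσ => max_le_max (by linarith) (by linarith)
    refine (isCompact_farLoops (T := T) hc R δ).induction_on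
      (p := fun s => ∃ σ > 0, ∀ x₀ ∈ s, ∃ y, (SpeedLE c y ∧ ‖y‖ ≤ R) ∧
      ∃ r > 0, ∀ x ∈ farLoops T c R δ, ‖x - x₀‖ < r →
      variation c μ F x y ≤ max (-σ) (C - 2 * σ - action c μ V x)) ⟨1, one_pos, by simp⟩ ?_ ?_ ?_
    · rintro s t hst ⟨σ, hσ, H⟩
      exact ⟨σ, hσ, fun x hx => H x (hst hx)⟩
    · rintro s t ⟨σ, hσ, H⟩ ⟨σ', hσ', H'⟩
      refine ⟨min σ σ', by positivity, ?_⟩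
      rintro x (hx | hx)
      · obtain ⟨y, hy, r, hr, hyr⟩ := H x hx
        exact ⟨y, hy, r, hr, fun x hx hxr => (hyr x hx hxr).trans (hmono (min_le_left _ _))⟩
      · obtain ⟨y, hy, r, hr, hyr⟩ := H' x hx
        exact ⟨y, hy, r, hr, fun x hx hxr => (hyr x hx hxr).trans (hmono (min_le_right _ _))⟩
    · intro x₀ hx₀
      obtain ⟨y, hy, σ, hσ, r, hr, H⟩ := h.exists_local_descent hc hα hδ hC hR hcrit hx₀
      refine ⟨_, mem_nhdsWithin_of_mem_nhds (Metric.ball_mem_nhds x₀ (half_pos hr)), σ, hσ,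
        fun x₁ hx₁ => ⟨y, hy, r / 2, half_pos hr, fun x hx hxr => H x hx ?_⟩⟩
      rw [mem_ball_iff_norm] at hx₁
      have := norm_sub_le_norm_sub_add_norm_sub x x₁ x₀
      linarith
  obtain ⟨g, hg⟩ := exists_continuous_forall_mem_convex_of_local_const
    (X := farLoops T c R δ) (E := C(AddCircle T, E3))
    (t := fun x => {y | SpeedLE c y ∧ ‖y‖ ≤ R} ∩
      {y | SpeedLE c y ∧ variation c μ F x.1 y ≤ max (-σ) (C - 2 * σ - action c μ V x.1)})
    (fun x => (convex_ball_speedLE R).inter fun y hy z hz a b ha hb hab =>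
      ⟨convex_speedLE hy.1 hz.1 ha hb hab, by
        refine (h.variation_combo_le hc (fun t => ne_zero_of_le_norm hδ (x.2.2.2 t))
          hy.1 hz.1 ha hb hab).trans ?_
        have h1 := mul_le_mul_of_nonneg_left hy.2 ha
        have h2 := mul_le_mul_of_nonneg_left hz.2 hb
        set m := max (-σ) (C - 2 * σ - action c μ V x.1)
        have h3 : a * m + b * m = m := by rw [← add_mul, hab, one_mul]
        linarith⟩)
    (fun x => by
      obtain ⟨y, hy, r, hr, H'⟩ := H x.1 x.2
      refine ⟨y, ?_⟩
      filter_upwards [Metric.ball_mem_nhds x hr] with x' hx'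
      rw [Metric.mem_ball, Subtype.dist_eq, dist_eq_norm] at hx'
      exact ⟨hy, hy.1, H' x' x'.2 hx'⟩)
  exact ⟨σ, hσ, g, g.continuous, fun x => ⟨(hg x).1, (hg x).2.2⟩⟩

end

lemma loopFamily_of_continuous {T : ℝ} {n : ℕ} {f : (Fin n → ℝ) → C(AddCircle T, E3)} (hf : Continuous f)
    (hper : ∀ s (z : Fin n → ℤ), f (s + fun i => (z i : ℝ)) = f s) :
    LoopFamily fun s u => f s ((T * u : ℝ) : AddCircle T) where
  cont := by
    have h1 : Continuous fun p : (Fin n → ℝ) × ℝ => ((T * p.2 : ℝ) : AddCircle T) :=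
      (AddCircle.continuous_mk' T).comp (continuous_const.mul continuous_snd)
    exact (hf.comp continuous_fst).eval h1
  per s z u := by rw [hper]
  closed s := by simp [AddCircle.coe_period]

section

variable {T α S c μ : ℝ} {V : ℝ → E3 → ℝ} {F : ℝ → E3 → E3} [hT : Fact (0 < T)]

/-- Essential periodic families of admissible loops of norm at most `R` and action at most `A`. -/
structure LowFamily (c μ : ℝ) (V : ℝ → E3 → ℝ) (R A : ℝ) {n : ℕ}
    (f : (Fin (n + 1) → ℝ) → C(AddCircle T, E3)) : Prop where
  cont : Continuous f
  per : ∀ s (z : Fin (n + 1) → ℤ), f (s + fun i => (z i : ℝ)) = f s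
  speed : ∀ s, SpeedLE c (f s)
  norm_le : ∀ s, ‖f s‖ ≤ R
  ne_zero : ∀ s (t : ℝ), f s t ≠ 0
  action_le : ∀ s, action c μ V (f s) ≤ A
  essential : Essential fun s u => f s ((T * u : ℝ) : AddCircle T)

/-- One step of the deformation: without critical loops of action at least `C`, a family of loops
can be pushed down by a fixed amount. -/
lemma IsPotential.exists_deformation (h : IsPotential T α S V F) (hc : 0 < c) (hμ : 0 < μ)
    (hα : 0 < α) {C C₁ R : ℝ} (hC : c * μ * T + T * (α + S) + 1 ≤ C) (hC₁ : C ≤ C₁)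
    (hR : 2 + c * T ≤ R)
    (hcrit : ∀ x : C(AddCircle T, E3), SpeedLE c x → (∀ t : ℝ, x t ≠ 0) → C ≤ action c μ V x →
      ∃ y, SpeedLE c y ∧ variation c μ F x y < 0) (n : ℕ) :
    ∃ κ > 0, ∀ A, C ≤ A → A ≤ C₁ → ∀ f : (Fin (n + 1) → ℝ) → C(AddCircle T, E3),
      LowFamily c μ V R A f → ∃ f' : (Fin (n + 1) → ℝ) → C(AddCircle T, E3),
        LowFamily c μ V R (max (A - κ) C) f' := by
  have hT0 := hT.out
  have hR0 : 0 < R := by have := mul_pos hc hT0; linarith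
  obtain ⟨δ, hδ, hfar⟩ := h.exists_le_norm (μ := μ) hc hμ hα C₁
  obtain ⟨σ, hσ, y, hyc, hy⟩ := h.exists_uniform_descent hc hα hδ hC hR hcrit
  obtain ⟨ρ, hρ, hρδ, H⟩ := h.exists_integral_taylor R hδ (e := σ / (4 * R)) (by positivity)
  set b := 8 * R / δ + 1 with hb
  have hb0 : 0 < b := by positivity
  set τ := min 1 (min ρ (δ / 30 / b) / (2 * R)) with hτ
  have hτ0 : 0 < τ := by positivity
  have hτ1 : τ ≤ 1 := min_le_left _ _
  have hτR : τ * (2 * R) ≤ min ρ (δ / 30 / b) := by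
    have := min_le_right 1 (min ρ (δ / 30 / b) / (2 * R))
    rwa [← hτ, le_div_iff₀ (by positivity)] at this
  refine ⟨τ * σ / 2, by positivity, fun A hCA hAC f hf => ?_⟩
  have hmem : ∀ s, f s ∈ farLoops T c R δ := fun s =>
    ⟨hf.speed s, hf.norm_le s, hfar _ (hf.speed s) (hf.ne_zero s) ((hf.action_le s).trans hAC)⟩
  set Y := fun s => y ⟨f s, hmem s⟩ with hY
  have hYc : Continuous Y := hyc.comp (hf.cont.subtype_mk hmem)
  set f' := fun s => (1 - τ) • f s + τ • Y s with hf'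
  have hdiff : ∀ s, f' s - f s = τ • (Y s - f s) := fun s => by rw [hf']; module
  have hYf : ∀ s, ‖Y s - f s‖ ≤ 2 * R := fun s =>
    (norm_sub_le _ _).trans (by linarith [(hy ⟨f s, hmem s⟩).1.2, hf.norm_le s])
  have hclose : ∀ s, ‖f' s - f s‖ ≤ τ * (2 * R) := fun s => by
    rw [hdiff, norm_smul, Real.norm_of_nonneg hτ0.le]
    exact mul_le_mul_of_nonneg_left (hYf s) hτ0.le
  have hball : ∀ s, SpeedLE c (f' s) ∧ ‖f' s‖ ≤ R := fun s =>
    convex_ball_speedLE R ⟨hf.speed s, hf.norm_le s⟩ (hy ⟨f s, hmem s⟩).1 (sub_nonneg.2 hτ1) hτ0.le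
      (sub_add_cancel 1 τ)
  have hpt : ∀ s (t : AddCircle T), ‖f s t - f' s t‖ ≤ τ * (2 * R) := fun s t => by
    rw [norm_sub_rev]
    exact (ContinuousMap.norm_coe_le_norm (f' s - f s) t).trans (hclose s)
  have hne : ∀ s (t : ℝ), f' s t ≠ 0 := fun s t => by
    refine ne_zero_of_le_norm (half_pos hδ) ?_
    have h1 := norm_sub_norm_le (f s t) (f' s t)
    have h2 := hpt s t
    have h3 := (hmem s).2.2 t
    have h4 := hτR.trans (min_le_left _ _)
    linarith
  have hact : ∀ s, action c μ V (f' s) ≤ max (A - τ * σ / 2) C := fun s => by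
    obtain ⟨H1, -⟩ := H (f s) (f' s) (hmem s).2.2 (hf.norm_le s)
      ((hclose s).trans (hτR.trans (min_le_left _ _)))
    have H2 := (hy ⟨f s, hmem s⟩).2
    have H3 := (convexOn_kin (μ := μ) hc).2 (hf.speed s) (hy ⟨f s, hmem s⟩).1.1 (sub_nonneg.2 hτ1)
      hτ0.le (sub_add_cancel 1 τ)
    have H4 : work F (f s) (f' s - f s) = τ * work F (f s) (Y s - f s) := by
      have := h.work_combo (hf.ne_zero s) (Y s - f s) 0 τ 0
      rw [zero_mul, add_zero] at this
      rw [hdiff, ← this]; congr 1; module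
    have H5 : σ / (4 * R) * ‖f' s - f s‖ ≤ τ * σ / 2 := by
      calc σ / (4 * R) * ‖f' s - f s‖ ≤ σ / (4 * R) * (τ * (2 * R)) := by gcongr; exact hclose s
        _ = τ * σ / 2 := by field_simp; norm_num
    change |_ - _ - work F (f s) (f' s - f s)| ≤ _ at H1
    change variation c μ F (f s) (Y s) ≤ max (-σ) (C - 2 * σ - action c μ V (f s)) at H2
    change kin c μ (f' s) ≤ (1 - τ) * kin c μ (f s) + τ * kin c μ (Y s) at H3
    rw [H4, abs_le] at H1
    have H6 : action c μ V (f' s) ≤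
        action c μ V (f s) + τ * variation c μ F (f s) (Y s) + τ * σ / 2 := by
      unfold action variation
      linarith
    have H7 := hf.action_le s
    rcases le_max_iff.1 H2 with H8 | H8
    · refine le_max_of_le_left ?_
      have := mul_le_mul_of_nonneg_left H8 hτ0.le
      linarith
    · have H9 := mul_le_mul_of_nonneg_left H8 hτ0.le
      rcases le_total (C - σ) (action c μ V (f s)) with H10 | H10
      · refine le_max_of_le_left ?_
        have := mul_le_mul_of_nonneg_left H10 hτ0.le
        linarith
      · refine le_max_of_le_right ?_
        have := mul_le_mul_of_nonneg_left H10 (sub_nonneg.2 hτ1)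
        have := mul_pos hτ0 hσ
        linarith
  have hc' : Continuous f' := (hf.cont.const_smul (1 - τ)).add (hYc.const_smul τ)
  have hper' : ∀ s (z : Fin (n + 1) → ℤ), f' (s + fun i => (z i : ℝ)) = f' s := fun s z => by
    simp only [hf', hY, hf.per]
  have hmaxC : max (A - τ * σ / 2) C ≤ C₁ :=
    max_le (by have := mul_pos hτ0 hσ; linarith) hC₁
  refine ⟨f', hc', hper', fun s => (hball s).1, fun s => (hball s).2, hne, hact, ?_⟩
  have hin : ∀ u : ℝ, ∃ t : ℝ, ((T * u : ℝ) : AddCircle T) = t := fun u => ⟨_, rfl⟩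
  refine hf.essential.of_close (loopFamily_of_continuous hf.cont hf.per)
    (loopFamily_of_continuous hc' hper') hδ (B := R) (r := τ * (2 * R))
    (fun s u => (hmem s).2.2 _)
    (fun s u => hfar _ (hball s).1 (hne s) ((hact s).trans hmaxC) _)
    (fun s u => ((f' s).norm_coe_le_norm _).trans (hball s).2) (fun s u => hpt s _) ?_
  have := hτR.trans (min_le_right _ _)
  rwa [le_div_iff₀ hb0] at this

/-- There are critical loops of arbitrarily large action. -/
lemma IsPotential.exists_critical (h : IsPotential T α S V F) (hc : 0 < c) (hμ : 0 < μ)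
    (hα : 0 < α) (C : ℝ) : ∃ x : C(AddCircle T, E3), SpeedLE c x ∧ (∀ t : ℝ, x t ≠ 0) ∧
      C ≤ action c μ V x ∧ ∀ y, SpeedLE c y → 0 ≤ variation c μ F x y := by
  wlog hC : c * μ * T + T * (α + S) + 1 ≤ C generalizing C
  · obtain ⟨x, h1, h2, h3, h4⟩ := this _ le_rfl
    exact ⟨x, h1, h2, (not_le.1 hC).le.trans h3, h4⟩
  by_contra! hcrit
  have hT0 := hT.out
  obtain ⟨δ, hδ, hfar⟩ := h.exists_le_norm (μ := μ) hc hμ hα C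
  obtain ⟨n, hn⟩ := exists_nat_gt (c * T / δ)
  rw [div_lt_iff₀ hδ] at hn
  obtain ⟨f, hf, hper, hspeed, ⟨δ₀, hδ₀, hf0⟩, ⟨B, hB⟩, hess⟩ := exists_essential T hc n
  set C₁ := max C (c * μ * T + T * (α / δ₀ + S))
  set R := max B (2 + c * T)
  have hlow : LowFamily c μ V R C₁ f := by
    have hne : ∀ s (t : ℝ), f s t ≠ 0 := fun s t => ne_zero_of_le_norm hδ₀ (hf0 s _)
    refine ⟨hf, hper, hspeed, fun s => (hB s).trans (le_max_left _ _), hne, fun s =>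
      le_max_of_le_right ?_, hess⟩
    have h1 := kin_le_const (μ := μ) hc (hspeed s)
    have h2 : ∫ t in (0 : ℝ)..T, V t (f s t) ≤ ∫ _ in (0 : ℝ)..T, (α / δ₀ + S) :=
      intervalIntegral.integral_mono_on hT0.le
        ((h.continuous_comp (continuous_loop (f s)) (hne s)).intervalIntegrable _ _)
        (continuous_const.intervalIntegrable _ _) fun t _ => (h.upper t _).trans (by
          have := hf0 s t
          gcongr)
    rw [intervalIntegral.integral_const, smul_eq_mul, sub_zero] at h2
    unfold action
    linarith
  obtain ⟨κ, hκ, hstep⟩ := h.exists_deformation hc hμ hα hC (le_max_left C _ : C ≤ C₁)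
    (le_max_right _ _ : _ ≤ R) hcrit n
  have hiter : ∀ k : ℕ, ∃ f : (Fin (n + 1) → ℝ) → C(AddCircle T, E3),
      LowFamily c μ V R (max (C₁ - k * κ) C) f := by
    intro k
    induction k with
    | zero => exact ⟨f, by simpa [C₁] using hlow⟩
    | succ k ih =>
      obtain ⟨g, hg⟩ := ih
      obtain ⟨g', hg'⟩ := hstep _ (le_max_right _ _)
        (max_le (by have : 0 ≤ k * κ := by positivity
                    linarith) (le_max_left _ _)) g hg
      refine ⟨g', { hg' with action_le := fun s => (hg'.action_le s).trans (max_le ?_ (le_max_right _ _)) }⟩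
      have h1 := le_max_left (C₁ - (k + 1 : ℕ) * κ) C
      have h2 := le_max_right (C₁ - (k + 1 : ℕ) * κ) C
      push_cast at h1 h2 ⊢
      exact sub_le_iff_le_add.2 (max_le (by linarith) (by linarith))
  obtain ⟨k, hk⟩ := exists_nat_gt ((C₁ - C) / κ)
  rw [div_lt_iff₀ hκ] at hk
  obtain ⟨g, hg⟩ := hiter k
  have hgC : ∀ s, action c μ V (g s) ≤ C := fun s =>
    (hg.action_le s).trans (max_le (by linarith) le_rfl)
  have := hg.essential.lipschitz_bound (loopFamily_of_continuous hg.cont hg.per) hδ (Λ := c * T)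
    (fun s u => hfar _ (hg.speed s) (hg.ne_zero s) (hgC s) _)
    (fun s u u' => (hg.speed s _ _).trans (le_of_eq (by
      rw [← mul_sub, abs_mul, abs_of_pos hT0, mul_assoc])))
  push_cast at this
  linarith

end

section

variable {T α : ℝ} {U : ℝ → E3 → ℝ}

lemma hasGradientAt_of_contDiff (hU : ContDiff ℝ 1 fun p : ℝ × E3 => U p.1 p.2) (t : ℝ) (p : E3) :
    HasGradientAt (U t) (gradient (U t) p) p := by
  have h1 : ContDiff ℝ 1 (U t) := hU.comp (contDiff_const.prodMk contDiff_id)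
  exact (h1.differentiable one_ne_zero p).hasGradientAt

lemma continuous_gradient_of_contDiff (hU : ContDiff ℝ 1 fun p : ℝ × E3 => U p.1 p.2) :
    Continuous fun p : ℝ × E3 => gradient (U p.1) p.2 := by
  have e : (fun p : ℝ × E3 => gradient (U p.1) p.2) = fun p => (InnerProductSpace.toDual ℝ E3).symm
      ((fderiv ℝ (fun p : ℝ × E3 => U p.1 p.2) p).comp (ContinuousLinearMap.inr ℝ ℝ E3)) := by
    funext p
    have h1 : HasFDerivAt (fun x : E3 => ((p.1, x) : ℝ × E3)) (ContinuousLinearMap.inr ℝ ℝ E3) p.2 :=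
      hasFDerivAt_prodMk_right p.1 p.2
    have h2 : HasFDerivAt (U p.1) ((fderiv ℝ (fun p : ℝ × E3 => U p.1 p.2) p).comp
        (ContinuousLinearMap.inr ℝ ℝ E3)) p.2 :=
      HasFDerivAt.comp p.2 (hU.differentiable one_ne_zero (p.1, p.2)).hasFDerivAt h1
    rw [gradient, h2.fderiv]
  rw [e]
  refine (LinearIsometryEquiv.continuous _).comp ?_
  exact (hU.continuous_fderiv one_ne_zero).clm_comp continuous_const

lemma hasGradientAt_div_norm (α : ℝ) {p : E3} (hp : p ≠ 0) :
    HasGradientAt (fun x : E3 => α / ‖x‖) (-(α / ‖p‖ ^ 3) • p) p := by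
  have hn : ‖p‖ ≠ 0 := norm_ne_zero_iff.2 hp
  have h1 : HasFDerivAt (fun x : E3 => ‖x‖ ^ 2) (2 • innerSL ℝ p) p :=
    (hasStrictFDerivAt_norm_sq p).hasFDerivAt
  have h2 : HasDerivAt (fun y : ℝ => α / Real.sqrt y) (-(α / (2 * ‖p‖ ^ 3))) (‖p‖ ^ 2) := by
    have hs : Real.sqrt (‖p‖ ^ 2) = ‖p‖ := Real.sqrt_sq (norm_nonneg p)
    refine ((hasDerivAt_const _ α).div (Real.hasDerivAt_sqrt (by positivity))
      (by rwa [hs])).congr_deriv ?_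
    rw [hs]; field_simp; ring
  have h3 := h2.comp_hasFDerivAt p h1
  rw [hasGradientAt_iff_hasFDerivAt]
  refine (h3.congr_fderiv ?_).congr_of_eventuallyEq (Filter.Eventually.of_forall fun x => ?_)
  · ext z
    simp
    field_simp
  · simp [Real.sqrt_sq (norm_nonneg x)]

lemma exists_potential_bound (hT : 0 < T) (hU : Continuous fun p : ℝ × E3 => U p.1 p.2)
    (hper : Periodic U T)
    (hdecay : ∀ ε > (0 : ℝ), ∃ R, ∀ t x, R < ‖x‖ → |U t x| + ‖gradient (U t) x‖ < ε) :
    ∃ S, ∀ t x, U t x ≤ S := by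
  obtain ⟨R, hR⟩ := hdecay 1 one_pos
  have hK : IsCompact (Set.Icc 0 T ×ˢ Metric.closedBall (0 : E3) R) :=
    isCompact_Icc.prod (isCompact_closedBall _ _)
  obtain ⟨S, hS⟩ := hK.bddAbove_image hU.continuousOn
  refine ⟨max S 1, fun t x => ?_⟩
  by_cases hx : R < ‖x‖
  · have := hR t x hx
    exact le_max_of_le_right (by linarith [le_abs_self (U t x), norm_nonneg (gradient (U t) x)])
  · obtain ⟨s, hs, hst⟩ := hper.exists_mem_Ico₀ hT t
    rw [hst]
    exact le_max_of_le_left (hS ⟨(s, x), ⟨⟨hs.1, hs.2.le⟩, by simpa using hx⟩, rfl⟩)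

lemma exists_isPotential (hT : 0 < T) (hU : ContDiff ℝ 1 fun p : ℝ × E3 => U p.1 p.2)
    (hper : ∀ t x, U (t + T) x = U t x) (hpos : ∀ t x, 0 < U t x)
    (hdecay : ∀ ε > (0 : ℝ), ∃ R, ∀ t x, R < ‖x‖ → |U t x| + ‖gradient (U t) x‖ < ε) :
    ∃ S, IsPotential T α S (fun t p => α / ‖p‖ + U t p)
      fun t p => -(α / ‖p‖ ^ 3) • p + gradient (U t) p := by
  have hper' : Periodic U T := fun t => funext fun x => hper t x
  obtain ⟨S, hS⟩ := exists_potential_bound hT hU.continuous hper' hdecay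
  refine ⟨S, ?_, ?_, fun t => ?_, fun t => ?_, fun t p hp => ?_, fun t p => ?_, fun t p => ?_⟩
  · exact (continuousOn_const.div continuous_snd.norm.continuousOn fun p hp =>
      norm_ne_zero_iff.2 hp).add hU.continuous.continuousOn
  · refine ContinuousOn.add ?_ (continuous_gradient_of_contDiff hU).continuousOn
    exact ((continuousOn_const.div (continuous_snd.norm.pow 3).continuousOn fun p hp =>
      pow_ne_zero 3 (norm_ne_zero_iff.2 hp)).neg).smul continuous_snd.continuousOn
  · simp only [hper' t]
  · simp only [hper' t]
  · have h1 := hasGradientAt_iff_hasFDerivAt.1 (hasGradientAt_div_norm α hp)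
    have h2 := hasGradientAt_iff_hasFDerivAt.1 (hasGradientAt_of_contDiff hU t p)
    rw [hasGradientAt_iff_hasFDerivAt, map_add]
    exact h1.add h2
  · linarith [hpos t p]
  · linarith [hS t p]

/-- Critical loops solve the relativistic equation with force field `F`. -/
lemma isSolution_of_critical {c m S : ℝ} {V : ℝ → E3 → ℝ} {F : ℝ → E3 → E3} [hT : Fact (0 < T)]
    (h : IsPotential T α S V F) (hc : 0 < c) (hm : 0 < m) {x : C(AddCircle T, E3)}
    (hx : SpeedLE c x) (h0 : ∀ t : ℝ, x t ≠ 0)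
    (hcrit : ∀ y, SpeedLE c y → 0 ≤ variation c (m * c) F x y) :
    ContDiff ℝ 1 (fun t : ℝ => x t) ∧ (∀ t, ‖deriv (fun t : ℝ => x t) t‖ < c) ∧
      ∀ t : ℝ, HasDerivAt (fun s : ℝ =>
        (Real.sqrt (1 - ‖deriv (fun t : ℝ => x t) s‖ ^ 2 / c ^ 2))⁻¹ •
          (m • deriv (fun t : ℝ => x t) s)) (F t (x t)) t := by
  have hμ : 0 < m * c := by positivity
  obtain ⟨q, hq, hxq⟩ := exists_momentum (μ := m * c) hc hμ hx
    (h.continuous_force_comp (continuous_loop x) h0) (fun t => by simp [h.per_force t]) hcrit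
  have hqc : Continuous q := continuous_iff_continuousAt.2 fun t => (hq t).continuousAt
  have hd : deriv (fun t : ℝ => x t) = fun t => velocity c (m * c) (q t) :=
    funext fun t => (hxq t).deriv
  refine ⟨contDiff_one_iff_deriv.2 ⟨fun t => (hxq t).differentiableAt, ?_⟩, fun t => ?_, fun t => ?_⟩
  · rw [hd]; exact (continuous_velocity hμ).comp hqc
  · rw [hd]; exact norm_velocity_lt hc hμ _
  · simp only [hd, momentum_velocity hc hm]
    exact hq t

end

/-- **Theorem (forced relativistic Kepler problem).** If `U` is `C¹`, `T`-periodic in time,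
positive, and `|U| + |∇ₓU| → 0` as `|x| → ∞` uniformly in `t`, then the equation
`d/dt(mẋ/√(1-|ẋ|²/c²)) = -α x/|x|³ + ∇ₓU(t,x)` has infinitely many `T`-periodic classical
solutions avoiding the origin. -/
theorem kepler_infinitely_many_periodic_solutions
    (T c m α : ℝ) (hT : 0 < T) (hc : 0 < c) (hm : 0 < m) (hα : 0 < α)
    (U : ℝ → E3 → ℝ)
    (hU_C1 : ContDiff ℝ 1 (fun p : ℝ × E3 => U p.1 p.2))
    (hU_per : ∀ t x, U (t + T) x = U t x)
    (hU_pos : ∀ t x, 0 < U t x)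
    (hU_decay : ∀ ε > (0:ℝ), ∃ R : ℝ, ∀ (t : ℝ) (x : E3), R < ‖x‖ →
      |U t x| + ‖gradient (U t) x‖ < ε) :
    {x : ℝ → E3 |
      Periodic x T ∧ ContDiff ℝ 1 x ∧ (∀ t, x t ≠ 0) ∧ (∀ t, ‖deriv x t‖ < c) ∧
      ∀ t : ℝ, HasDerivAt
        (fun s => (Real.sqrt (1 - ‖deriv x s‖ ^ 2 / c ^ 2))⁻¹ • (m • deriv x s))
        (-(α / ‖x t‖ ^ 3) • x t + gradient (U t) (x t)) t}.Infinite := by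
  have hTf : Fact (0 < T) := ⟨hT⟩
  have hμ : 0 < m * c := by positivity
  obtain ⟨S, h⟩ := exists_isPotential (α := α) hT hU_C1 hU_per hU_pos hU_decay
  set V : ℝ → E3 → ℝ := fun t p => α / ‖p‖ + U t p
  intro hfin
  set A : Set C(AddCircle T, E3) := {x | SpeedLE c x ∧ (∀ t : ℝ, x t ≠ 0) ∧
    ∀ y, SpeedLE c y → 0 ≤ variation c (m * c)
      (fun t p => -(α / ‖p‖ ^ 3) • p + gradient (U t) p) x y} with hA
  have hAfin : A.Finite := by
    refine Set.Finite.of_finite_image (f := fun x (t : ℝ) => x (t : AddCircle T))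
      (hfin.subset ?_) ?_
    · rintro _ ⟨x, hx, rfl⟩
      obtain ⟨h1, h2, h3⟩ := isSolution_of_critical h hc hm hx.1 hx.2.1 hx.2.2
      exact ⟨periodic_loop x, h1, hx.2.1, h2, h3⟩
    · intro x _ y _ hxy
      ext1 t
      obtain ⟨s, rfl⟩ := QuotientAddGroup.mk_surjective t
      exact congrFun hxy s
  obtain ⟨M, hM⟩ := (hAfin.image (action c (m * c) V)).bddAbove
  obtain ⟨x, hx, h0, hMx, hcrit⟩ := h.exists_critical hc hμ hα (M + 1)
  have := hM ⟨x, ⟨hx, h0, hcrit⟩, rfl⟩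
  linarith
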